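/- arXiv:1703.06616 — 5 statements merged into one kernel-verified Lean document; each statement's English description precedes it below -/
import Mathlib

section
/- Let H be a Hall universal group. Then Aut(H) has ample generics: for every n ≥ 1, the diagonal conjugacy action of Aut(H) on Aut(H)ⁿ has a comeager orbit, i.e., there exist g₁,…,gₙ ∈ Aut(H) such that the set { (f g₁ f⁻¹, …, f gₙ f⁻¹) : f ∈ Aut(H) } is comeager in Aut(H)ⁿ with the product topology. -/
/-- A group `H` is a *Hall universal group* if it is countable, locally finite,
every finite group embeds into it, and any two isomorphic finite subgroups are
conjugate in `H`.  (Philip Hall's universal locally finite group is the unique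
such group up to isomorphism.) -/
structure IsHallUniversal (H : Type*) [Group H] : Prop where
  /-- `H` is countable. -/
  countable : Countable H
  /-- `H` is locally finite: every finitely generated subgroup is finite. -/
  locallyFinite : ∀ S : Subgroup H, S.FG → Finite S
  /-- Every finite group embeds into `H`. -/
  embedsFinite : ∀ (G : Type) [Group G] [Finite G], ∃ f : G →* H, Function.Injective f
  /-- Any two isomorphic finite subgroups of `H` are conjugate in `H`. -/
  conjIso : ∀ A B : Subgroup H, Finite A → Finite B → Nonempty (A ≃* B) →
    ∃ h : H, Subgroup.map (MulAut.conj h).toMonoidHom A = B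

/-- The topology of pointwise convergence on `Aut H`: the topology induced by viewing an
automorphism `f` as the function `f : H → H` in the product space `H → H`, where `H`
carries the discrete topology. -/
instance hallAutTopology (H : Type*) [Group H] : TopologicalSpace (MulAut H) :=
  letI : TopologicalSpace H := ⊥
  TopologicalSpace.induced (fun f : MulAut H => (f : H → H)) Pi.topologicalSpace


set_option linter.style.haveILetI false

namespace HallAmple

variable {H : Type*} [Group H]

theorem isInducing_eval (n : ℕ) :
    letI : TopologicalSpace H := ⊥
    Topology.IsInducing (fun (g : Fin n → MulAut H) (p : Fin n × H) => g p.1 p.2) := by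
  letI : TopologicalSpace H := ⊥
  constructor
  simp only [Pi.topologicalSpace, hallAutTopology, induced_iInf, induced_compose, iInf_prod]
  rfl

theorem isOpen_eval {n : ℕ} (i : Fin n) (x y : H) :
    IsOpen {g : Fin n → MulAut H | g i x = y} := by
  letI : TopologicalSpace H := ⊥
  haveI : DiscreteTopology H := ⟨rfl⟩
  have h := (isInducing_eval (H := H) n).continuous
  have h2 : Continuous (fun g : Fin n → MulAut H => g i x) :=
    (continuous_apply (A := fun _ : Fin n × H => H) (i, x)).comp h
  exact (isOpen_discrete ({y} : Set H)).preimage h2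

theorem isOpen_eval_rel {n : ℕ} (i : Fin n) (x : H) (s : Set H) :
    IsOpen {g : Fin n → MulAut H | g i x ∈ s} := by
  have : {g : Fin n → MulAut H | g i x ∈ s} = ⋃ y ∈ s, {g | g i x = y} := by
    ext g; simp
  rw [this]
  exact isOpen_biUnion fun y _ => isOpen_eval i x y

theorem exists_finset_of_isOpen {n : ℕ} {U : Set (Fin n → MulAut H)} (hU : IsOpen U)
    {g : Fin n → MulAut H} (hg : g ∈ U) :
    ∃ T : Finset H, ∀ g' : Fin n → MulAut H, (∀ i, ∀ x ∈ T, g' i x = g i x) → g' ∈ U := by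
  classical
  letI : TopologicalSpace H := ⊥
  obtain ⟨V, hV, rfl⟩ := (isInducing_eval (H := H) n).isOpen_iff.1 hU
  obtain ⟨I, u, hu, hsub⟩ := isOpen_pi_iff.1 hV _ hg
  refine ⟨I.image Prod.snd, fun g' hg' => hsub ?_⟩
  intro p hp
  have : g' p.1 p.2 = g p.1 p.2 := hg' _ _ (Finset.mem_image_of_mem _ hp)
  simp only [this]
  exact (hu p hp).2

theorem baire [Countable H] (n : ℕ) : BaireSpace (Fin n → MulAut H) := by
  letI : TopologicalSpace H := ⊥
  haveI : DiscreteTopology H := ⟨rfl⟩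
  let Ψ : (Fin n → MulAut H) → (Fin n × H → H × H) := fun g p => (g p.1 p.2, (g p.1)⁻¹ p.2)
  have hcont : Continuous Ψ := by
    refine continuous_pi fun p => Continuous.prodMk ?_ ?_
    · exact continuous_discrete_rng.2 fun y => isOpen_eval _ _ _
    · refine continuous_discrete_rng.2 fun y => ?_
      have : (fun g : Fin n → MulAut H => (g p.1)⁻¹ p.2) ⁻¹' {y} = {g | g p.1 y = p.2} := by
        ext g
        simp only [Set.mem_preimage, Set.mem_singleton_iff, Set.mem_ofPred_eq, MulAut.inv_apply]
        rw [MulEquiv.symm_apply_eq, eq_comm]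
      rw [this]
      exact isOpen_eval _ _ _
  have hind : Topology.IsInducing Ψ := by
    refine Topology.IsInducing.of_comp hcont
      (g := fun (F : Fin n × H → H × H) p => (F p).1) (by fun_prop) (isInducing_eval (H := H) n)
  have hinj : Function.Injective Ψ := by
    intro g g' h
    funext i
    ext x
    exact congrArg Prod.fst (congrFun h (i, x))
  have hrange : Set.range Ψ = {F | (∀ i x y, (F (i, x * y)).1 = (F (i, x)).1 * (F (i, y)).1) ∧
      ∀ i x y, (F (i, x)).1 = y ↔ (F (i, y)).2 = x} := by
    ext F
    constructor
    · rintro ⟨g, rfl⟩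
      refine ⟨fun i x y => map_mul _ _ _, fun i x y => ?_⟩
      simp only [Ψ, MulAut.inv_apply]
      rw [MulEquiv.symm_apply_eq, eq_comm]
    · rintro ⟨h1, h2⟩
      refine ⟨fun i => 
        { toFun := fun x => (F (i, x)).1
          invFun := fun x => (F (i, x)).2
          left_inv := fun x => (h2 i x _).1 rfl
          right_inv := fun x => (h2 i _ x).2 rfl
          map_mul' := h1 i }, ?_⟩
      funext p
      rfl
  have hclosed : IsClosed (Set.range Ψ) := by
    rw [hrange]
    simp only [Set.ofPred_and, Set.ofPred_forall]
    refine IsClosed.inter ?_ ?_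
    · refine isClosed_iInter fun i => isClosed_iInter fun x => isClosed_iInter fun y => ?_
      have : Continuous fun F : Fin n × H → H × H =>
        ((F (i, x * y)).1, (F (i, x)).1, (F (i, y)).1) := by fun_prop
      exact (isClosed_discrete {q : H × H × H | q.1 = q.2.1 * q.2.2}).preimage this
    · refine isClosed_iInter fun i => isClosed_iInter fun x => isClosed_iInter fun y => ?_
      have : Continuous fun F : Fin n × H → H × H => ((F (i, x)).1, (F (i, y)).2) := by fun_prop
      exact (isClosed_discrete {q : H × H | q.1 = y ↔ q.2 = x}).preimage this
  have hce : Topology.IsClosedEmbedding Ψ := ⟨⟨hind, hinj⟩, hclosed⟩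
  haveI : PolishSpace (Fin n → MulAut H) := hce.polishSpace
  infer_instance

/-- every finite group in any universe embeds -/
theorem embeds (hH : IsHallUniversal H) (P : Type*) [Group P] [Finite P] :
    ∃ f : P →* H, Function.Injective f := by
  obtain ⟨f, hf⟩ := hH.embedsFinite (Shrink.{0} P)
  let e : Shrink.{0} P ≃* P := Shrink.mulEquiv
  exact ⟨f.comp e.symm.toMonoidHom, hf.comp e.symm.injective⟩

theorem conj_up_to_aut (hH : IsHallUniversal H) {P : Type*} [Group P] [Finite P]
    (α β : P →* H) (hα : Function.Injective α) (hβ : Function.Injective β) :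
    ∃ (g : H) (θ : MulAut P), ∀ p, g * α p * g⁻¹ = β (θ p) := by
  let ea := MonoidHom.ofInjective hα
  let eb := MonoidHom.ofInjective hβ
  haveI : Finite α.range := Finite.of_equiv _ ea.toEquiv
  haveI : Finite β.range := Finite.of_equiv _ eb.toEquiv
  obtain ⟨g, hg⟩ := hH.conjIso α.range β.range inferInstance inferInstance ⟨ea.symm.trans eb⟩
  let γ : P →* H := (MulAut.conj g).toMonoidHom.comp α
  have hγ : Function.Injective γ := (MulAut.conj g).injective.comp hα
  have hr : γ.range = β.range := by rw [← hg, MonoidHom.map_range]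
  let θ : MulAut P := ((MonoidHom.ofInjective hγ).trans (MulEquiv.subgroupCongr hr)).trans eb.symm
  refine ⟨g, θ, fun p => ?_⟩
  have : eb (θ p) = (MulEquiv.subgroupCongr hr) (MonoidHom.ofInjective hγ p) := by
    simp [θ]
  have h2 := congrArg Subtype.val this
  exact h2.symm

/-- Any two embeddings of a finite group are conjugate. -/
theorem conj_embeddings (hH : IsHallUniversal H) {P : Type*} [Group P] [Finite P]
    (α β : P →* H) (hα : Function.Injective α) (hβ : Function.Injective β) :
    ∃ u : H, ∀ p, u * α p * u⁻¹ = β p := by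
  obtain ⟨ι, hι⟩ := embeds hH (Equiv.Perm P)
  let lam : P →* Equiv.Perm P := MulAction.toPermHom P P
  have hlam : Function.Injective lam := MulAction.toPerm_injective
  obtain ⟨g, θ, hg⟩ := conj_up_to_aut hH α β hα hβ
  obtain ⟨w, τ, hw⟩ := conj_up_to_aut hH β (ι.comp lam) hβ (hι.comp hlam)
  let σ : MulAut P := τ * θ⁻¹ * τ⁻¹
  have hσ : ∀ p, σ.toEquiv * lam p * (σ.toEquiv : Equiv.Perm P)⁻¹ = lam (σ p) := by
    intro p
    rw [mul_inv_eq_iff_eq_mul]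
    ext x
    simp [lam]
  let s : H := ι σ.toEquiv
  have hs : ∀ p, s * ι (lam p) * s⁻¹ = ι (lam (σ p)) := by
    intro p
    rw [← hσ]; simp [s]
  refine ⟨w⁻¹ * s * w * g, fun p => ?_⟩
  have h1 : β p = w⁻¹ * ι (lam (τ p)) * w := by
    have := hw p
    simp only [MonoidHom.comp_apply] at this
    rw [← this]; group
  have h2 : w * (g * α p * g⁻¹) * w⁻¹ = ι (lam (τ (θ p))) := by
    rw [hg]; exact hw _
  have h3 : σ (τ (θ p)) = τ p := by simp [σ]
  rw [h1, ← h3, ← hs, ← h2]; group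

/-- the restriction of an automorphism to a finite subgroup is inner -/
theorem exists_inner (hH : IsHallUniversal H) (A : Subgroup H) [Finite A] (g : MulAut H) :
    ∃ c : H, ∀ x ∈ A, g x = c * x * c⁻¹ := by
  obtain ⟨u, hu⟩ := conj_embeddings hH A.subtype (g.toMonoidHom.comp A.subtype)
    A.subtype_injective (g.injective.comp A.subtype_injective)
  exact ⟨u, fun x hx => (hu ⟨x, hx⟩).symm⟩

theorem finite_closure (hH : IsHallUniversal H) {s : Set H} (hs : s.Finite) :
    Finite (Subgroup.closure s) :=
  hH.locallyFinite _ ⟨hs.toFinset, by simp⟩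

/-- The fibre product group used for amalgamation. -/
def fib (A K : Subgroup H) : Subgroup (K × K × K × K) where
  carrier := {p | (p.1 : H) * (p.2.2.1 : H)⁻¹ ∈ A ∧
    (p.1 : H) * (p.2.2.1 : H)⁻¹ = (p.2.1 : H) * (p.2.2.2 : H)⁻¹ ∧
    (∀ a, a ∈ A ↔ (p.2.2.1 : H) * a * (p.2.2.1 : H)⁻¹ ∈ A) ∧
    ∀ a ∈ A, (p.2.2.1 : H) * a * (p.2.2.1 : H)⁻¹ = (p.2.2.2 : H) * a * (p.2.2.2 : H)⁻¹}
  one_mem' := by simp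
  mul_mem' := by
    rintro ⟨⟨x, hx⟩, ⟨y, hy⟩, ⟨u, hu⟩, ⟨v, hv⟩⟩ ⟨⟨x', hx'⟩, ⟨y', hy'⟩, ⟨u', hu'⟩, ⟨v', hv'⟩⟩
      ⟨h1, h2, h3, h4⟩ ⟨k1, k2, k3, k4⟩
    simp only [Prod.mk_mul_mk, Set.mem_ofPred_eq, MulMemClass.mk_mul_mk] at *
    have e1 : x * x' * (u * u')⁻¹ = (x * u⁻¹) * (u * (x' * u'⁻¹) * u⁻¹) := by group
    have e2 : y * y' * (v * v')⁻¹ = (y * v⁻¹) * (v * (y' * v'⁻¹) * v⁻¹) := by group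
    have e3 : ∀ a, u * u' * a * (u * u')⁻¹ = u * (u' * a * u'⁻¹) * u⁻¹ := fun a => by group
    have e4 : ∀ a, v * v' * a * (v * v')⁻¹ = v * (v' * a * v'⁻¹) * v⁻¹ := fun a => by group
    refine ⟨?_, ?_, ?_, ?_⟩
    · rw [e1]; exact mul_mem h1 ((h3 _).1 k1)
    · rw [e1, e2, h2, ← k2, h4 _ k1]
    · intro a; rw [e3, k3, h3]
    · intro a ha; rw [e3, e4, h4 _ ((k3 a).1 ha), k4 a ha]
  inv_mem' := by
    rintro ⟨⟨x, hx⟩, ⟨y, hy⟩, ⟨u, hu⟩, ⟨v, hv⟩⟩ ⟨h1, h2, h3, h4⟩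
    simp only [Prod.inv_mk, Set.mem_ofPred_eq, InvMemClass.coe_inv] at *
    have e1 : u * (x⁻¹ * u⁻¹⁻¹) * u⁻¹ = (x * u⁻¹)⁻¹ := by group
    have e2 : v * (y⁻¹ * v⁻¹⁻¹) * v⁻¹ = (y * v⁻¹)⁻¹ := by group
    have h5 : x⁻¹ * u⁻¹⁻¹ ∈ A := by rw [h3, e1]; exact inv_mem h1
    have e3 : ∀ a, u * (u⁻¹ * a * u⁻¹⁻¹) * u⁻¹ = a := fun a => by group
    have e4 : ∀ a, v * (v⁻¹ * a * v⁻¹⁻¹) * v⁻¹ = a := fun a => by group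
    have h6 : ∀ a, a ∈ A ↔ u⁻¹ * a * u⁻¹⁻¹ ∈ A := fun a => by rw [h3 (u⁻¹ * a * u⁻¹⁻¹), e3]
    refine ⟨h5, ?_, h6, ?_⟩
    · have := h4 _ h5
      rw [e1, h2, ← e2] at this
      simpa using this.symm
    · intro a ha
      have := h4 _ ((h6 a).1 ha)
      rw [e3] at this
      conv_rhs => rw [this]
      group

theorem conj_mem_iff_of_finite (A : Subgroup H) [Finite A] (b : H)
    (hb : ∀ a ∈ A, b * a * b⁻¹ ∈ A) (a : H) : a ∈ A ↔ b * a * b⁻¹ ∈ A := by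
  refine ⟨hb a, fun h => ?_⟩
  let f : A → A := fun x => ⟨b * x * b⁻¹, hb _ x.2⟩
  have hf : Function.Injective f := by
    intro x y hxy
    have := congrArg Subtype.val hxy
    simpa [f] using this
  obtain ⟨y, hy⟩ := Finite.surjective_of_injective hf ⟨_, h⟩
  have := congrArg Subtype.val hy
  have h2 : (y : H) = a := by simpa [f] using this
  rw [← h2]; exact y.2

theorem amalgam (hH : IsHallUniversal H) {n : ℕ} (A B F : Subgroup H) [Finite A] [Finite B]
    [Finite F] (b c : Fin n → H) (hb : ∀ i, ∀ a ∈ A, b i * a * (b i)⁻¹ ∈ A)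
    (hbc : ∀ i, ∀ a ∈ A, c i * a * (c i)⁻¹ = b i * a * (b i)⁻¹) :
    ∃ (c' : Fin n → H) (h : H), (∀ i, ∀ x ∈ F, c' i * x * (c' i)⁻¹ = c i * x * (c i)⁻¹) ∧
      (∀ a ∈ A, h * a * h⁻¹ = a) ∧
      ∀ i, ∀ x ∈ B, c' i * (h * x * h⁻¹) * (c' i)⁻¹ = h * (b i * x * (b i)⁻¹) * h⁻¹ := by
  let K : Subgroup H := Subgroup.closure
    ((A : Set H) ∪ B ∪ F ∪ Set.range b ∪ Set.range c)
  haveI : Finite K := finite_closure hH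
    (((((Set.toFinite _).union (Set.toFinite _)).union (Set.toFinite _)).union
      (Set.finite_range b)).union (Set.finite_range c))
  have hK : ((A : Set H) ∪ B ∪ F ∪ Set.range b ∪ Set.range c) ⊆ K := Subgroup.subset_closure
  have hA : ∀ x ∈ A, x ∈ K := fun x hx => hK (by simp [hx])
  have hB : ∀ x ∈ B, x ∈ K := fun x hx => hK (by simp [hx])
  have hF : ∀ x ∈ F, x ∈ K := fun x hx => hK (by simp [hx])
  have hbK : ∀ i, b i ∈ K := fun i => hK (by simp)
  have hcK : ∀ i, c i ∈ K := fun i => hK (by simp)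
  obtain ⟨j, hj, hj1⟩ : ∃ j : K × K × K →* H, Function.Injective j ∧
      ∀ x : K, j (x, 1, 1) = x := by
    obtain ⟨j, hj⟩ := embeds hH (K × K × K)
    obtain ⟨u, hu⟩ := conj_embeddings hH (j.comp (MonoidHom.inl K (K × K))) K.subtype
      (hj.comp (fun x y h => by simpa using h)) K.subtype_injective
    exact ⟨(MulAut.conj u).toMonoidHom.comp j, (MulAut.conj u).injective.comp hj, hu⟩
  let P := fib A K
  let q1 : K × K × K × K →* K × K × K := (MonoidHom.fst _ _).prod
    ((MonoidHom.snd _ _).comp (MonoidHom.snd _ _))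
  let q2 : K × K × K × K →* K × K × K := MonoidHom.snd _ _
  have hq1 : Function.Injective (q1.comp P.subtype) := by
    rw [injective_iff_map_eq_one]
    rintro ⟨⟨x, y, u, v⟩, h1, h2, h3, h4⟩ h
    simp only [q1, MonoidHom.comp_apply, Subgroup.subtype_apply, MonoidHom.prod_apply,
      MonoidHom.coe_fst, MonoidHom.coe_snd, Prod.mk_eq_one] at h
    obtain ⟨rfl, rfl, rfl⟩ := h
    have : y = 1 := by simpa using h2.symm
    subst this; rfl
  have hq2 : Function.Injective (q2.comp P.subtype) := by
    rw [injective_iff_map_eq_one]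
    rintro ⟨⟨x, y, u, v⟩, h1, h2, h3, h4⟩ h
    simp only [q2, MonoidHom.comp_apply, Subgroup.subtype_apply,
      MonoidHom.coe_snd, Prod.mk_eq_one] at h
    obtain ⟨rfl, rfl, rfl⟩ := h
    have : x = 1 := by simpa using h2
    subst this; rfl
  obtain ⟨h, hh⟩ := conj_embeddings hH (j.comp (q2.comp P.subtype)) (j.comp (q1.comp P.subtype))
    (hj.comp hq2) (hj.comp hq1)
  have hP : ∀ x y u v : K, ((x, y, u, v) : K × K × K × K) ∈ P →
      h * j (y, u, v) * h⁻¹ = j (x, u, v) := fun x y u v hm => hh ⟨_, hm⟩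
  let cK : Fin n → K := fun i => ⟨c i, hcK i⟩
  let bK : Fin n → K := fun i => ⟨b i, hbK i⟩
  have hconj : ∀ (w u v x : K), j (w, u, v) * x * (j (w, u, v))⁻¹ = w * x * (w : H)⁻¹ := by
    intro w u v x
    rw [← hj1 x, ← map_inv, ← map_mul, ← map_mul]
    have : ((w, u, v) * (x, 1, 1) * (w, u, v)⁻¹ : K × K × K) = (w * x * w⁻¹, 1, 1) := by
      simp
    rw [this, hj1, hj1]; simp
  have hc' : ∀ i, h * j (bK i, cK i, bK i) * h⁻¹ = j (cK i, cK i, bK i) := by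
    intro i
    apply hP
    refine ⟨by simp [A.one_mem], by simp, ?_, ?_⟩
    · refine conj_mem_iff_of_finite A (c i) (fun a ha => ?_)
      rw [hbc i a ha]; exact hb i a ha
    · exact hbc i
  refine ⟨fun i => j (cK i, cK i, bK i), h, ?_, ?_, ?_⟩
  · intro i x hx
    exact hconj _ _ _ ⟨x, hF x hx⟩
  · intro a ha
    have := hP ⟨a, hA a ha⟩ ⟨a, hA a ha⟩ 1 1 ⟨by simpa using ha, by simp, by simp, by simp⟩
    simpa [hj1] using this
  · intro i x hx
    have := hconj (bK i) (cK i) (bK i) ⟨x, hB x hx⟩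
    simp only [← hc']
    simp only [bK] at this ⊢
    rw [← this]; group

/-- genericity: extension part -/
def extSet (n : ℕ) (A B : Subgroup H) (b : Fin n → H) : Set (Fin n → MulAut H) :=
  {g | (∀ i, ∀ a ∈ A, b i * a * (b i)⁻¹ ∈ A) → (∀ i, ∀ a ∈ A, g i a = b i * a * (b i)⁻¹) →
    ∃ h : H, (∀ a ∈ A, h * a * h⁻¹ = a) ∧
      ∀ i, ∀ x ∈ B, g i (h * x * h⁻¹) = h * (b i * x * (b i)⁻¹) * h⁻¹}

/-- genericity: local finiteness part -/
def locSet (n : ℕ) (S : Finset H) : Set (Fin n → MulAut H) :=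
  {g | ∃ (B : Subgroup H) (b : Fin n → H), Finite B ∧ (∀ x ∈ S, x ∈ B) ∧ (∀ i, b i ∈ B) ∧
    ∀ i, ∀ x ∈ B, g i x = b i * x * (b i)⁻¹}

theorem isOpen_agree {n : ℕ} (A : Subgroup H) [Finite A] (s t : Fin n → H → H) :
    IsOpen {g : Fin n → MulAut H | ∀ i, ∀ x ∈ A, g i (s i x) = t i x} := by
  simp only [Set.ofPred_forall]
  refine isOpen_iInter_of_finite fun i => ?_
  exact Set.Finite.isOpen_biInter (Set.toFinite (A : Set H)) fun x _ => isOpen_eval _ _ _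

theorem isOpen_extSet (n : ℕ) (A B : Subgroup H) [Finite A] [Finite B] (b : Fin n → H) :
    IsOpen (extSet n A B b) := by
  by_cases hb : ∀ i, ∀ a ∈ A, b i * a * (b i)⁻¹ ∈ A
  · have : extSet n A B b = (⋃ i, ⋃ a ∈ A, {g | g i a ∈ ({b i * a * (b i)⁻¹} : Set H)ᶜ}) ∪
        ⋃ h : H, ⋃ _ : ∀ a ∈ A, h * a * h⁻¹ = a,
          {g | ∀ i, ∀ x ∈ B, g i (h * x * h⁻¹) = h * (b i * x * (b i)⁻¹) * h⁻¹} := by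
      ext g
      simp only [extSet, Set.mem_ofPred_eq, Set.mem_union, Set.mem_iUnion, Set.mem_compl_iff,
        Set.mem_singleton_iff, exists_prop]
      constructor
      · intro h
        by_cases hc : ∀ i, ∀ a ∈ A, g i a = b i * a * (b i)⁻¹
        · exact Or.inr (h hb hc)
        · push Not at hc
          exact Or.inl hc
      · rintro (⟨i, a, ha, hne⟩ | h) _ hc
        · exact absurd (hc i a ha) hne
        · exact h
    rw [this]
    refine IsOpen.union ?_ ?_
    · exact isOpen_iUnion fun i => isOpen_iUnion fun a => isOpen_iUnion fun _ =>
        isOpen_eval_rel _ _ _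
    · exact isOpen_iUnion fun h => isOpen_iUnion fun _ => isOpen_agree B _ _
  · have : extSet n A B b = Set.univ := by
      ext g; simp only [extSet, Set.mem_ofPred_eq, Set.mem_univ, iff_true]
      exact fun h => absurd h hb
    rw [this]; exact isOpen_univ

theorem isOpen_locSet (n : ℕ) (S : Finset H) : IsOpen (locSet n S) := by
  have : locSet n S = ⋃ B : Subgroup H, ⋃ b : Fin n → H, ⋃ _ : Finite B,
      ⋃ _ : (∀ x ∈ S, x ∈ B) ∧ (∀ i, b i ∈ B),
      {g | ∀ i, ∀ x ∈ B, g i x = b i * x * (b i)⁻¹} := by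
    ext g
    simp only [locSet, Set.mem_ofPred_eq, Set.mem_iUnion, exists_prop, and_assoc]
  rw [this]
  exact isOpen_iUnion fun B => isOpen_iUnion fun b => isOpen_iUnion fun _ => isOpen_iUnion fun _ =>
    isOpen_agree B (fun _ x => x) _

/-- In each nonempty open set there is an inner tuple, controlled on a large finite subgroup. -/
theorem exists_inner_mem (hH : IsHallUniversal H) {n : ℕ} {U : Set (Fin n → MulAut H)}
    (hU : IsOpen U) (hne : U.Nonempty) (S : Set H) (hS : S.Finite) :
    ∃ (F : Subgroup H) (c : Fin n → H), Finite F ∧ S ⊆ F ∧ ∀ g' : Fin n → MulAut H,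
      (∀ i, ∀ x ∈ F, g' i x = c i * x * (c i)⁻¹) → g' ∈ U := by
  obtain ⟨g, hg⟩ := hne
  obtain ⟨T, hT⟩ := exists_finset_of_isOpen hU hg
  let F := Subgroup.closure ((T : Set H) ∪ S)
  haveI : Finite F := finite_closure hH (T.finite_toSet.union hS)
  choose c hc using fun i => exists_inner hH F (g i)
  refine ⟨F, c, inferInstance, fun x hx => Subgroup.subset_closure (Or.inr hx), ?_⟩
  intro g' hg'
  refine hT g' fun i x hx => ?_
  have hx' : x ∈ F := Subgroup.subset_closure (Or.inl hx)
  rw [hg' i x hx', hc i x hx']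

theorem dense_extSet (hH : IsHallUniversal H) (n : ℕ) (A B : Subgroup H) [Finite A] [Finite B]
    (b : Fin n → H) : Dense (extSet n A B b) := by
  rw [dense_iff_inter_open]
  intro U hU hne
  obtain ⟨F, c, hF, hAF, hcU⟩ := exists_inner_mem hH hU hne (A : Set H) (Set.toFinite _)
  by_cases hb : ∀ i, ∀ a ∈ A, b i * a * (b i)⁻¹ ∈ A
  swap
  · exact ⟨fun i => MulAut.conj (c i), hcU _ (fun i x _ => rfl), fun h => absurd h hb⟩
  by_cases hbc : ∀ i, ∀ a ∈ A, c i * a * (c i)⁻¹ = b i * a * (b i)⁻¹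
  swap
  · exact ⟨fun i => MulAut.conj (c i), hcU _ (fun i x _ => rfl), fun _ h => absurd h hbc⟩
  obtain ⟨c', h, h1, h2, h3⟩ := amalgam hH A B F b c hb hbc
  exact ⟨fun i => MulAut.conj (c' i), hcU _ h1, fun _ _ => ⟨h, h2, h3⟩⟩

theorem dense_locSet (hH : IsHallUniversal H) (n : ℕ) (S : Finset H) : Dense (locSet n S) := by
  rw [dense_iff_inter_open]
  intro U hU hne
  obtain ⟨F, c, hF, -, hcU⟩ := exists_inner_mem hH hU hne ∅ Set.finite_empty
  refine ⟨fun i => MulAut.conj (c i), hcU _ (fun i x _ => rfl),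
    Subgroup.closure ((S : Set H) ∪ Set.range c), c,
    finite_closure hH (S.finite_toSet.union (Set.finite_range c)),
    fun x hx => Subgroup.subset_closure (Or.inl hx),
    fun i => Subgroup.subset_closure (Or.inr ⟨i, rfl⟩), fun i x _ => rfl⟩

/-- The generic tuples. -/
def generic (H : Type*) [Group H] (n : ℕ) : Set (Fin n → MulAut H) :=
  {g | (∀ A B : Subgroup H, Finite A → Finite B → ∀ b, g ∈ extSet n A B b) ∧
    ∀ S, g ∈ locSet n S}

theorem generic_mem_residual (hH : IsHallUniversal H) (n : ℕ) :
    generic H n ∈ residual (Fin n → MulAut H) := by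
  haveI := hH.countable
  haveI : Countable {A : Subgroup H // Finite A} := by
    refine Function.Injective.countable
      (f := fun A : {A : Subgroup H // Finite A} =>
        (haveI := A.2; (Set.toFinite (A.1 : Set H)).toFinset)) ?_
    intro A A' h
    simp only [Set.Finite.toFinset_inj] at h
    exact Subtype.ext (SetLike.coe_injective h)
  have h1 : ∀ (A B : {A : Subgroup H // Finite A}) (b : Fin n → H),
      extSet n A.1 B.1 b ∈ residual (Fin n → MulAut H) := by
    intro A B b
    haveI := A.2
    haveI := B.2
    exact residual_of_dense_open (isOpen_extSet n _ _ b) (dense_extSet hH n _ _ b)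
  have h2 : ∀ S, locSet n S ∈ residual (Fin n → MulAut H) := fun S =>
    residual_of_dense_open (isOpen_locSet n S) (dense_locSet hH n S)
  have h3 := countable_iInter_mem.2 fun A => countable_iInter_mem.2 fun B =>
    countable_iInter_mem.2 (h1 A B)
  have h4 := countable_iInter_mem.2 h2
  filter_upwards [h3, h4] with g hg hg'
  simp only [Set.mem_iInter] at hg hg'
  exact ⟨fun A B hA hB b => hg ⟨A, hA⟩ ⟨B, hB⟩ b, hg'⟩

/-- partial conjugacies -/
def valid {n : ℕ} (g g' : Fin n → MulAut H) (A : Subgroup H) (k : H) : Prop :=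
  Finite A ∧ ∀ i, ∀ x ∈ A, g i x ∈ A ∧ g' i (k * x * k⁻¹) = k * g i x * k⁻¹

/-- conjugate subgroup -/
def cj (k : H) (A : Subgroup H) : Subgroup H := A.map (MulAut.conj k).toMonoidHom

theorem mem_cj {k : H} {A : Subgroup H} {y : H} : y ∈ cj k A ↔ ∃ x ∈ A, k * x * k⁻¹ = y :=
  Iff.rfl

theorem finite_cj (k : H) (A : Subgroup H) [Finite A] : Finite (cj k A) :=
  Finite.of_equiv _ (A.equivMapOfInjective _ (MulAut.conj k).injective).toEquiv

theorem valid_swap {n : ℕ} {g g' : Fin n → MulAut H} {A : Subgroup H} {k : H}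
    (h : valid g g' A k) : valid g' g (cj k A) k⁻¹ := by
  haveI := h.1
  refine ⟨finite_cj k A, ?_⟩
  rintro i _ ⟨x, hx, rfl⟩
  have h2 := h.2 i x hx
  simp only [MulEquiv.coe_toMonoidHom, MulAut.conj_apply]
  refine ⟨?_, ?_⟩
  · rw [h2.2]; exact ⟨_, h2.1, rfl⟩
  · rw [h2.2]
    have : k⁻¹ * (k * x * k⁻¹) * k⁻¹⁻¹ = x := by group
    rw [this]; group

theorem forth {n : ℕ} {g g' : Fin n → MulAut H} (hg : g ∈ generic H n) (hg' : g' ∈ generic H n)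
    {A : Subgroup H} {k : H} (h : valid g g' A k) (x : H) :
    ∃ (B : Subgroup H) (l : H), valid g g' B l ∧ A ≤ B ∧ (∀ a ∈ A, l * a * l⁻¹ = k * a * k⁻¹) ∧
      x ∈ B := by
  classical
  haveI := h.1
  obtain ⟨B, b, hB, hS, hbB, hb⟩ := hg.2 (insert x (Set.toFinite (A : Set H)).toFinset)
  have hAB : A ≤ B := fun a ha => hS a (by simp [ha])
  have hAb : ∀ i, ∀ a ∈ A, k * b i * k⁻¹ * (k * a * k⁻¹) * (k * b i * k⁻¹)⁻¹
      = k * g i a * k⁻¹ := by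
    intro i a ha
    rw [hb i a (hAB ha)]; group
  obtain ⟨u, hu, hu2⟩ := hg'.1 (cj k A) (cj k B) (finite_cj k A) (finite_cj k B)
    (fun i => k * b i * k⁻¹)
    (by
      rintro i _ ⟨a, ha, rfl⟩
      simp only [MulEquiv.coe_toMonoidHom, MulAut.conj_apply]
      rw [hAb i a ha]
      exact ⟨_, (h.2 i a ha).1, rfl⟩)
    (by
      rintro i _ ⟨a, ha, rfl⟩
      simp only [MulEquiv.coe_toMonoidHom, MulAut.conj_apply]
      rw [hAb i a ha]
      exact (h.2 i a ha).2)
  refine ⟨B, u * k, ⟨hB, ?_⟩, hAB, ?_, hS x (by simp)⟩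
  · intro i y hy
    rw [hb i y hy]
    refine ⟨mul_mem (mul_mem (hbB i) hy) (inv_mem (hbB i)), ?_⟩
    have := hu2 i (k * y * k⁻¹) ⟨y, hy, rfl⟩
    have e : u * k * y * (u * k)⁻¹ = u * (k * y * k⁻¹) * u⁻¹ := by group
    rw [e, this]; group
  · intro a ha
    have := hu (k * a * k⁻¹) ⟨a, ha, rfl⟩
    rw [← this]; group

theorem back {n : ℕ} {g g' : Fin n → MulAut H} (hg : g ∈ generic H n) (hg' : g' ∈ generic H n)
    {A : Subgroup H} {k : H} (h : valid g g' A k) (y : H) :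
    ∃ (B : Subgroup H) (l : H), valid g g' B l ∧ A ≤ B ∧ (∀ a ∈ A, l * a * l⁻¹ = k * a * k⁻¹) ∧
      ∃ x ∈ B, l * x * l⁻¹ = y := by
  obtain ⟨B, l, hv, hle, hagree, hy⟩ := forth hg' hg (valid_swap h) y
  have key : ∀ a ∈ A, l * (k * a * k⁻¹) * l⁻¹ = a := by
    intro a ha
    rw [hagree (k * a * k⁻¹) ⟨a, ha, rfl⟩]; group
  refine ⟨cj l B, l⁻¹, valid_swap hv, ?_, ?_, ?_⟩
  · intro a ha
    exact ⟨k * a * k⁻¹, hle ⟨a, ha, rfl⟩, key a ha⟩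
  · intro a ha
    conv_lhs => rw [← key a ha]
    group
  · exact ⟨l * y * l⁻¹, ⟨y, hy, rfl⟩, by group⟩

/-- The poset of partial conjugacies. -/
def St {n : ℕ} (g g' : Fin n → MulAut H) : Type _ := {p : Subgroup H × H // valid g g' p.1 p.2}

instance {n : ℕ} (g g' : Fin n → MulAut H) : Preorder (St g g') where
  le p q := p.1.1 ≤ q.1.1 ∧ ∀ a ∈ p.1.1, q.1.2 * a * (q.1.2)⁻¹ = p.1.2 * a * (p.1.2)⁻¹
  le_refl p := ⟨le_rfl, fun _ _ => rfl⟩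
  le_trans p q r h h' := ⟨h.1.trans h'.1, fun a ha => (h'.2 a (h.1 ha)).trans (h.2 a ha)⟩

theorem conj_generic [Countable H] {n : ℕ} {g g' : Fin n → MulAut H} (hg : g ∈ generic H n)
    (hg' : g' ∈ generic H n) : ∃ f : MulAut H, ∀ i, g' i = f * g i * f⁻¹ := by
  haveI : Encodable H := Encodable.ofCountable H
  let D : H ⊕ H → Order.Cofinal (St g g') := fun z => match z with
    | Sum.inl x => ⟨{p | x ∈ p.1.1}, fun p => by
        obtain ⟨B, l, hv, h1, h2, h3⟩ := forth hg hg' p.2 x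
        exact ⟨⟨(B, l), hv⟩, h3, h1, h2⟩⟩
    | Sum.inr y => ⟨{p | ∃ x ∈ p.1.1, p.1.2 * x * (p.1.2)⁻¹ = y}, fun p => by
        obtain ⟨B, l, hv, h1, h2, h3⟩ := back hg hg' p.2 y
        exact ⟨⟨(B, l), hv⟩, h3, h1, h2⟩⟩
  let p0 : St g g' := ⟨(⊥, 1), inferInstance, by
    intro i x hx
    rw [Subgroup.mem_bot] at hx
    subst hx
    simp⟩
  let I := Order.idealOfCofinals p0 D
  have hx : ∀ x, ∃ p : St g g', p ∈ I ∧ x ∈ p.1.1 := fun x => by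
    obtain ⟨p, h1, h2⟩ := Order.cofinal_meets_idealOfCofinals p0 D (Sum.inl x)
    exact ⟨p, h2, h1⟩
  have hy : ∀ y, ∃ p : St g g', p ∈ I ∧ ∃ x ∈ p.1.1, p.1.2 * x * (p.1.2)⁻¹ = y := fun y => by
    obtain ⟨p, h1, h2⟩ := Order.cofinal_meets_idealOfCofinals p0 D (Sum.inr y)
    exact ⟨p, h2, h1⟩
  choose c hcI hc using hx
  let f : H → H := fun x => (c x).1.2 * x * ((c x).1.2)⁻¹
  have hf : ∀ p ∈ I, ∀ x ∈ p.1.1, f x = p.1.2 * x * (p.1.2)⁻¹ := by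
    intro p hp x hx
    obtain ⟨q, -, h1, h2⟩ := I.directed _ hp _ (hcI x)
    rw [← h1.2 x hx, h2.2 x (hc x)]
  have hpair : ∀ x y, ∃ p ∈ I, x ∈ p.1.1 ∧ y ∈ p.1.1 := by
    intro x y
    obtain ⟨q, hq, h1, h2⟩ := I.directed _ (hcI x) _ (hcI y)
    exact ⟨q, hq, h1.1 (hc x), h2.1 (hc y)⟩
  let fh : H →* H := MonoidHom.mk' f (by
    intro x y
    obtain ⟨p, hp, hx, hy⟩ := hpair x y
    rw [hf p hp x hx, hf p hp y hy, hf p hp _ (mul_mem hx hy)]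
    group)
  have hbij : Function.Bijective fh := by
    constructor
    · intro x y hxy
      change f x = f y at hxy
      obtain ⟨p, hp, hx, hy⟩ := hpair x y
      rw [hf p hp x hx, hf p hp y hy] at hxy
      simpa using hxy
    · intro y
      obtain ⟨p, hp, x, hx, rfl⟩ := hy y
      exact ⟨x, hf p hp x hx⟩
  refine ⟨MulEquiv.ofBijective fh hbij, fun i => ?_⟩
  rw [eq_mul_inv_iff_mul_eq]
  ext x
  change g' i (f x) = f (g i x)
  have hv := (c x).2.2 i x (hc x)
  rw [hf _ (hcI x) _ hv.1]
  exact hv.2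

end HallAmple

/-- **`Aut H` has ample generics.**  For every `n ≥ 1` the diagonal conjugacy action of
`Aut H` on `(Aut H)ⁿ` has a comeager orbit: there are `g₁, …, gₙ ∈ Aut H` whose diagonal
conjugacy orbit `{(f g₁ f⁻¹, …, f gₙ f⁻¹) : f ∈ Aut H}` is comeager in `(Aut H)ⁿ`
(with the product topology). -/
theorem hallUniversal_ample_generics
    (H : Type*) [Group H] (hH : IsHallUniversal H) (n : ℕ) (hn : 1 ≤ n) :
    ∃ g : Fin n → MulAut H,
      {p : Fin n → MulAut H | ∃ f : MulAut H, ∀ i : Fin n, p i = f * g i * f⁻¹} ∈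
        residual (Fin n → MulAut H) := by
  haveI := hH.countable
  haveI := HallAmple.baire (H := H) n
  have hres := HallAmple.generic_mem_residual hH n
  obtain ⟨g, hg⟩ := (dense_of_mem_residual hres).nonempty
  exact ⟨g, Filter.mem_of_superset hres fun p hp => HallAmple.conj_generic hg hp⟩
end

section
/- Let H be a Hall universal group. Then Aut(H) has the small index property: every subgroup of Aut(H) of index strictly less than 2^ℵ₀ is open in Aut(H). -/
namespace HallSIP

open Function

/-- Two free actions of `C` on a finite group `T` by left translations are isomorphic. -/
theorem exists_perm_conj {C T : Type*} [Group C] [Group T] [Finite T]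
    (i j : C →* T) (hi : Injective i) (hj : Injective j) :
    ∃ s : Equiv.Perm T, ∀ c t, s (i c * t) = j c * s t := by
  have key : ∀ k : C →* T, Injective k →
      Bijective (fun p : (T ⧸ k.range) × C => p.1.out * k p.2) := by
    intro k hk
    constructor
    · rintro ⟨q, c⟩ ⟨q', c'⟩ h
      simp only at h
      have hq : q = q' := by
        rw [← q.out_eq', ← q'.out_eq']
        change (QuotientGroup.mk q.out : T ⧸ k.range) = QuotientGroup.mk q'.out
        rw [QuotientGroup.eq]
        refine ⟨c * c'⁻¹, ?_⟩
        rw [map_mul, map_inv, eq_inv_mul_iff_mul_eq, ← mul_assoc, h, mul_assoc, mul_inv_cancel,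
          mul_one]
      subst hq
      have := hk (mul_left_cancel h)
      rw [this]
    · intro t
      have h : (QuotientGroup.mk (Quotient.out (QuotientGroup.mk t : T ⧸ k.range)) : T ⧸ k.range)
          = QuotientGroup.mk t := Quotient.out_eq' _
      rw [QuotientGroup.eq] at h
      obtain ⟨c, hc⟩ := h
      refine ⟨⟨QuotientGroup.mk t, c⟩, ?_⟩
      simp only
      rw [hc]
      simp
  have hcard : Nat.card (T ⧸ i.range) = Nat.card (T ⧸ j.range) := by
    have h1 := Subgroup.card_eq_card_quotient_mul_card_subgroup i.range
    have h2 := Subgroup.card_eq_card_quotient_mul_card_subgroup j.range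
    have h3 : Nat.card i.range = Nat.card C :=
      Nat.card_congr (MonoidHom.ofInjective hi).toEquiv.symm
    have h4 : Nat.card j.range = Nat.card C :=
      Nat.card_congr (MonoidHom.ofInjective hj).toEquiv.symm
    have : Finite C := Finite.of_injective i hi
    have h5 : 0 < Nat.card C := Nat.card_pos
    rw [h3] at h1
    rw [h4] at h2
    exact Nat.eq_of_mul_eq_mul_right h5 (h1.symm.trans h2)
  let σ : (T ⧸ i.range) ≃ (T ⧸ j.range) := (Finite.card_eq.1 hcard).some
  let ei := Equiv.ofBijective _ (key i hi)
  let ej := Equiv.ofBijective _ (key j hj)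
  let s : Equiv.Perm T := ei.symm.trans ((Equiv.prodCongr σ (Equiv.refl C)).trans ej)
  have hs : ∀ t c, s (t * i c) = s t * j c := by
    intro t c
    obtain ⟨⟨q, c0⟩, rfl⟩ := ei.surjective t
    have e1 : ei (q, c0) * i c = ei (q, c0 * c) := by
      simp [ei, mul_assoc]
    rw [e1]
    simp [s, ej, mul_assoc]
  refine ⟨(Equiv.inv T).trans (s.trans (Equiv.inv T)), fun c t => ?_⟩
  simp only [Equiv.trans_apply, Equiv.inv_apply, mul_inv_rev]
  rw [← map_inv i, hs]
  simp

variable {H : Type*} [Group H]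

/-- Extension property: an embedding of `A` into `H` extends to any finite overgroup. -/
theorem exists_extension (hH : IsHallUniversal H) {A P : Type*} [Group A] [Group P] [Finite P]
    (i : A →* P) (hi : Injective i) (j : A →* H) (hj : Injective j) :
    ∃ k : P →* H, Injective k ∧ ∀ a, k (i a) = j a := by
  have : Finite A := Finite.of_injective i hi
  obtain ⟨n, ⟨e⟩⟩ := Finite.exists_equiv_fin P
  let ψ : Equiv.Perm P ≃* Equiv.Perm (Fin n) := e.permCongrHom
  obtain ⟨f, hf⟩ := hH.embedsFinite (Equiv.Perm (Fin n))
  let ρ : P →* Equiv.Perm P := MulAction.toPermHom P P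
  have hρ : Injective ρ := MulAction.toPerm_injective
  let F : Equiv.Perm P →* H := f.comp ψ.toMonoidHom
  have hF : Injective F := hf.comp ψ.injective
  let m : A →* H := F.comp (ρ.comp i)
  have hm : Injective m := hF.comp (hρ.comp hi)
  obtain ⟨x, hx⟩ := hH.conjIso m.range j.range
    (Set.finite_range m).to_subtype (Set.finite_range j).to_subtype
    ⟨(MonoidHom.ofInjective hm).symm.trans (MonoidHom.ofInjective hj)⟩
  have h1 : ∀ a, ∃ b, x * m b * x⁻¹ = j a := by
    intro a
    have : j a ∈ Subgroup.map (MulAut.conj x).toMonoidHom m.range := by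
      rw [hx]; exact ⟨a, rfl⟩
    obtain ⟨_, ⟨b, rfl⟩, hb⟩ := this
    exact ⟨b, by simpa using hb⟩
  choose β hβ using h1
  have minj : ∀ a b, x * m a * x⁻¹ = x * m b * x⁻¹ → a = b := by
    intro a b h
    exact hm (mul_left_cancel (mul_right_cancel h))
  let B : A →* A := MonoidHom.mk' β (by
    intro a b
    apply minj
    rw [hβ, map_mul, map_mul, ← hβ a, ← hβ b]
    group)
  have hB : Injective B := by
    intro a b h
    apply hj
    rw [← hβ a, ← hβ b]
    change β a = β b at h
    rw [h]
  obtain ⟨s, hs⟩ := exists_perm_conj i (i.comp B) hi (hi.comp hB)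
  refine ⟨(MulAut.conj x).toMonoidHom.comp (F.comp ((MulAut.conj s).toMonoidHom.comp ρ)), ?_, ?_⟩
  · exact (MulAut.conj x).injective.comp (hF.comp ((MulAut.conj s).injective.comp hρ))
  · intro a
    have : s * ρ (i a) * s⁻¹ = ρ (i (B a)) := by
      rw [mul_inv_eq_iff_eq_mul]
      ext t
      simpa [ρ] using hs a t
    simp only [MonoidHom.comp_apply, MulEquiv.coe_toMonoidHom, MulAut.conj_apply, this]
    exact hβ a

theorem finite_closure (hH : IsHallUniversal H) {S : Set H} (hS : S.Finite) :
    Finite (Subgroup.closure S) :=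
  hH.locallyFinite _ ⟨hS.toFinset, by simp⟩

/-- Strong homogeneity. -/
theorem exists_conj (hH : IsHallUniversal H) {C : Type*} [Group C] [Finite C]
    (i j : C →* H) (hi : Injective i) (hj : Injective j) :
    ∃ u : H, ∀ c, u * i c * u⁻¹ = j c := by
  let T : Subgroup H := Subgroup.closure (Set.range i ∪ Set.range j)
  have : Finite T := finite_closure hH ((Set.finite_range i).union (Set.finite_range j))
  let i' : C →* T := i.codRestrict T fun c => Subgroup.subset_closure (Or.inl ⟨c, rfl⟩)
  let j' : C →* T := j.codRestrict T fun c => Subgroup.subset_closure (Or.inr ⟨c, rfl⟩)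
  obtain ⟨s, hs⟩ := exists_perm_conj i' j'
    (fun a b h => hi (congrArg Subtype.val h)) (fun a b h => hj (congrArg Subtype.val h))
  let ρ : T →* Equiv.Perm T := MulAction.toPermHom T T
  obtain ⟨k, -, hk⟩ := exists_extension hH ρ MulAction.toPerm_injective T.subtype
    T.subtype_injective
  refine ⟨k s, fun c => ?_⟩
  have h2 : s * ρ (i' c) * s⁻¹ = ρ (j' c) := by
    rw [mul_inv_eq_iff_eq_mul]
    ext t
    simpa [ρ] using congrArg Subtype.val (hs c t)
  have h3 := hk (i' c)
  have h4 := hk (j' c)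
  rw [← h2, map_mul, map_mul, h3, map_inv] at h4
  exact h4

/-- Every automorphism agrees with an inner one on a finite set. -/
theorem exists_inner (hH : IsHallUniversal H) (γ : MulAut H) {S : Set H} (hS : S.Finite) :
    ∃ u : H, ∀ x ∈ S, u * x * u⁻¹ = γ x := by
  have := finite_closure hH hS
  obtain ⟨u, hu⟩ := exists_conj hH (Subgroup.closure S).subtype
    (γ.toMonoidHom.comp (Subgroup.closure S).subtype) (Subgroup.subtype_injective _)
    (γ.injective.comp (Subgroup.subtype_injective _))
  exact ⟨u, fun x hx => hu ⟨x, Subgroup.subset_closure hx⟩⟩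

/-- Amalgamation of finite groups with automorphisms, inside `H`. -/
theorem amalg_abstract (hH : IsHallUniversal H) {A D B ι : Type*} [Group A] [Group D] [Group B]
    [Finite D] [Finite B] (i : A →* D) (hi : Injective i) (i' : A →* B) (hi' : Injective i')
    (jD : D →* H) (hjD : Injective jD) (jB : B →* H) (hjB : Injective jB)
    (hij : ∀ a, jB (i' a) = jD (i a))
    (α : ι → MulAut A) (δ : ι → MulAut D) (ε : ι → MulAut B)
    (hδ : ∀ k a, δ k (i a) = i (α k a)) (hε : ∀ k a, ε k (i' a) = i' (α k a)) :
    ∃ (h : H) (v : ι → H), (∀ a, h * jD (i a) * h⁻¹ = jD (i a)) ∧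
      (∀ k x, v k * jD x * (v k)⁻¹ = jD (δ k x)) ∧
      (∀ k x, v k * (h * jB x * h⁻¹) * (v k)⁻¹ = h * jB (ε k x) * h⁻¹) := by
  have : Finite A := Finite.of_injective i hi
  let K : Subgroup (MulAut A × MulAut D × MulAut B) :=
    { carrier := {p | (∀ a, p.2.1 (i a) = i (p.1 a)) ∧ (∀ a, p.2.2 (i' a) = i' (p.1 a))}
      mul_mem' := by
        rintro p q ⟨hp, hp'⟩ ⟨hq, hq'⟩
        constructor
        · intro a; simp [hp, hq]
        · intro a; simp [hp', hq']
      one_mem' := by simp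
      inv_mem' := by
        rintro p ⟨hp, hp'⟩
        constructor
        · intro a
          apply p.2.1.injective
          simp [hp]
        · intro a
          apply p.2.2.injective
          simp [hp'] }
  have finAut : ∀ (X : Type _) [Group X] [Finite X], Finite (MulAut X) := fun X _ _ =>
    Finite.of_injective (fun f : MulAut X => (f : X → X)) DFunLike.coe_injective
  have finAut' : ∀ (X : Type _) [Group X] [Finite X], Finite (MulAut X) := fun X _ _ =>
    Finite.of_injective (fun f : MulAut X => (f : X → X)) DFunLike.coe_injective
  have finAut'' : ∀ (X : Type _) [Group X] [Finite X], Finite (MulAut X) := fun X _ _ =>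
    Finite.of_injective (fun f : MulAut X => (f : X → X)) DFunLike.coe_injective
  have := finAut A
  have := finAut' D
  have := finAut'' B
  have : Finite K := inferInstance
  let φA : K →* MulAut A := (MonoidHom.fst _ _).comp K.subtype
  let φD : K →* MulAut D := (MonoidHom.fst _ _).comp ((MonoidHom.snd _ _).comp K.subtype)
  let φB : K →* MulAut B := (MonoidHom.snd _ _).comp ((MonoidHom.snd _ _).comp K.subtype)
  have : Finite (D ⋊[φD] K) := Finite.of_equiv _ SemidirectProduct.equivProd.symm
  have : Finite (B ⋊[φB] K) := Finite.of_equiv _ SemidirectProduct.equivProd.symm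
  let mD : A ⋊[φA] K →* D ⋊[φD] K := SemidirectProduct.map i (MonoidHom.id K) (by
    intro k; ext a; exact (k.2.1 a).symm)
  let mB : A ⋊[φA] K →* B ⋊[φB] K := SemidirectProduct.map i' (MonoidHom.id K) (by
    intro k; ext a; exact (k.2.2 a).symm)
  have hmD : Injective mD := by
    intro x y h
    have h1 := congrArg SemidirectProduct.left h
    have h2 := congrArg SemidirectProduct.right h
    exact SemidirectProduct.ext (hi h1) h2
  have hmB : Injective mB := by
    intro x y h
    have h1 := congrArg SemidirectProduct.left h
    have h2 := congrArg SemidirectProduct.right h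
    exact SemidirectProduct.ext (hi' h1) h2
  obtain ⟨J1, hJ1, hJ1'⟩ := exists_extension hH (SemidirectProduct.inl : D →* D ⋊[φD] K)
    SemidirectProduct.inl_injective jD hjD
  obtain ⟨J2, hJ2, hJ2'⟩ := exists_extension hH mB hmB (J1.comp mD) (hJ1.comp hmD)
  obtain ⟨h, hh⟩ := exists_conj hH jB (J2.comp SemidirectProduct.inl) hjB
    (hJ2.comp SemidirectProduct.inl_injective)
  let κ : ι → K := fun k => ⟨(α k, δ k, ε k), hδ k, hε k⟩
  refine ⟨h, fun k => J1 (SemidirectProduct.inr (κ k)), ?_, ?_, ?_⟩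
  · intro a
    have h1 := hJ2' (SemidirectProduct.inl a)
    simp only [mB, mD, SemidirectProduct.map_inl, MonoidHom.comp_apply, hJ1'] at h1
    rw [← hij, hh, MonoidHom.comp_apply, h1, hij]
  · intro k x
    rw [← hJ1', ← hJ1', ← map_inv, ← map_inv, ← map_mul, ← map_mul, ← SemidirectProduct.inl_aut]
    rfl
  · intro k x
    have h1 := hJ2' (SemidirectProduct.inr (κ k))
    simp only [mB, mD, SemidirectProduct.map_inr, MonoidHom.comp_apply, MonoidHom.id_apply] at h1
    beta_reduce
    rw [hh, hh, ← h1, MonoidHom.comp_apply, MonoidHom.comp_apply, ← map_inv, ← map_inv,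
      ← map_mul, ← map_mul, ← SemidirectProduct.inl_aut]
    rfl

theorem mem_closure_of_mapsTo {γ : MulAut H} {S : Set H} (h : ∀ x ∈ S, γ x ∈ S) :
    ∀ x ∈ Subgroup.closure S, γ x ∈ Subgroup.closure S := by
  intro x hx
  have : Subgroup.closure S ≤ (Subgroup.closure S).comap γ.toMonoidHom := by
    rw [Subgroup.closure_le]
    intro y hy
    exact Subgroup.subset_closure (h y hy)
  exact this hx

theorem eq_on_closure {γ γ' : MulAut H} {S : Set H} (h : ∀ x ∈ S, γ x = γ' x) :
    ∀ x ∈ Subgroup.closure S, γ x = γ' x := by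
  intro x hx
  exact MonoidHom.eqOn_closure (f := γ.toMonoidHom) (g := γ'.toMonoidHom) h hx

theorem exists_restrict (γ : MulAut H) (S : Subgroup H) [Finite S]
    (h : ∀ x ∈ S, γ x ∈ S) : ∃ δ : MulAut S, ∀ x : S, (δ x : H) = γ x := by
  let f : S →* S := (γ.toMonoidHom.comp S.subtype).codRestrict S fun x => h x x.2
  have hf : Injective f := by
    intro x y hxy
    exact Subtype.ext (γ.injective (congrArg Subtype.val hxy))
  exact ⟨MulEquiv.ofBijective f (Finite.injective_iff_bijective.1 hf), fun x => rfl⟩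

/-- Amalgamation, concrete form. -/
theorem amalg (hH : IsHallUniversal H) (m : ℕ) {A B D : Set H} (hB : B.Finite) (hD : D.Finite)
    (hAB : A ⊆ B) (hAD : A ⊆ D) (d e : ℕ → MulAut H)
    (dA : ∀ i < m, ∀ x ∈ A, d i x ∈ A) (dD : ∀ i < m, ∀ x ∈ D, d i x ∈ D)
    (eB : ∀ i < m, ∀ x ∈ B, e i x ∈ B) (hde : ∀ i < m, ∀ x ∈ A, e i x = d i x) :
    ∃ (E : Set H) (f : ℕ → MulAut H) (h : MulAut H), E.Finite ∧ D ⊆ E ∧ (∀ x ∈ B, h x ∈ E) ∧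
      (∀ x ∈ A, h x = x) ∧ (∀ i < m, ∀ x ∈ E, f i x ∈ E) ∧ (∀ i < m, ∀ x ∈ D, f i x = d i x) ∧
      (∀ i < m, ∀ x ∈ B, f i (h x) = h (e i x)) := by
  have := finite_closure hH hB
  have := finite_closure hH hD
  have := finite_closure hH (hB.subset hAB)
  have r1 : ∀ k : Fin m, _ := fun k => exists_restrict (d k) (Subgroup.closure A)
    (mem_closure_of_mapsTo (dA k k.2))
  have r2 : ∀ k : Fin m, _ := fun k => exists_restrict (d k) (Subgroup.closure D)
    (mem_closure_of_mapsTo (dD k k.2))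
  have r3 : ∀ k : Fin m, _ := fun k => exists_restrict (e k) (Subgroup.closure B)
    (mem_closure_of_mapsTo (eB k k.2))
  choose α hα using r1
  choose δ hδ using r2
  choose ε hε using r3
  obtain ⟨h, v, h1, h2, h3⟩ := amalg_abstract hH
    (Subgroup.inclusion (Subgroup.closure_mono hAD)) (Subgroup.inclusion_injective _)
    (Subgroup.inclusion (Subgroup.closure_mono hAB)) (Subgroup.inclusion_injective _)
    (Subgroup.subtype _) (Subgroup.subtype_injective _)
    (Subgroup.subtype _) (Subgroup.subtype_injective _) (fun a => rfl) α δ ε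
    (by
      intro k a
      apply Subtype.ext
      simp [hδ, hα])
    (by
      intro k a
      apply Subtype.ext
      simp only [hε, hα, Subgroup.coe_inclusion]
      exact eq_on_closure (hde k k.2) a a.2)
  let f : ℕ → MulAut H := fun i => if hi : i < m then MulAut.conj (v ⟨i, hi⟩) else 1
  have hf : ∀ i (hi : i < m) x, f i x = v ⟨i, hi⟩ * x * (v ⟨i, hi⟩)⁻¹ := by
    intro i hi x
    simp [f, hi]
  let E0 : Set H := D ∪ (MulAut.conj h '' B) ∪ Set.range v
  have hE0 : E0.Finite := (hD.union (hB.image _)).union (Set.finite_range v)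
  have := finite_closure hH hE0
  refine ⟨Subgroup.closure E0, f, MulAut.conj h, Set.toFinite _, ?_, ?_, ?_, ?_, ?_, ?_⟩
  · intro x hx
    exact Subgroup.subset_closure (Or.inl (Or.inl hx))
  · intro x hx
    exact Subgroup.subset_closure (Or.inl (Or.inr ⟨x, hx, rfl⟩))
  · intro x hx
    exact h1 ⟨x, Subgroup.subset_closure hx⟩
  · intro i hi x hx
    rw [hf i hi]
    have hv : v ⟨i, hi⟩ ∈ Subgroup.closure E0 := Subgroup.subset_closure (Or.inr ⟨_, rfl⟩)
    exact mul_mem (mul_mem hv hx) (inv_mem hv)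
  · intro i hi x hx
    rw [hf i hi]
    exact (h2 ⟨i, hi⟩ ⟨x, Subgroup.subset_closure hx⟩).trans (hδ ⟨i, hi⟩ _)
  · intro i hi x hx
    rw [hf i hi, MulAut.conj_apply, MulAut.conj_apply]
    refine (h3 ⟨i, hi⟩ ⟨x, Subgroup.subset_closure hx⟩).trans ?_
    congr 2
    exact hε ⟨i, hi⟩ _

open Filter Topology

/-! ### Topology of the automorphism group -/

theorem tendsto_aut_iff {α : Type*} {l : Filter α} {f : α → MulAut H} {g : MulAut H} :
    Tendsto f l (𝓝 g) ↔ ∀ x, ∀ᶠ z in l, f z x = g x := by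
  let : TopologicalSpace H := ⊥
  have : DiscreteTopology H := ⟨rfl⟩
  rw [nhds_induced, tendsto_comap_iff, tendsto_pi_nhds]
  simp only [nhds_discrete, tendsto_pure, Function.comp_apply]

theorem eventually_apply_eq (g : MulAut H) (x : H) : ∀ᶠ y in 𝓝 g, y x = g x :=
  (tendsto_aut_iff (f := fun y => y)).1 tendsto_id x

theorem eventually_eq_on (g : MulAut H) {E : Set H} (hE : E.Finite) :
    ∀ᶠ y in 𝓝 g, ∀ x ∈ E, y x = g x :=
  (eventually_all_finite hE).2 fun x _ => eventually_apply_eq g x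

theorem mem_nhds_aut_iff {s : Set (MulAut H)} {g : MulAut H} :
    s ∈ 𝓝 g ↔ ∃ E : Set H, E.Finite ∧ ∀ y : MulAut H, (∀ x ∈ E, y x = g x) → y ∈ s := by
  constructor
  · intro hs
    have hle : (⨅ x, 𝓟 {y : MulAut H | y x = g x}) ≤ 𝓝 g := by
      have := (tendsto_aut_iff (l := ⨅ x, 𝓟 {y : MulAut H | y x = g x}) (f := fun y => y)
        (g := g)).2 (fun x => mem_iInf_of_mem x (mem_principal_self _))
      exact this
    obtain ⟨E, hE, hEs⟩ := (hasBasis_iInf_principal_finite _).mem_iff.1 (hle hs)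
    refine ⟨E, hE, fun y hy => hEs ?_⟩
    simpa using hy
  · rintro ⟨E, hE, h⟩
    filter_upwards [eventually_eq_on g hE] with y hy using h y hy

instance autTopGroup : IsTopologicalGroup (MulAut H) where
  continuous_mul := by
    rw [continuous_iff_continuousAt]
    rintro ⟨a, b⟩
    refine tendsto_aut_iff.2 fun x => ?_
    have h1 := (continuous_snd.tendsto (a, b)).eventually (eventually_apply_eq b x)
    have h2 := (continuous_fst.tendsto (a, b)).eventually (eventually_apply_eq a (b x))
    filter_upwards [h1, h2] with p hp1 hp2
    simp only [MulAut.mul_apply, hp1, hp2]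
  continuous_inv := by
    rw [continuous_iff_continuousAt]
    intro a
    refine tendsto_aut_iff.2 fun x => ?_
    filter_upwards [eventually_apply_eq a (a⁻¹ x)] with y hy
    apply y.injective
    simp only [MulAut.apply_inv_self] at hy ⊢
    exact hy.symm

theorem dense_aut_iff {O : Set (MulAut H)} : Dense O ↔
    ∀ (g : MulAut H) (E : Set H), E.Finite → ∃ y ∈ O, ∀ x ∈ E, y x = g x := by
  constructor
  · intro h g E hE
    obtain ⟨y, hy⟩ := ((mem_closure_iff_frequently.1 (h g)).and_eventually
      (eventually_eq_on g hE)).exists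
    exact ⟨y, hy⟩
  · intro h g
    rw [mem_closure_iff_nhds]
    intro t ht
    obtain ⟨E, hE, hEt⟩ := mem_nhds_aut_iff.1 ht
    obtain ⟨y, hy, hyE⟩ := h g E hE
    exact ⟨y, hEt y hyE, hy⟩

theorem eventually_near (g : MulAut H) {E : Set H} (hE : E.Finite) :
    ∀ᶠ y in 𝓝 g, ∀ x ∈ E, y x = g x ∧ y⁻¹ x = g⁻¹ x := by
  have h1 := eventually_eq_on g hE
  have h2 := (continuous_inv.tendsto g).eventually (eventually_eq_on g⁻¹ hE)
  filter_upwards [h1, h2] with y hy1 hy2 x hx using ⟨hy1 x hx, hy2 x hx⟩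

/-- Limits of coherent sequences of automorphisms. -/
theorem exists_limit (A : ℕ → Set H) (hmono : Monotone A) (hex : ∀ x, ∃ n, x ∈ A n)
    (y : ℕ → MulAut H)
    (hy : ∀ n, ∀ x ∈ A n, y (n + 1) x = y n x ∧ (y (n + 1))⁻¹ x = (y n)⁻¹ x) :
    ∃ h : MulAut H, ∀ n, ∀ x ∈ A n, h x = y n x ∧ h⁻¹ x = (y n)⁻¹ x := by
  have key : ∀ n m, n ≤ m → ∀ x ∈ A n, y m x = y n x ∧ (y m)⁻¹ x = (y n)⁻¹ x := by
    intro n m hnm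
    induction m, hnm using Nat.le_induction with
    | base => intro x _; exact ⟨rfl, rfl⟩
    | succ m hm ih =>
      intro x hx
      have h1 := hy m x (hmono hm hx)
      have h2 := ih x hx
      exact ⟨h1.1.trans h2.1, h1.2.trans h2.2⟩
  choose N hN using hex
  have k1 : ∀ x m, N x ≤ m → y (N x) x = y m x := fun x m hm => (key _ _ hm x (hN x)).1.symm
  have k2 : ∀ x m, N x ≤ m → (y (N x))⁻¹ x = (y m)⁻¹ x :=
    fun x m hm => (key _ _ hm x (hN x)).2.symm
  let h : MulAut H :=
    { toFun := fun x => y (N x) x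
      invFun := fun x => (y (N x))⁻¹ x
      left_inv := by
        intro x
        have hm1 := le_max_left (N x) (N (y (N x) x))
        have hm2 := le_max_right (N x) (N (y (N x) x))
        generalize max (N x) (N (y (N x) x)) = m at hm1 hm2
        beta_reduce
        rw [k2 _ m hm2, k1 x m hm1, MulAut.inv_apply_self]
      right_inv := by
        intro x
        have hm1 := le_max_left (N x) (N ((y (N x))⁻¹ x))
        have hm2 := le_max_right (N x) (N ((y (N x))⁻¹ x))
        generalize max (N x) (N ((y (N x))⁻¹ x)) = m at hm1 hm2
        beta_reduce
        rw [k1 _ m hm2, k2 x m hm1, MulAut.apply_inv_self]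
      map_mul' := by
        intro a b
        rw [k1 a (N a + N b + N (a * b)) (by omega), k1 b (N a + N b + N (a * b)) (by omega),
          k1 (a * b) (N a + N b + N (a * b)) (by omega), map_mul] }
  refine ⟨h, fun n x hx => ?_⟩
  constructor
  · change y (N x) x = y n x
    rcases le_total (N x) n with hle | hle
    · exact k1 x n hle
    · exact (key _ _ hle x hx).1
  · change (y (N x))⁻¹ x = (y n)⁻¹ x
    rcases le_total (N x) n with hle | hle
    · exact k2 x n hle
    · exact (key _ _ hle x hx).2

theorem dep_choice {σ : ℕ → Type*} (s0 : σ 0) (R : ∀ n, σ n → σ (n + 1) → Prop)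
    (step : ∀ n s, ∃ t, R n s t) :
    ∃ f : ∀ n, σ n, f 0 = s0 ∧ ∀ n, R n (f n) (f (n + 1)) := by
  choose F hF using step
  exact ⟨fun n => Nat.rec s0 (fun n s => F n s) n, rfl, fun n => hF n _⟩

/-! ### Generic tuples -/

/-- `c 0, …, c (n-1)` is a generic tuple of automorphisms. -/
def Generic (n : ℕ) (c : ℕ → MulAut H) : Prop :=
  (∀ F : Set H, F.Finite → ∃ A : Set H, A.Finite ∧ F ⊆ A ∧ ∀ i < n, ∀ x ∈ A, c i x ∈ A) ∧
  (∀ A B : Set H, B.Finite → A ⊆ B → ∀ e : ℕ → MulAut H,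
    (∀ i < n, ∀ x ∈ A, c i x ∈ A) → (∀ i < n, ∀ x ∈ B, e i x ∈ B) →
    (∀ i < n, ∀ x ∈ A, e i x = c i x) →
    ∃ h : MulAut H, (∀ x ∈ A, h x = x) ∧ ∀ i < n, ∀ x ∈ B, c i (h x) = h (e i x))

theorem generic_zero (c : ℕ → MulAut H) : Generic 0 c :=
  ⟨fun F hF => ⟨F, hF, subset_rfl, by simp⟩, fun A B _ _ e _ _ _ => ⟨1, by simp, by simp⟩⟩

theorem homog_forth {n : ℕ} {c d : ℕ → MulAut H} (hc : Generic n c) (hd : Generic n d)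
    {A : Set H} (hA : A.Finite) (cA : ∀ i < n, ∀ x ∈ A, c i x ∈ A) (u : MulAut H)
    (hu : ∀ i < n, ∀ x ∈ A, d i (u x) = u (c i x)) (z : H) :
    ∃ (A' : Set H) (u' : MulAut H), A'.Finite ∧ (∀ i < n, ∀ x ∈ A', c i x ∈ A') ∧
      (∀ i < n, ∀ x ∈ A', d i (u' x) = u' (c i x)) ∧ A ⊆ A' ∧ z ∈ A' ∧
      ∀ x ∈ A, u' x = u x := by
  obtain ⟨A', hA', hAA', cA'⟩ := hc.1 (insert z A) (hA.insert z)
  have hsub : A ⊆ A' := (Set.subset_insert _ _).trans hAA'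
  obtain ⟨h, h1, h2⟩ := hd.2 (u '' A) (u '' A') (hA'.image _) (Set.image_mono hsub)
    (fun i => u * c i * u⁻¹)
    (by
      rintro i hi _ ⟨x, hx, rfl⟩
      rw [hu i hi x hx]
      exact ⟨_, cA i hi x hx, rfl⟩)
    (by
      rintro i hi _ ⟨x, hx, rfl⟩
      simp only [MulAut.mul_apply, MulAut.inv_apply_self]
      exact ⟨_, cA' i hi x hx, rfl⟩)
    (by
      rintro i hi _ ⟨x, hx, rfl⟩
      simp only [MulAut.mul_apply, MulAut.inv_apply_self]
      exact (hu i hi x hx).symm)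
  refine ⟨A', h * u, hA', cA', ?_, hsub, hAA' (Set.mem_insert _ _), ?_⟩
  · intro i hi x hx
    have := h2 i hi (u x) ⟨x, hx, rfl⟩
    simpa using this
  · intro x hx
    exact h1 _ ⟨x, hx, rfl⟩

/-- Generic tuples which agree on a finite invariant set are conjugate over this set. -/
theorem homog [Countable H] {n : ℕ} {c d : ℕ → MulAut H} (hc : Generic n c) (hd : Generic n d)
    {B : Set H} (hB : B.Finite) (cB : ∀ i < n, ∀ x ∈ B, c i x ∈ B)
    (hcd : ∀ i < n, ∀ x ∈ B, d i x = c i x) :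
    ∃ k : MulAut H, (∀ x ∈ B, k x = x) ∧ ∀ i < n, k * c i = d i * k := by
  obtain ⟨en, hen⟩ := exists_surjective_nat H
  let σ : ℕ → Type _ := fun _ => {p : Set H × MulAut H // p.1.Finite ∧
    (∀ i < n, ∀ x ∈ p.1, c i x ∈ p.1) ∧ ∀ i < n, ∀ x ∈ p.1, d i (p.2 x) = p.2 (c i x)}
  obtain ⟨f, f0, hf⟩ := dep_choice (σ := σ) ⟨(B, 1), hB, cB, by simpa using hcd⟩
    (fun m p q => p.1.1 ⊆ q.1.1 ∧ en m ∈ q.1.1 ∧ q.1.2⁻¹ (en m) ∈ q.1.1 ∧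
      ∀ x ∈ p.1.1, q.1.2 x = p.1.2 x) (by
    rintro m ⟨⟨A, u⟩, hA, cA, hu⟩
    obtain ⟨A1, u1, hA1, cA1, hu1, hs1, hz1, he1⟩ := homog_forth hc hd hA cA u hu (en m)
    obtain ⟨A2, w, hA2, dA2, hw, hs2, hz2, he2⟩ := homog_forth hd hc (hA1.image u1)
      (by
        rintro i hi _ ⟨x, hx, rfl⟩
        exact ⟨_, cA1 i hi x hx, (hu1 i hi x hx).symm⟩) u1⁻¹
      (by
        rintro i hi _ ⟨x, hx, rfl⟩
        rw [hu1 i hi x hx]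
        simp) (en m)
    have hwu : ∀ x ∈ A1, w (u1 x) = x := by
      intro x hx
      rw [he2 _ ⟨x, hx, rfl⟩, MulAut.inv_apply_self]
    have hwu' : ∀ x ∈ A1, w⁻¹ x = u1 x := by
      intro x hx
      apply w.injective
      rw [MulAut.apply_inv_self, hwu x hx]
    have hA1w : A1 ⊆ w '' A2 := fun x hx => ⟨u1 x, hs2 ⟨x, hx, rfl⟩, hwu x hx⟩
    refine ⟨⟨(w '' A2, w⁻¹), hA2.image _, ?_, ?_⟩, ?_, ?_, ?_, ?_⟩
    · rintro i hi _ ⟨x, hx, rfl⟩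
      rw [hw i hi x hx]
      exact ⟨_, dA2 i hi x hx, rfl⟩
    · rintro i hi _ ⟨x, hx, rfl⟩
      dsimp only
      rw [hw i hi x hx]
      simp
    · exact hs1.trans hA1w
    · exact hA1w hz1
    · dsimp only
      rw [inv_inv]
      exact ⟨_, hz2, rfl⟩
    · intro x hx
      exact (hwu' x (hs1 hx)).trans (he1 x hx))
  have inv_eq : ∀ m x, (f m).1.2⁻¹ x ∈ (f m).1.1 →
      (f (m + 1)).1.2⁻¹ x = (f m).1.2⁻¹ x := by
    intro m x hx
    apply (f (m + 1)).1.2.injective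
    rw [(hf m).2.2.2 _ hx, MulAut.apply_inv_self, MulAut.apply_inv_self]
  let L : ℕ → Set H := fun m => {x | x ∈ (f m).1.1 ∧ (f m).1.2⁻¹ x ∈ (f m).1.1}
  have hL : Monotone L := by
    refine monotone_nat_of_le_succ ?_
    rintro m x ⟨h1, h2⟩
    refine ⟨(hf m).1 h1, ?_⟩
    rw [inv_eq m x h2]
    exact (hf m).1 h2
  have hex : ∀ x, ∃ m, x ∈ L m := by
    intro x
    obtain ⟨m, rfl⟩ := hen x
    exact ⟨m + 1, (hf m).2.1, (hf m).2.2.1⟩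
  obtain ⟨k, hk⟩ := exists_limit L hL hex (fun m => (f m).1.2)
    (fun m x hx => ⟨(hf m).2.2.2 x hx.1, inv_eq m x hx.2⟩)
  refine ⟨k, ?_, ?_⟩
  · intro x hx
    have : ∀ m, x ∈ (f m).1.1 ∧ (f m).1.2 x = x := by
      intro m
      induction m with
      | zero => rw [f0]; exact ⟨hx, rfl⟩
      | succ m ih => exact ⟨(hf m).1 ih.1, ((hf m).2.2.2 x ih.1).trans ih.2⟩
    obtain ⟨m, hm⟩ := hex x
    exact ((hk m x hm).1).trans (this m).2
  · intro i hi
    ext x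
    obtain ⟨m1, hm1⟩ := hex x
    obtain ⟨m2, hm2⟩ := hex (c i x)
    have e1 := hL (le_max_left m1 m2) hm1
    have e2 := hL (le_max_right m1 m2) hm2
    rw [MulAut.mul_apply, MulAut.mul_apply, (hk _ _ e1).1, (hk _ _ e2).1]
    exact ((f _).2.2.2 i hi x e1.1).symm

/-- Any automorphism can be approximated by one which, jointly with a given generic tuple,
preserves a prescribed finite set. -/
theorem generic_dense_one (hH : IsHallUniversal H) {n : ℕ} {c : ℕ → MulAut H} (hc : Generic n c)
    (g0 : MulAut H) {S F : Set H} (hS : S.Finite) (hF : F.Finite) :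
    ∃ (g : MulAut H) (D : Set H), D.Finite ∧ F ⊆ D ∧ (∀ i < n, ∀ x ∈ D, c i x ∈ D) ∧
      (∀ x ∈ D, g x ∈ D) ∧ ∀ x ∈ S, g x = g0 x := by
  obtain ⟨D0, hD0, hsub, cD0⟩ := hc.1 (F ∪ (S ∪ g0 '' S)) (hF.union (hS.union (hS.image _)))
  have hu : ∀ i, ∃ u : H, ∀ x ∈ D0, u * x * u⁻¹ = c i x := fun i => exists_inner hH (c i) hD0
  choose u hu using hu
  obtain ⟨w, hw⟩ := exists_inner hH g0 hS
  let E0 : Set H := D0 ∪ (u '' Set.Iio n) ∪ {w}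
  have hE0 : E0.Finite := (hD0.union ((Set.finite_Iio n).image _)).union (Set.finite_singleton w)
  have := finite_closure hH hE0
  have hDE : D0 ⊆ Subgroup.closure E0 :=
    fun x hx => Subgroup.subset_closure (Or.inl (Or.inl hx))
  have cE : ∀ i < n, ∀ x ∈ (Subgroup.closure E0 : Set H),
      MulAut.conj (u i) x ∈ (Subgroup.closure E0 : Set H) := by
    intro i hi x hx
    have hv : u i ∈ Subgroup.closure E0 :=
      Subgroup.subset_closure (Or.inl (Or.inr ⟨i, hi, rfl⟩))
    exact mul_mem (mul_mem hv hx) (inv_mem hv)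
  obtain ⟨h, h1, h2⟩ := hc.2 D0 (Subgroup.closure E0) (Set.toFinite _) hDE
    (fun i => MulAut.conj (u i)) cD0 cE (fun i _ x hx => hu i x hx)
  refine ⟨h * MulAut.conj w * h⁻¹, h '' (Subgroup.closure E0), (Set.toFinite _).image _,
    ?_, ?_, ?_, ?_⟩
  · intro x hx
    have hx' : x ∈ D0 := hsub (Or.inl hx)
    exact ⟨x, hDE hx', h1 x hx'⟩
  · rintro i hi _ ⟨x, hx, rfl⟩
    rw [h2 i hi x hx]
    exact ⟨_, cE i hi x hx, rfl⟩
  · rintro _ ⟨x, hx, rfl⟩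
    simp only [MulAut.mul_apply, MulAut.inv_apply_self]
    have hv : w ∈ Subgroup.closure E0 := Subgroup.subset_closure (Or.inr rfl)
    exact ⟨_, mul_mem (mul_mem hv hx) (inv_mem hv), rfl⟩
  · intro x hx
    have hx' : x ∈ D0 := hsub (Or.inr (Or.inl hx))
    have hgx : g0 x ∈ D0 := hsub (Or.inr (Or.inr ⟨x, hx, rfl⟩))
    have h3 : h⁻¹ x = x := by
      apply h.injective
      rw [MulAut.apply_inv_self, h1 x hx']
    simp only [MulAut.mul_apply, h3, MulAut.conj_apply, hw x hx, h1 _ hgx]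

/-- The extension clause in the definition of genericity. -/
def ExtClause (n : ℕ) (c : ℕ → MulAut H) (A B : Set H) (e : ℕ → MulAut H) : Prop :=
  A ⊆ B → (∀ i < n, ∀ x ∈ A, c i x ∈ A) → (∀ i < n, ∀ x ∈ B, e i x ∈ B) →
    (∀ i < n, ∀ x ∈ A, e i x = c i x) →
    ∃ h : MulAut H, (∀ x ∈ A, h x = x) ∧ ∀ i < n, ∀ x ∈ B, c i (h x) = h (e i x)

theorem update_agree {c : ℕ → MulAut H} {n : ℕ} {g g' : MulAut H} {x : H} (h : g' x = g x)
    (i : ℕ) : update c n g' i x = update c n g i x := by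
  by_cases hi : i = n
  · subst hi; simpa using h
  · simp [hi]

theorem extClause_open (n : ℕ) (c : ℕ → MulAut H) {A B : Set H} (hB : B.Finite) (hA : A.Finite)
    (e : ℕ → MulAut H) :
    IsOpen {g | ExtClause (n + 1) (update c n g) A B e} := by
  rw [isOpen_iff_mem_nhds]
  intro g hg
  rw [mem_nhds_aut_iff]
  by_cases hp : A ⊆ B ∧ (∀ i < n + 1, ∀ x ∈ A, update c n g i x ∈ A) ∧
      (∀ i < n + 1, ∀ x ∈ B, e i x ∈ B) ∧ (∀ i < n + 1, ∀ x ∈ A, e i x = update c n g i x)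
  · obtain ⟨h, h1, h2⟩ := hg hp.1 hp.2.1 hp.2.2.1 hp.2.2.2
    refine ⟨h '' B, hB.image _, fun y hy _ _ _ _ => ⟨h, h1, fun i hi x hx => ?_⟩⟩
    rw [update_agree (hy (h x) ⟨x, hx, rfl⟩), h2 i hi x hx]
  · refine ⟨A, hA, fun y hy q1 q2 q3 q4 => absurd ⟨q1, ?_, q3, ?_⟩ hp⟩
    · intro i hi x hx
      rw [← update_agree (hy x hx)]
      exact q2 i hi x hx
    · intro i hi x hx
      rw [← update_agree (hy x hx)]
      exact q4 i hi x hx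

theorem extClause_dense (hH : IsHallUniversal H) {n : ℕ} {c : ℕ → MulAut H} (hc : Generic n c)
    {A B : Set H} (hB : B.Finite) (hA : A.Finite) (e : ℕ → MulAut H) :
    Dense {g | ExtClause (n + 1) (update c n g) A B e} := by
  rw [dense_aut_iff]
  intro g0 S hS
  obtain ⟨g1, D, hD, hSA, cD, gD, hg1⟩ := generic_dense_one hH hc g0 hS (hS.union hA)
  by_cases hp : A ⊆ B ∧ (∀ i < n + 1, ∀ x ∈ A, update c n g1 i x ∈ A) ∧
      (∀ i < n + 1, ∀ x ∈ B, e i x ∈ B) ∧ (∀ i < n + 1, ∀ x ∈ A, e i x = update c n g1 i x)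
  swap
  · exact ⟨g1, fun q1 q2 q3 q4 => absurd ⟨q1, q2, q3, q4⟩ hp, hg1⟩
  obtain ⟨p1, p2, p3, p4⟩ := hp
  have hAD : A ⊆ D := fun x hx => hSA (Or.inr hx)
  have uD : ∀ i < n + 1, ∀ x ∈ D, update c n g1 i x ∈ D := by
    intro i hi x hx
    by_cases hin : i = n
    · subst hin; simpa using gD x hx
    · simpa [hin] using cD i (by omega) x hx
  obtain ⟨E, f, h, hE, hDE, hBE, hhA, fE, fD, fB⟩ := amalg hH (n + 1) hB hD p1 hAD
    (update c n g1) e p2 uD p3 p4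
  obtain ⟨h', h1', h2'⟩ := hc.2 D E hE hDE f cD (fun i hi => fE i (by omega)) (by
    intro i hi x hx
    rw [fD i (by omega) x hx]
    simp [hi.ne])
  refine ⟨h' * f n * h'⁻¹, ?_, ?_⟩
  · intro _ _ _ _
    refine ⟨h' * h, ?_, ?_⟩
    · intro x hx
      rw [MulAut.mul_apply, hhA x hx, h1' x (hAD hx)]
    · intro i hi x hx
      by_cases hin : i = n
      · subst hin
        simp only [update_self, MulAut.mul_apply, MulAut.inv_apply_self]
        rw [fB i hi x hx]
      · have hi' : i < n := by omega
        simp only [update_of_ne hin, MulAut.mul_apply]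
        rw [h2' i hi' _ (hBE x hx), fB i hi x hx]
  · intro x hx
    have hxD : x ∈ D := hSA (Or.inl hx)
    have h3 : h'⁻¹ x = x := by
      apply h'.injective
      rw [MulAut.apply_inv_self, h1' x hxD]
    have h4 : f n x = g1 x := by
      rw [fD n (by omega) x hxD]
      simp
    rw [MulAut.mul_apply, MulAut.mul_apply, h3, h4, h1' _ (gD x hxD), hg1 x hx]

/-- Comeagerly many automorphisms extend a generic tuple to a longer generic tuple. -/
theorem generic_residual (hH : IsHallUniversal H) {n : ℕ} {c : ℕ → MulAut H}
    (hc : Generic n c) : ∀ᶠ g in residual (MulAut H), Generic (n + 1) (update c n g) := by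
  have := hH.countable
  have h1 : ∀ᶠ g in residual (MulAut H), ∀ F : Finset H, ∃ A : Set H, A.Finite ∧ (F : Set H) ⊆ A ∧
      ∀ i < n + 1, ∀ x ∈ A, update c n g i x ∈ A := by
    rw [eventually_countable_forall]
    intro F
    apply residual_of_dense_open
    · rw [isOpen_iff_mem_nhds]
      rintro g ⟨A, hA, hFA, h⟩
      rw [mem_nhds_aut_iff]
      refine ⟨A, hA, fun y hy => ⟨A, hA, hFA, fun i hi x hx => ?_⟩⟩
      rw [update_agree (hy x hx)]
      exact h i hi x hx
    · rw [dense_aut_iff]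
      intro g0 S hS
      obtain ⟨g, D, hD, hFD, cD, gD, hg⟩ := generic_dense_one hH hc g0 hS F.finite_toSet
      refine ⟨g, ⟨D, hD, hFD, fun i hi x hx => ?_⟩, hg⟩
      by_cases hin : i = n
      · subst hin; simpa using gD x hx
      · simpa [hin] using cD i (by omega) x hx
  have h2 : ∀ᶠ g in residual (MulAut H), ∀ q : Finset H × Finset H × (Fin (n + 1) → H),
      ExtClause (n + 1) (update c n g) q.1 q.2.1
        (fun i => MulAut.conj (q.2.2 (Fin.ofNat (n + 1) i))) := by
    rw [eventually_countable_forall]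
    intro q
    exact residual_of_dense_open (extClause_open n c q.2.1.finite_toSet q.1.finite_toSet _)
      (extClause_dense hH hc q.2.1.finite_toSet q.1.finite_toSet _)
  filter_upwards [h1, h2] with g hg1 hg2
  constructor
  · intro F hF
    obtain ⟨A, hA⟩ := hg1 hF.toFinset
    exact ⟨A, by simpa using hA⟩
  · intro A B hB hAB e q2 q3 q4
    have hu : ∀ i, ∃ u : H, ∀ x ∈ B, u * x * u⁻¹ = e i x := fun i => exists_inner hH (e i) hB
    choose u hu using hu
    have hof : ∀ i < n + 1, ((Fin.ofNat (n + 1) i : Fin (n + 1)) : ℕ) = i := by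
      intro i hi
      simp [Fin.ofNat, Nat.mod_eq_of_lt hi]
    have key := hg2 ((hB.subset hAB).toFinset, hB.toFinset, fun i => u i)
    simp only [Set.Finite.coe_toFinset] at key
    have hconj : ∀ i < n + 1, ∀ x ∈ B,
        MulAut.conj (u (Fin.ofNat (n + 1) i : Fin (n + 1))) x = e i x := by
      intro i hi x hx
      rw [hof i hi, MulAut.conj_apply, hu i x hx]
    obtain ⟨h, k1, k2⟩ := key hAB q2
      (fun i hi x hx => by rw [hconj i hi x hx]; exact q3 i hi x hx)
      (fun i hi x hx => by rw [hconj i hi x (hAB hx)]; exact q4 i hi x hx)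
    exact ⟨h, k1, fun i hi x hx => by rw [k2 i hi x hx, hconj i hi x hx]⟩

/-! ### Subgroups of small index -/

theorem exists_same_coset (G : Subgroup (MulAut H))
    (hG : Cardinal.mk (MulAut H ⧸ G) < 2 ^ Cardinal.aleph0) (f : (ℕ → Bool) → MulAut H) :
    ∃ a b, a ≠ b ∧ (f a)⁻¹ * f b ∈ G := by
  by_contra hcon
  push Not at hcon
  have hinj : Injective (fun a => (QuotientGroup.mk (f a) : MulAut H ⧸ G)) := by
    intro a b hab
    by_contra hne
    exact hcon a b hne (QuotientGroup.eq.1 hab)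
  have h1 := Cardinal.mk_le_of_injective (α := ULift (ℕ → Bool)) (β := MulAut H ⧸ G)
    (f := fun a => QuotientGroup.mk (f a.down)) (hinj.comp ULift.down_injective)
  have h2 := h1.trans_lt hG
  simp at h2

/-- A Mycielski-type argument: a subgroup of small index meets every comeager set, even near
the identity. -/
theorem small_index_meets [Countable H] (G : Subgroup (MulAut H))
    (hG : Cardinal.mk (MulAut H ⧸ G) < 2 ^ Cardinal.aleph0) {D : Set (MulAut H)}
    (hD : D ∈ residual (MulAut H)) {E : Set H} (hE : E.Finite) :
    ∃ g ∈ G, g ∈ D ∧ ∀ x ∈ E, g x = x := by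
  obtain ⟨en, hen⟩ := exists_surjective_nat H
  obtain ⟨𝒮, hop, hde, hct, hsub⟩ := mem_residual_iff.1 hD
  obtain ⟨O, hO⟩ := (hct.insert Set.univ).exists_eq_range (Set.insert_nonempty _ _)
  have hOop : ∀ i, IsOpen (O i) := by
    intro i
    have : O i ∈ insert Set.univ 𝒮 := hO ▸ Set.mem_range_self i
    rcases this with h | h
    · rw [h]; exact isOpen_univ
    · exact hop _ h
  have hOde : ∀ i, Dense (O i) := by
    intro i
    have : O i ∈ insert Set.univ 𝒮 := hO ▸ Set.mem_range_self i
    rcases this with h | h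
    · rw [h]; exact dense_univ
    · exact hde _ h
  have hOD : ∀ g, (∀ i, g ∈ O i) → g ∈ D := by
    intro g hg
    apply hsub
    intro t ht
    have : t ∈ Set.range O := hO ▸ Set.mem_insert_of_mem _ ht
    obtain ⟨i, rfl⟩ := this
    exact hg i
  let σ : ℕ → Type _ := fun n => ((Fin n → Bool) → MulAut H) × {S : Set H // S.Finite}
  obtain ⟨f, f0, hf⟩ := dep_choice (σ := σ) (fun _ => 1, ⟨E, hE⟩)
    (fun n p q => p.2.1 ⊆ q.2.1 ∧ en n ∈ q.2.1 ∧
      (∀ s, ∀ x ∈ p.2.1, q.1 s x = p.1 (Fin.init s) x ∧ (q.1 s)⁻¹ x = (p.1 (Fin.init s))⁻¹ x) ∧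
      ∀ s t, s ≠ t → ∀ u v : MulAut H, (∀ x ∈ q.2.1, u x = q.1 s x) →
        (∀ x ∈ q.2.1, v x = q.1 t x) → ∀ i : Fin (n + 1), u⁻¹ * v ∈ O i) (by
    rintro n ⟨y, S, hS⟩
    let I := Fin (n + 1) → Bool
    let ι := {q : I × I // q.1 ≠ q.2} × Fin (n + 1)
    let W : ι → Set (I → MulAut H) := fun q => {z | (z q.1.1.1)⁻¹ * z q.1.1.2 ∈ O q.2}
    have hWo : ∀ q, IsOpen (W q) := by
      intro q
      apply (hOop q.2).preimage
      fun_prop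
    have hWd : ∀ q, Dense (W q) := by
      rintro ⟨⟨⟨s, t⟩, hst⟩, i⟩ z
      simp only at hst
      have hcont : Continuous (fun w : MulAut H => update z t (z s * w)) := by fun_prop
      have h1 := map_mem_closure (t := W ⟨⟨⟨s, t⟩, hst⟩, i⟩) hcont
        (hOde i ((z s)⁻¹ * z t)) (by
          intro w hw
          simp only [W, Set.mem_ofPred_eq, update_self, update_of_ne hst]
          simpa using hw)
      simpa using h1
    have hdense : Dense (⋂₀ Set.range W) := (Set.finite_range W).dense_sInter
      (by rintro _ ⟨q, rfl⟩; exact hWo q) (by rintro _ ⟨q, rfl⟩; exact hWd q)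
    have hnear : ∀ᶠ z in 𝓝 (fun s : I => y (Fin.init s)), ∀ s : I, ∀ x ∈ S,
        z s x = y (Fin.init s) x ∧ (z s)⁻¹ x = (y (Fin.init s))⁻¹ x := by
      rw [eventually_all]
      intro s
      exact ((continuous_apply s).tendsto (fun s : I => y (Fin.init s))).eventually
        (eventually_near (y (Fin.init s)) hS)
    obtain ⟨z, hzW, hz⟩ := ((mem_closure_iff_frequently.1 (hdense _)).and_eventually hnear).exists
    have hF : ∀ q : ι, ∃ F : Set H, F.Finite ∧ ∀ u v : MulAut H, (∀ x ∈ F, u x = z q.1.1.1 x) →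
        (∀ x ∈ F, v x = z q.1.1.2 x) → u⁻¹ * v ∈ O q.2 := by
      intro q
      have hq : (z q.1.1.1)⁻¹ * z q.1.1.2 ∈ O q.2 := hzW _ ⟨q, rfl⟩
      have hc : Continuous (fun p : MulAut H × MulAut H => p.1⁻¹ * p.2) := by fun_prop
      have h1 := hc.continuousAt.preimage_mem_nhds (x := (z q.1.1.1, z q.1.1.2))
        ((hOop q.2).mem_nhds hq)
      rw [nhds_prod_eq, mem_prod_iff] at h1
      obtain ⟨t1, ht1, t2, ht2, hsub⟩ := h1
      obtain ⟨F1, hF1, hF1'⟩ := mem_nhds_aut_iff.1 ht1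
      obtain ⟨F2, hF2, hF2'⟩ := mem_nhds_aut_iff.1 ht2
      refine ⟨F1 ∪ F2, hF1.union hF2, fun u v hu hv => ?_⟩
      exact hsub (Set.mk_mem_prod (hF1' u fun x hx => hu x (Or.inl hx))
        (hF2' v fun x hx => hv x (Or.inr hx)))
    choose F hFfin hF using hF
    refine ⟨(z, ⟨insert (en n) S ∪ ⋃ q, F q, (hS.insert _).union
      (Set.finite_iUnion hFfin)⟩), ?_, ?_, hz, ?_⟩
    · intro x hx
      exact Or.inl (Or.inr hx)
    · exact Or.inl (Or.inl rfl)
    · intro s t hst u v hu hv i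
      exact hF ⟨⟨⟨s, t⟩, hst⟩, i⟩ u v
        (fun x hx => hu x (Or.inr (Set.mem_iUnion.2 ⟨_, hx⟩)))
        (fun x hx => hv x (Or.inr (Set.mem_iUnion.2 ⟨_, hx⟩))))
  let r : (ℕ → Bool) → ∀ n, Fin n → Bool := fun a n i => a i
  have hmono : Monotone (fun n => (f n).2.1) := monotone_nat_of_le_succ fun n => (hf n).1
  have hlim : ∀ a : ℕ → Bool, ∃ h : MulAut H, ∀ n, ∀ x ∈ (f n).2.1,
      h x = (f n).1 (r a n) x ∧ h⁻¹ x = ((f n).1 (r a n))⁻¹ x := by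
    intro a
    apply exists_limit (fun n => (f n).2.1) hmono
    · intro x
      obtain ⟨n, rfl⟩ := hen x
      exact ⟨n + 1, (hf n).2.1⟩
    · intro n x hx
      exact (hf n).2.2.1 (r a (n + 1)) x hx
  choose h hh using hlim
  obtain ⟨a, b, hab, hGab⟩ := exists_same_coset G hG h
  refine ⟨_, hGab, hOD _ ?_, ?_⟩
  · intro i
    obtain ⟨m, hm⟩ := Function.ne_iff.1 hab
    have hne : r a (i + m + 1) ≠ r b (i + m + 1) := by
      intro heq
      exact hm (congrFun heq ⟨m, by omega⟩)
    exact (hf (i + m)).2.2.2 _ _ hne (h a) (h b) (fun x hx => (hh a _ x hx).1)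
      (fun x hx => (hh b _ x hx).1) ⟨i, by omega⟩
  · intro x hx
    have h0 : ∀ a, h a x = x ∧ (h a)⁻¹ x = x := by
      intro a
      have := hh a 0 x (by rw [f0]; exact hx)
      rw [f0] at this
      simpa using this
    rw [MulAut.mul_apply, (h0 b).1, (h0 a).2]

theorem residual_meets [Countable H] {D : Set (MulAut H)}
    (hD : D ∈ residual (MulAut H)) {E : Set H} (hE : E.Finite) :
    ∃ g ∈ D, ∀ x ∈ E, g x = x := by
  obtain ⟨g, -, h⟩ := small_index_meets (⊤ : Subgroup (MulAut H)) (by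
    have : Subsingleton (MulAut H ⧸ (⊤ : Subgroup (MulAut H))) :=
      QuotientGroup.subsingleton_quotient_top
    exact (Cardinal.le_one_iff_subsingleton.2 this).trans_lt
      (Cardinal.one_lt_aleph0.trans (Cardinal.cantor _))) hD hE
  exact ⟨g, h⟩

theorem isOpen_of_fixator_le (G : Subgroup (MulAut H)) {E : Set H} (hE : E.Finite)
    (h : ∀ g : MulAut H, (∀ x ∈ E, g x = x) → g ∈ G) : IsOpen (G : Set (MulAut H)) := by
  apply Subgroup.isOpen_of_mem_nhds G (g := 1)
  rw [mem_nhds_aut_iff]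
  exact ⟨E, hE, fun y hy => h y (by simpa using hy)⟩

/-- A non-open subgroup misses some element of every comeager set, near the identity. -/
theorem not_open_misses [Countable H] (G : Subgroup (MulAut H))
    (hG : ¬ IsOpen (G : Set (MulAut H))) {D : Set (MulAut H)}
    (hD : D ∈ residual (MulAut H)) {E : Set H} (hE : E.Finite) :
    ∃ g ∉ G, g ∈ D ∧ ∀ x ∈ E, g x = x := by
  have : ∃ x : MulAut H, (∀ z ∈ E, x z = z) ∧ x ∉ G := by
    by_contra hcon
    push Not at hcon
    exact hG (isOpen_of_fixator_le G hE hcon)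
  obtain ⟨x, hxE, hxG⟩ := this
  let φ : MulAut H ≃ₜ MulAut H := (Homeomorph.inv (MulAut H)).trans (Homeomorph.mulRight x)
  have h2 : φ ⁻¹' D ∈ residual (MulAut H) :=
    tendsto_residual_of_isOpenMap φ.continuous φ.isOpenMap hD
  obtain ⟨y, ⟨hy1, hy2⟩, hyE⟩ := residual_meets (inter_mem hD h2) hE
  have hy2' : y⁻¹ * x ∈ D := hy2
  by_cases hyG : y ∈ G
  · refine ⟨y⁻¹ * x, ?_, hy2', ?_⟩
    · intro hmem
      apply hxG
      have := mul_mem hyG hmem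
      simpa using this
    · intro z hz
      rw [MulAut.mul_apply, hxE z hz]
      apply y.injective
      rw [MulAut.apply_inv_self, hyE z hz]
  · exact ⟨y, hyG, hy1, hyE⟩

theorem main (hH : IsHallUniversal H) (G : Subgroup (MulAut H))
    (hG : Cardinal.mk (MulAut H ⧸ G) < 2 ^ Cardinal.aleph0) : IsOpen (G : Set (MulAut H)) := by
  have := hH.countable
  by_contra hopen
  obtain ⟨en, hen⟩ := exists_surjective_nat H
  let L : ℕ → Set H := fun n => en '' Set.Iic n
  have hLfin : ∀ n, (L n).Finite := fun n => (Set.finite_Iic n).image _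
  have hLmono : Monotone L := fun m n hmn => Set.image_mono (Set.Iic_subset_Iic.2 hmn)
  have hLex : ∀ x, ∃ n, x ∈ L n := by
    intro x
    obtain ⟨n, rfl⟩ := hen x
    exact ⟨n, n, Set.mem_Iic.2 le_rfl, rfl⟩
  let σ : ℕ → Type _ := fun n =>
    {p : ((Fin n → Bool) → ℕ → MulAut H) × ((Fin n → Bool) → MulAut H) //
      ∀ s, Generic n (p.1 s)}
  obtain ⟨f, -, hf⟩ := dep_choice (σ := σ) ⟨(fun _ _ => 1, fun _ => 1), fun _ => generic_zero _⟩
    (fun n p q =>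
      (∀ s, ∀ i < n, q.1.1 s i = p.1.1 (Fin.init s) i) ∧
      (∀ s, ∀ i < n, q.1.2 s * q.1.1 s i * (q.1.2 s)⁻¹ =
        p.1.2 (Fin.init s) * p.1.1 (Fin.init s) i * (p.1.2 (Fin.init s))⁻¹) ∧
      (∀ s, ∀ x ∈ L n, q.1.2 s x = p.1.2 (Fin.init s) x ∧
        (q.1.2 s)⁻¹ x = (p.1.2 (Fin.init s))⁻¹ x) ∧
      (∀ s, s (Fin.last n) = false → q.1.1 s n ∈ G) ∧
      (∀ s, s (Fin.last n) = true → q.1.1 s n ∉ G) ∧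
      (∀ s t, Fin.init s = (Fin.init t : Fin n → Bool) →
        q.1.2 s * q.1.1 s n * (q.1.2 s)⁻¹ = q.1.2 t * q.1.1 t n * (q.1.2 t)⁻¹)) (by
    rintro n ⟨⟨c, h⟩, hc⟩
    simp only at hc
    have hB : ∀ s, ∃ B : Set H, B.Finite ∧ (L n ∪ (fun x => (h s)⁻¹ x) '' L n) ⊆ B ∧
        ∀ i < n, ∀ x ∈ B, c s i x ∈ B :=
      fun s => (hc s).1 _ ((hLfin n).union ((hLfin n).image _))
    choose B hBfin hBsub cB using hB
    have hE : (⋃ s, B s).Finite := Set.finite_iUnion hBfin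
    have hD : {g | ∀ s, Generic (n + 1) (update (c s) n g)} ∈ residual (MulAut H) := by
      have : ∀ᶠ g in residual (MulAut H), ∀ s, Generic (n + 1) (update (c s) n g) := by
        rw [eventually_all]
        exact fun s => generic_residual hH (hc s)
      exact this
    obtain ⟨g, hgG, hgD, hgE⟩ := small_index_meets G hG hD hE
    obtain ⟨g', hgG', hgD', hgE'⟩ := not_open_misses G hopen hD hE
    have hk : ∀ s, ∃ k : MulAut H, (∀ x ∈ B s, k x = x) ∧
        ∀ i < n + 1, k * update (c s) n g' i = update (c s) n g i * k := by
      intro s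
      have hBs : ∀ x ∈ B s, x ∈ ⋃ s, B s := fun x hx => Set.mem_iUnion.2 ⟨s, hx⟩
      apply homog (hgD' s) (hgD s) (hBfin s)
      · intro i hi x hx
        by_cases hin : i = n
        · subst hin
          simpa [hgE' x (hBs x hx)] using hx
        · simpa [hin] using cB s i (by omega) x hx
      · intro i hi x hx
        apply update_agree
        rw [hgE x (hBs x hx), hgE' x (hBs x hx)]
    choose k hkB hkc using hk
    have hkn : ∀ s, k s * g' * (k s)⁻¹ = g := by
      intro s
      have := hkc s n (by omega)
      simp only [update_self] at this
      rw [this]; group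
    have hki : ∀ s, ∀ i < n, k s * c s i * (k s)⁻¹ = c s i := by
      intro s i hi
      have := hkc s i (by omega)
      simp only [update_of_ne hi.ne] at this
      rw [this]; group
    let c' : (Fin (n + 1) → Bool) → ℕ → MulAut H := fun s =>
      update (c (Fin.init s)) n (if s (Fin.last n) = true then g' else g)
    let h' : (Fin (n + 1) → Bool) → MulAut H := fun s =>
      h (Fin.init s) * (if s (Fin.last n) = true then k (Fin.init s) else 1)
    have hlast : ∀ s, h' s * c' s n * (h' s)⁻¹ = h (Fin.init s) * g * (h (Fin.init s))⁻¹ := by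
      intro s
      by_cases hs : s (Fin.last n) = true
      · simp only [h', c', hs, if_true, update_self]
        rw [← hkn (Fin.init s)]
        group
      · simp only [h', c', hs, update_self]
        simp
    refine ⟨⟨(c', h'), ?_⟩, ?_, ?_, ?_, ?_, ?_, ?_⟩
    · intro s
      by_cases hs : s (Fin.last n) = true
      · simp only [c', hs, if_true]
        exact hgD' _
      · simp only [c', hs]
        exact hgD _
    · intro s i hi
      simp only [c', update_of_ne hi.ne]
    · intro s i hi
      by_cases hs : s (Fin.last n) = true
      · simp only [h', c', hs, if_true, update_of_ne hi.ne]
        conv_rhs => rw [← hki (Fin.init s) i hi]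
        group
      · simp [h', c', hs, update_of_ne hi.ne]
    · intro s x hx
      by_cases hs : s (Fin.last n) = true
      · simp only [h', hs, if_true, MulAut.mul_apply, mul_inv_rev]
        have h1 : k (Fin.init s) x = x := hkB _ x (hBsub _ (Or.inl hx))
        have h2 : k (Fin.init s) ((h (Fin.init s))⁻¹ x) = (h (Fin.init s))⁻¹ x :=
          hkB _ _ (hBsub _ (Or.inr ⟨x, hx, rfl⟩))
        refine ⟨by rw [h1], ?_⟩
        apply (k (Fin.init s)).injective
        rw [MulAut.apply_inv_self, h2]
      · simp [h', hs]
    · intro s hs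
      simp only [c', hs, update_self]
      simpa using hgG
    · intro s hs
      simp only [c', hs, update_self]
      simpa using hgG'
    · intro s t hst
      simp only
      rw [hlast, hlast, hst])
  let r : (ℕ → Bool) → ∀ n, Fin n → Bool := fun a n i => a i
  have hlim : ∀ a : ℕ → Bool, ∃ h : MulAut H, ∀ n, ∀ x ∈ L n,
      h x = (f n).1.2 (r a n) x ∧ h⁻¹ x = ((f n).1.2 (r a n))⁻¹ x := by
    intro a
    apply exists_limit L hLmono hLex
    intro n x hx
    exact (hf n).2.2.1 (r a (n + 1)) x hx
  choose h hh using hlim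
  -- the tuples and their conjugates stabilize
  have stab : ∀ a n m, n + 1 ≤ m → (f m).1.1 (r a m) n = (f (n + 1)).1.1 (r a (n + 1)) n ∧
      (f m).1.2 (r a m) * (f m).1.1 (r a m) n * ((f m).1.2 (r a m))⁻¹ =
      (f (n + 1)).1.2 (r a (n + 1)) * (f (n + 1)).1.1 (r a (n + 1)) n *
        ((f (n + 1)).1.2 (r a (n + 1)))⁻¹ := by
    intro a n m hm
    induction m, hm using Nat.le_induction with
    | base => exact ⟨rfl, rfl⟩
    | succ m hm ih =>
      exact ⟨((hf m).1 (r a (m + 1)) n (by omega)).trans ih.1,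
        ((hf m).2.1 (r a (m + 1)) n (by omega)).trans ih.2⟩
  have conj_lim : ∀ a n, h a * (f (n + 1)).1.1 (r a (n + 1)) n * (h a)⁻¹ =
      (f (n + 1)).1.2 (r a (n + 1)) * (f (n + 1)).1.1 (r a (n + 1)) n *
        ((f (n + 1)).1.2 (r a (n + 1)))⁻¹ := by
    intro a n
    ext x
    obtain ⟨m1, hm1⟩ := hLex x
    obtain ⟨m2, hm2⟩ := hLex ((f (n + 1)).1.1 (r a (n + 1)) n ((h a)⁻¹ x))
    let m := n + 1 + m1 + m2
    have e1 := hLmono (show m1 ≤ m by omega) hm1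
    have e2 := hLmono (show m2 ≤ m by omega) hm2
    obtain ⟨s1, s2⟩ := stab a n m (by omega)
    rw [← s2, MulAut.mul_apply, MulAut.mul_apply, (hh a m _ e2).1, (hh a m x e1).2, s1]
    rfl
  -- separating the cosets
  have sep : ∀ a b n, r a n = r b n → a n = false → b n = true → (h a)⁻¹ * h b ∉ G := by
    intro a b n hab ha hb hmem
    have h1 : (f (n + 1)).1.1 (r a (n + 1)) n ∈ G := (hf n).2.2.2.1 (r a (n + 1)) ha
    have h2 : (f (n + 1)).1.1 (r b (n + 1)) n ∉ G := (hf n).2.2.2.2.1 (r b (n + 1)) hb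
    have h3 := (hf n).2.2.2.2.2 (r a (n + 1)) (r b (n + 1)) hab
    rw [← conj_lim a n, ← conj_lim b n] at h3
    apply h2
    have h4 : (f (n + 1)).1.1 (r b (n + 1)) n =
        ((h a)⁻¹ * h b)⁻¹ * (f (n + 1)).1.1 (r a (n + 1)) n * ((h a)⁻¹ * h b) := by
      calc (f (n + 1)).1.1 (r b (n + 1)) n
          = (h b)⁻¹ * (h b * (f (n + 1)).1.1 (r b (n + 1)) n * (h b)⁻¹) * h b := by group
        _ = _ := by rw [← h3]; group
    rw [h4]
    exact mul_mem (mul_mem (inv_mem hmem) h1) hmem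
  obtain ⟨a, b, hab, hGab⟩ := exists_same_coset G hG h
  have hex := Function.ne_iff.1 hab
  classical
  have hn : a (Nat.find hex) ≠ b (Nat.find hex) := Nat.find_spec hex
  have hlt : r a (Nat.find hex) = r b (Nat.find hex) := by
    funext i
    by_contra hne
    exact Nat.find_min hex i.2 hne
  cases ha : a (Nat.find hex) <;> cases hb : b (Nat.find hex)
  · exact hn (ha.trans hb.symm)
  · exact sep a b _ hlt ha hb hGab
  · refine sep b a _ hlt.symm hb ha ?_
    have := inv_mem hGab
    simpa using this
  · exact hn (ha.trans hb.symm)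

end HallSIP

/-- **`Aut H` has the small index property.**  Every subgroup of `Aut H` of index
strictly less than `2^ℵ₀` is open (in the topology of pointwise convergence). -/
theorem hallUniversal_small_index_property
    (H : Type*) [Group H] (hH : IsHallUniversal H)
    (G : Subgroup (MulAut H))
    (hG : Cardinal.mk (MulAut H ⧸ G) < 2 ^ Cardinal.aleph0) :
    IsOpen (G : Set (MulAut H)) :=
  HallSIP.main hH G hG
end

section
/- Let H be a Hall universal group. Then Aut(H) is not the union of a countable chain of non-open subgroups: if (Gₖ)ₖ∈ℕ is an increasing sequence of subgroups of Aut(H) (Gₖ ⊆ Gₖ₊₁ for all k) whose union is all of Aut(H), then some Gₖ is open in Aut(H). -/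
namespace HallChain


section

universe u v

lemma exists_emb {H : Type u} [Group H] (hH : IsHallUniversal H) (K : Type v) [Group K] [Finite K] :
    ∃ f : K →* H, Function.Injective f := by
  have : Finite (Shrink.{0} K) := Finite.of_equiv K (equivShrink.{0} K)
  obtain ⟨f, hf⟩ := hH.embedsFinite (Shrink.{0} K)
  have m : Shrink.{0} K ≃* K := Shrink.mulEquiv
  exact ⟨f.comp m.symm.toMonoidHom, hf.comp m.symm.injective⟩

lemma hom_conj_aux {H : Type u} [Group H] (hH : IsHallUniversal H) (K : Type v) [Group K] [Finite K]
    (e : Equiv.Perm K →* H) (he : Function.Injective e)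
    (a : K →* H) (ha : Function.Injective a) :
    ∃ h : H, ∀ x, h * a x * h⁻¹ = e (MulAction.toPermHom K K x) := by
  set l : K →* H := e.comp (MulAction.toPermHom K K) with hl
  have hli : Function.Injective l := he.comp (MulAction.toPerm_injective)
  have fa : Finite a.range := Finite.of_equiv K (MonoidHom.ofInjective ha).toEquiv
  have fl : Finite l.range := Finite.of_equiv K (MonoidHom.ofInjective hli).toEquiv
  obtain ⟨h1, hh1⟩ := hH.conjIso a.range l.range fa fl
    ⟨(MonoidHom.ofInjective ha).symm.trans (MonoidHom.ofInjective hli)⟩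
  have hmem : ∀ x, ∃ y, l y = h1 * a x * h1⁻¹ := by
    intro x
    have : h1 * a x * h1⁻¹ ∈ l.range := by
      rw [← hh1]
      exact ⟨a x, ⟨x, rfl⟩, by simp⟩
    exact this
  choose θ hθ using hmem
  have hinj : Function.Injective θ := by
    intro x y hxy
    have := hθ x
    rw [hxy, hθ y] at this
    apply ha
    simpa using this.symm
  have hmul : ∀ x y, θ (x * y) = θ x * θ y := by
    intro x y
    apply hli
    rw [map_mul, hθ, hθ, hθ, map_mul]
    group
  let T : Equiv.Perm K := Equiv.ofBijective θ ((Finite.injective_iff_bijective).1 hinj)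
  have hT : ∀ x, T x = θ x := fun x => rfl
  refine ⟨(e T)⁻¹ * h1, fun x => ?_⟩
  have h2 : MulAction.toPermHom K K (θ x) = T * MulAction.toPermHom K K x * T⁻¹ := by
    rw [eq_mul_inv_iff_mul_eq]
    ext y
    simp [hT, hmul]
  have h3 := hθ x
  rw [hl, MonoidHom.comp_apply, h2, map_mul, map_mul, map_inv] at h3
  calc (e T)⁻¹ * h1 * a x * ((e T)⁻¹ * h1)⁻¹ = (e T)⁻¹ * (h1 * a x * h1⁻¹) * e T := by group
    _ = _ := by rw [← h3]; group

lemma hom_conj {H : Type u} [Group H] (hH : IsHallUniversal H) {K : Type v} [Group K] [Finite K]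
    (a b : K →* H) (ha : Function.Injective a) (hb : Function.Injective b) :
    ∃ h : H, ∀ x, h * a x * h⁻¹ = b x := by
  obtain ⟨e, he⟩ := exists_emb hH (Equiv.Perm K)
  obtain ⟨h1, hh1⟩ := hom_conj_aux hH K e he a ha
  obtain ⟨h2, hh2⟩ := hom_conj_aux hH K e he b hb
  refine ⟨h2⁻¹ * h1, fun x => ?_⟩
  have h3 := (hh1 x).trans (hh2 x).symm
  calc h2⁻¹ * h1 * a x * (h2⁻¹ * h1)⁻¹ = h2⁻¹ * (h1 * a x * h1⁻¹) * h2 := by group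
    _ = _ := by rw [h3]; group

lemma finite_closure {H : Type u} [Group H] (hH : IsHallUniversal H) (s : Finset H) :
    Finite (Subgroup.closure (s : Set H)) :=
  hH.locallyFinite _ ⟨s, rfl⟩

/-- Every automorphism agrees with an inner one on a finite set. -/
lemma inner_on {H : Type u} [Group H] (hH : IsHallUniversal H) (g : MulAut H) (s : Finset H) :
    ∃ t : H, ∀ x ∈ s, g x = t * x * t⁻¹ := by
  have := finite_closure hH s
  obtain ⟨t, ht⟩ := hom_conj hH (Subgroup.closure (s : Set H)).subtype
    (g.toMonoidHom.comp (Subgroup.closure (s : Set H)).subtype)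
    (Subtype.val_injective) (g.injective.comp Subtype.val_injective)
  exact ⟨t, fun x hx => (ht ⟨x, Subgroup.subset_closure hx⟩).symm⟩

/-- Amalgamation with operators. -/
lemma amalg {H : Type u} [Group H] (hH : IsHallUniversal H) {B : Type v} [Group B] [Finite B]
    (j : B →* H) (hj : Function.Injective j) (A : Subgroup B) :
    ∃ h : H, (∀ a ∈ A, h * j a = j a * h) ∧ ∀ r t : B, (∀ a, a ∈ A ↔ r * a * r⁻¹ ∈ A) →
      (∀ a ∈ A, r * a * r⁻¹ = t * a * t⁻¹) →
      ∃ q : H, ∀ c : B, q * j c * q⁻¹ = j (r * c * r⁻¹) ∧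
        q * (h * j c * h⁻¹) * q⁻¹ = h * j (t * c * t⁻¹) * h⁻¹ := by
  obtain ⟨φ, hφ⟩ := exists_emb hH (B × B × B)
  let R : Subgroup (B × B × B) :=
    { carrier := {z | (∀ a, a ∈ A ↔ z.2.1 * a * z.2.1⁻¹ ∈ A) ∧ z.1 * z.2.1⁻¹ ∈ A ∧
        ∀ a ∈ A, z.2.1 * a * z.2.1⁻¹ = z.2.2 * a * z.2.2⁻¹}
      one_mem' := by simp
      mul_mem' := by
        rintro ⟨x, p, q⟩ ⟨x', p', q'⟩ ⟨h1, h2, h3⟩ ⟨h1', h2', h3'⟩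
        simp only at h1 h2 h3 h1' h2' h3'
        refine ⟨fun a => ?_, ?_, fun a ha => ?_⟩
        · simp only [Prod.mk_mul_mk]
          rw [h1' a, h1]
          have : p * (p' * a * p'⁻¹) * p⁻¹ = p * p' * a * (p * p')⁻¹ := by group
          rw [this]
        · simp only [Prod.mk_mul_mk]
          have : x * x' * (p * p')⁻¹ = (x * p⁻¹) * (p * (x' * p'⁻¹) * p⁻¹) := by group
          rw [this]
          exact A.mul_mem h2 ((h1 _).1 h2')
        · simp only [Prod.mk_mul_mk]
          have e1 : p * p' * a * (p * p')⁻¹ = p * (p' * a * p'⁻¹) * p⁻¹ := by group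
          have e2 : q * q' * a * (q * q')⁻¹ = q * (q' * a * q'⁻¹) * q⁻¹ := by group
          rw [e1, e2, h3 _ ((h1' a).1 ha), h3' a ha]
      inv_mem' := by
        rintro ⟨x, p, q⟩ ⟨h1, h2, h3⟩
        simp only at h1 h2 h3
        have k1 : ∀ a, a ∈ A ↔ p⁻¹ * a * p ∈ A := by
          intro a
          rw [h1 (p⁻¹ * a * p)]
          have : p * (p⁻¹ * a * p) * p⁻¹ = a := by group
          rw [this]
        refine ⟨fun a => ?_, ?_, fun a ha => ?_⟩
        · simpa using k1 a
        · have : x⁻¹ * p⁻¹⁻¹ = p⁻¹ * (x * p⁻¹)⁻¹ * p := by group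
          simp only [Prod.inv_mk]
          rw [this, ← k1]
          exact A.inv_mem h2
        · have := h3 _ ((k1 a).1 ha)
          simp only [Prod.inv_mk, inv_inv]
          have e1 : p * (p⁻¹ * a * p) * p⁻¹ = a := by group
          rw [e1] at this
          calc p⁻¹ * a * p = q⁻¹ * (q * (p⁻¹ * a * p) * q⁻¹) * q := by group
            _ = _ := by rw [← this] }
  let σ : R →* B × B × B :=
    { toFun := fun z => (z.1.1 * z.1.2.1⁻¹ * z.1.2.2, z.1.2.1, z.1.2.2)
      map_one' := by simp
      map_mul' := by
        rintro ⟨⟨x, p, q⟩, h1, h2, h3⟩ ⟨⟨x', p', q'⟩, h1', h2', h3'⟩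
        simp only at h1 h2 h3 h1' h2' h3'
        simp only [Prod.mk_mul_mk, Subgroup.coe_mul, Prod.mk.injEq, and_true]
        have := h3 _ h2'
        calc x * x' * (p * p')⁻¹ * (q * q') = x * p⁻¹ * (p * (x' * p'⁻¹) * p⁻¹) * q * q' := by group
          _ = _ := by rw [this]; group }
  have hσ : Function.Injective σ := by
    rintro ⟨⟨x, p, q⟩, h⟩ ⟨⟨x', p', q'⟩, h'⟩ e
    simp only [σ, MonoidHom.coe_mk, OneHom.coe_mk, Prod.mk.injEq] at e
    obtain ⟨e1, rfl, rfl⟩ := e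
    simp only [mul_left_inj] at e1
    subst e1
    rfl
  obtain ⟨k, hk⟩ := hom_conj hH (φ.comp R.subtype) (φ.comp σ)
    (hφ.comp Subtype.val_injective) (hφ.comp hσ)
  let i1 : B →* B × B × B := MonoidHom.inl B (B × B)
  have hi1 : Function.Injective i1 := fun x y e => by simpa [i1] using e
  obtain ⟨m, hm⟩ := hom_conj hH (φ.comp i1) j (hφ.comp hi1) hj
  have hm' : ∀ x, j x = m * φ (x, 1, 1) * m⁻¹ := fun x => (hm x).symm
  refine ⟨m * k⁻¹ * m⁻¹, fun a ha => ?_, fun r t hr hrt => ?_⟩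
  · have := hk ⟨(a, 1, 1), by simp, by simpa using ha, by simp⟩
    simp only [MonoidHom.comp_apply, Subgroup.coe_subtype, σ, MonoidHom.coe_mk, OneHom.coe_mk,
      inv_one, mul_one] at this
    rw [hm']
    have h2 : k⁻¹ * φ (a, 1, 1) = φ (a, 1, 1) * k⁻¹ := by
      rw [inv_mul_eq_iff_eq_mul, ← mul_assoc, eq_mul_inv_iff_mul_eq]
      exact (mul_inv_eq_iff_eq_mul.1 this).symm
    calc m * k⁻¹ * m⁻¹ * (m * φ (a, 1, 1) * m⁻¹) = m * (k⁻¹ * φ (a, 1, 1)) * m⁻¹ := by group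
      _ = _ := by rw [h2]; group
  · have h1 := hk ⟨(r, r, t), hr, by simp, hrt⟩
    simp only [MonoidHom.comp_apply, Subgroup.coe_subtype, σ, MonoidHom.coe_mk, OneHom.coe_mk,
      mul_inv_cancel, one_mul] at h1
    have h2 : φ (r, r, t) = k⁻¹ * φ (t, r, t) * k := by rw [← h1]; group
    have key : ∀ x p q c : B, φ (x, p, q) * φ (c, 1, 1) * (φ (x, p, q))⁻¹ = φ (x * c * x⁻¹, 1, 1) := by
      intro x p q c
      rw [← map_inv, ← map_mul, ← map_mul]
      simp
    refine ⟨m * φ (r, r, t) * m⁻¹, fun c => ⟨?_, ?_⟩⟩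
    · rw [hm', hm', ← key r r t c]; group
    · rw [hm', hm', ← key t r t c, h2]; group


open Classical in
lemma amalg' {H : Type u} [Group H] (hH : IsHallUniversal H) (n : ℕ) (A C s : Finset H)
    (r t : ℕ → H)
    (hrA : ∀ i < n, ∀ a ∈ A, r i * a * (r i)⁻¹ ∈ A ∧ r i * a * (r i)⁻¹ = t i * a * (t i)⁻¹) :
    ∃ h : H, (∀ a ∈ A, h * a = a * h) ∧ ∃ q : ℕ → H, ∀ i < n,
      (∀ c ∈ C, q i * c * (q i)⁻¹ = r i * c * (r i)⁻¹) ∧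
      ∀ b ∈ s, q i * (h * b * h⁻¹) * (q i)⁻¹ = h * (t i * b * (t i)⁻¹) * h⁻¹ := by
  set X : Finset H := A ∪ C ∪ s ∪ (Finset.range n).image r ∪ (Finset.range n).image t with hX
  set B := Subgroup.closure (X : Set H) with hB
  have := finite_closure hH X
  have hsub : ∀ x ∈ X, x ∈ B := fun x hx => Subgroup.subset_closure hx
  have hAB : ∀ x ∈ A, x ∈ B := fun x hx => hsub x (by simp [hX, hx])
  have hCB : ∀ x ∈ C, x ∈ B := fun x hx => hsub x (by simp [hX, hx])
  have hsB : ∀ x ∈ s, x ∈ B := fun x hx => hsub x (by simp [hX, hx])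
  have hrB : ∀ i < n, r i ∈ B := fun i hi => hsub _ (by
    simp only [hX, Finset.mem_union, Finset.mem_image, Finset.mem_range]
    exact Or.inl (Or.inr ⟨i, hi, rfl⟩))
  have htB : ∀ i < n, t i ∈ B := fun i hi => hsub _ (by
    simp only [hX, Finset.mem_union, Finset.mem_image, Finset.mem_range]
    exact Or.inr ⟨i, hi, rfl⟩)
  obtain ⟨h, h1, h2⟩ := amalg hH B.subtype Subtype.val_injective
    ((Subgroup.closure (A : Set H)).subgroupOf B)
  refine ⟨h, fun a ha => h1 ⟨a, hAB a ha⟩ (Subgroup.subset_closure ha), ?_⟩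
  have hex : ∀ i, ∃ q : H, i < n → 
      (∀ c ∈ C, q * c * q⁻¹ = r i * c * (r i)⁻¹) ∧
      ∀ b ∈ s, q * (h * b * h⁻¹) * q⁻¹ = h * (t i * b * (t i)⁻¹) * h⁻¹ := by
    intro i
    by_cases hi : i < n
    swap
    · exact ⟨1, fun h => absurd h hi⟩
    have himg : A.image (MulAut.conj (r i)) = A := by
      apply Finset.eq_of_subset_of_card_le
      · intro x hx
        obtain ⟨a, ha, rfl⟩ := Finset.mem_image.1 hx
        exact (hrA i hi a ha).1
      · rw [Finset.card_image_of_injective _ (MulAut.conj (r i)).injective]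
    have hmap : (Subgroup.closure (A : Set H)).map (MulAut.conj (r i)).toMonoidHom =
        Subgroup.closure (A : Set H) := by
      rw [MonoidHom.map_closure]
      congr 1
      conv_rhs => rw [← himg]
      simp
    have hagree : ∀ a ∈ Subgroup.closure (A : Set H),
        r i * a * (r i)⁻¹ = t i * a * (t i)⁻¹ := by
      intro a ha
      have : Set.EqOn (MulAut.conj (r i)).toMonoidHom (MulAut.conj (t i)).toMonoidHom
          (Subgroup.closure (A : Set H)) :=
        MonoidHom.eqOn_closure (fun a ha => by simpa using (hrA i hi a ha).2)
      simpa using this ha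
    obtain ⟨q, hq⟩ := h2 ⟨r i, hrB i hi⟩ ⟨t i, htB i hi⟩ (by
        rintro ⟨a, ha⟩
        simp only [Subgroup.mem_subgroupOf, Subgroup.coe_mul, Subgroup.coe_inv]
        conv_rhs => rw [← hmap]
        constructor
        · intro h
          exact ⟨a, h, by simp⟩
        · rintro ⟨a', ha', e⟩
          have : a' = a := by simpa using e
          exact this ▸ ha') (by
        rintro ⟨a, ha⟩ ha'
        exact Subtype.ext (hagree a ha'))
    exact ⟨q, fun _ => ⟨fun c hc => (hq ⟨c, hCB c hc⟩).1, fun b hb => (hq ⟨b, hsB b hb⟩).2⟩⟩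
  choose q hq using hex
  exact ⟨q, fun i hi => hq i hi⟩

/-- Concrete form of genericity of the tuple `g 0, …, g (n-1)`. -/
structure Gen {H : Type u} [Group H] (n : ℕ) (g : ℕ → MulAut H) : Prop where
  lf : ∀ s : Finset H, ∃ A : Finset H, s ⊆ A ∧ ∀ i < n, ∀ a ∈ A, g i a ∈ A
  ext : ∀ (A s : Finset H) (t : ℕ → H),
    (∀ i < n, ∀ a ∈ A, g i a ∈ A ∧ g i a = t i * a * (t i)⁻¹) →
    ∃ h : H, (∀ a ∈ A, h * a = a * h) ∧
      ∀ i < n, ∀ b ∈ s, g i (h * b * h⁻¹) = h * (t i * b * (t i)⁻¹) * h⁻¹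

lemma Gen.zero {H : Type u} [Group H] (g : ℕ → MulAut H) : Gen 0 g :=
  ⟨fun s => ⟨s, subset_rfl, by simp⟩, fun A s t _ => ⟨1, by simp, by simp⟩⟩

lemma Gen.congr {H : Type u} [Group H] {n : ℕ} {g g' : ℕ → MulAut H} (h : Gen n g)
    (e : ∀ i < n, g' i = g i) : Gen n g' := by
  refine ⟨fun s => ?_, fun A s t hA => ?_⟩
  · obtain ⟨A, h1, h2⟩ := h.lf s
    exact ⟨A, h1, fun i hi => by rw [e i hi]; exact h2 i hi⟩
  · obtain ⟨k, h1, h2⟩ := h.ext A s t (fun i hi => by rw [← e i hi]; exact hA i hi)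
    exact ⟨k, h1, fun i hi => by rw [e i hi]; exact h2 i hi⟩

/-- Genericity is invariant under conjugation. -/
lemma Gen.conj {H : Type u} [Group H] {n : ℕ} {g : ℕ → MulAut H} (h : Gen n g) (u : MulAut H) :
    Gen n (fun i => u * g i * u⁻¹) := by
  classical
  refine ⟨fun s => ?_, fun A s t hA => ?_⟩
  · obtain ⟨A, h1, h2⟩ := h.lf (s.image u.symm)
    refine ⟨A.image u, fun x hx => ?_, fun i hi a ha => ?_⟩
    · exact Finset.mem_image.2 ⟨u.symm x, h1 (Finset.mem_image_of_mem _ hx), by simp⟩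
    · obtain ⟨a, ha', rfl⟩ := Finset.mem_image.1 ha
      exact Finset.mem_image.2 ⟨g i a, h2 i hi a ha', by simp⟩
  · obtain ⟨k, h1, h2⟩ := h.ext (A.image u.symm) (s.image u.symm) (fun i => u.symm (t i)) (by
      intro i hi a ha
      obtain ⟨a, ha', rfl⟩ := Finset.mem_image.1 ha
      obtain ⟨h1, h2⟩ := hA i hi a ha'
      refine ⟨Finset.mem_image.2 ⟨_, h1, by simp [MulAut.inv_def]⟩, ?_⟩
      have := congrArg u.symm h2
      simpa [MulAut.inv_def] using this)
    refine ⟨u k, fun a ha => ?_, fun i hi b hb => ?_⟩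
    · have := congrArg u (h1 _ (Finset.mem_image_of_mem _ ha))
      simpa using this
    · have := congrArg u (h2 i hi _ (Finset.mem_image_of_mem _ hb))
      simpa [MulAut.inv_def] using this

/-- Density for local finiteness. -/
lemma dense_lf {H : Type u} [Group H] (hH : IsHallUniversal H) {n : ℕ} {g : ℕ → MulAut H}
    (hg : Gen n g) (g0 : MulAut H) (e s : Finset H) :
    ∃ g1 : MulAut H, (∀ x ∈ e, g1 x = g0 x) ∧
      ∃ A : Finset H, s ⊆ A ∧ (∀ i < n, ∀ a ∈ A, g i a ∈ A) ∧ ∀ a ∈ A, g1 a ∈ A := by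
  classical
  obtain ⟨C, hC1, hC2⟩ := hg.lf (s ∪ e ∪ e.image g0)
  choose t ht using fun i => inner_on hH (g i) C
  obtain ⟨w, hw⟩ := inner_on hH g0 e
  set X : Finset H := C ∪ (Finset.range n).image t ∪ {w} with hX
  have := finite_closure hH X
  set B := Subgroup.closure (X : Set H) with hB
  have hsub : ∀ x ∈ X, x ∈ B := fun x hx => Subgroup.subset_closure hx
  have hBf : (B : Set H).Finite := this
  obtain ⟨h, h1, h2⟩ := hg.ext C hBf.toFinset t (fun i hi a ha => ⟨hC2 i hi a ha, ht i a ha⟩)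
  have h1' : ∀ a ∈ C, h * a * h⁻¹ = a := fun a ha => by rw [h1 a ha]; group
  refine ⟨MulAut.conj (h * w * h⁻¹), fun x hx => ?_, hBf.toFinset.image (MulAut.conj h), ?_, ?_, ?_⟩
  · have e1 := h1' x (hC1 (by simp [hx]))
    have e2 := h1' (g0 x) (hC1 (by
      simp only [Finset.mem_union, Finset.mem_image]; exact Or.inr ⟨x, hx, rfl⟩))
    rw [MulAut.conj_apply]
    conv_lhs => rw [← e1]
    conv_rhs => rw [← e2, hw x hx]
    group
  · intro x hx
    have hxC : x ∈ C := hC1 (by simp [hx])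
    refine Finset.mem_image.2 ⟨x, ?_, by simpa using h1' x hxC⟩
    simpa using hsub x (by simp [hX, hxC])
  · intro i hi a ha
    obtain ⟨b, hb, rfl⟩ := Finset.mem_image.1 ha
    rw [MulAut.conj_apply, h2 i hi b hb]
    refine Finset.mem_image.2 ⟨t i * b * (t i)⁻¹, ?_, by simp⟩
    have hti : t i ∈ B := hsub _ (by
      simp only [hX, Finset.mem_union, Finset.mem_image, Finset.mem_range]
      exact Or.inl (Or.inr ⟨i, hi, rfl⟩))
    have hb' : b ∈ B := by simpa using hb
    simpa using B.mul_mem (B.mul_mem hti hb') (B.inv_mem hti)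
  · intro a ha
    obtain ⟨b, hb, rfl⟩ := Finset.mem_image.1 ha
    refine Finset.mem_image.2 ⟨w * b * w⁻¹, ?_, by simp only [MulAut.conj_apply]; group⟩
    have hti : w ∈ B := hsub _ (by simp [hX])
    have hb' : b ∈ B := by simpa using hb
    simpa using B.mul_mem (B.mul_mem hti hb') (B.inv_mem hti)

/-- Density for the extension property. -/
lemma dense_ext {H : Type u} [Group H] (hH : IsHallUniversal H) {n : ℕ} {g : ℕ → MulAut H}
    (hg : Gen n g) (g0 : MulAut H) (e A s : Finset H) (t : ℕ → H)
    (hA : ∀ i < n, ∀ a ∈ A, g i a ∈ A ∧ g i a = t i * a * (t i)⁻¹)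
    (hA0 : ∀ a ∈ A, g0 a ∈ A ∧ g0 a = t n * a * (t n)⁻¹) :
    ∃ g1 : MulAut H, (∀ x ∈ e, g1 x = g0 x) ∧
      ∃ h : H, (∀ a ∈ A, h * a = a * h) ∧
      (∀ i < n, ∀ b ∈ s, g i (h * b * h⁻¹) = h * (t i * b * (t i)⁻¹) * h⁻¹) ∧
      ∀ b ∈ s, g1 (h * b * h⁻¹) = h * (t n * b * (t n)⁻¹) * h⁻¹ := by
  classical
  obtain ⟨g1, hg1, C, hC, hCg, hC1⟩ := dense_lf hH hg g0 (e ∪ A) (e ∪ A)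
  choose r hr using fun i => inner_on hH (g i) C
  obtain ⟨r', hr'⟩ := inner_on hH g1 C
  have hAC : A ⊆ C := Finset.union_subset_right hC
  have heC : e ⊆ C := Finset.union_subset_left hC
  set R : ℕ → H := Function.update r n r' with hR
  have hRn : R n = r' := by simp [hR]
  have hRi : ∀ i < n, R i = r i := fun i hi => by simp [hR, hi.ne]
  obtain ⟨h, h1, q, hq⟩ := amalg' hH (n + 1) A C s R t (by
    intro i hi a ha
    rcases Nat.lt_succ_iff_lt_or_eq.1 hi with hi | rfl
    · rw [hRi i hi, ← hr i a (hAC ha)]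
      exact hA i hi a ha
    · rw [hRn, ← hr' a (hAC ha), hg1 a (by simp [ha])]
      exact hA0 a ha)
  obtain ⟨k, k1, k2⟩ := hg.ext C (s.image (MulAut.conj h)) q (by
    intro i hi c hc
    refine ⟨hCg i hi c hc, ?_⟩
    rw [(hq i (by omega)).1 c hc, hRi i hi, hr i c hc])
  have k1' : ∀ a ∈ C, k * a * k⁻¹ = a := fun a ha => by rw [k1 a ha]; group
  have k1'' : ∀ a ∈ C, k⁻¹ * a * k = a := fun a ha => by
    conv_lhs => rw [← k1' a ha]
    group
  refine ⟨MulAut.conj (k * q n * k⁻¹), fun x hx => ?_, k * h, fun a ha => ?_, fun i hi b hb => ?_,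
    fun b hb => ?_⟩
  · have hx' := heC hx
    rw [← hg1 x (by simp [hx]), ← k1' _ (hC1 x hx'), hr' x hx', ← hRn,
      ← (hq n (by omega)).1 x hx']
    conv_rhs => rw [← k1'' x hx']
    simp only [MulAut.conj_apply]
    group
  · rw [mul_assoc, h1 a ha, ← mul_assoc, k1 a (hAC ha), mul_assoc]
  · have e1 := k2 i hi (h * b * h⁻¹) (Finset.mem_image.2 ⟨b, hb, by simp⟩)
    rw [(hq i (by omega)).2 b hb] at e1
    have e2 : k * h * b * (k * h)⁻¹ = k * (h * b * h⁻¹) * k⁻¹ := by group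
    rw [e2, e1]
    group
  · have e1 := (hq n (by omega)).2 b hb
    calc _ = k * (q n * (h * b * h⁻¹) * (q n)⁻¹) * k⁻¹ := by
          simp only [MulAut.conj_apply]; group
      _ = _ := by rw [e1]; group

lemma isOpen_basic {H : Type u} [Group H] (g0 : MulAut H) (e : Finset H) :
    IsOpen {g : MulAut H | ∀ x ∈ e, g x = g0 x} := by
  let : TopologicalSpace H := ⊥
  have : DiscreteTopology H := ⟨rfl⟩
  have hc : Continuous (fun f : MulAut H => (f : H → H)) := continuous_induced_dom
  have : {g : MulAut H | ∀ x ∈ e, g x = g0 x} =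
      ⋂ x ∈ e, (fun f : MulAut H => f x) ⁻¹' {g0 x} := by
    ext g; simp
  rw [this]
  apply isOpen_biInter_finset
  intro x _
  exact (isOpen_discrete _).preimage ((continuous_apply x).comp hc)

lemma isOpen_iff' {H : Type u} [Group H] (U : Set (MulAut H)) :
    IsOpen U ↔ ∀ g0 ∈ U, ∃ e : Finset H, ∀ g : MulAut H, (∀ x ∈ e, g x = g0 x) → g ∈ U := by
  constructor
  · intro hU g0 hg0
    let : TopologicalSpace H := ⊥
    obtain ⟨V, hV, rfl⟩ := isOpen_induced_iff.1 hU
    obtain ⟨I, w, h1, h2⟩ := isOpen_pi_iff.1 hV _ hg0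
    refine ⟨I, fun g hg => h2 ?_⟩
    intro a ha
    simp only [hg a ha]
    exact (h1 a ha).2
  · intro h
    rw [isOpen_iff_forall_mem_open]
    intro g0 hg0
    obtain ⟨e, he⟩ := h g0 hg0
    exact ⟨_, fun g hg => he g hg, isOpen_basic g0 e, fun x _ => rfl⟩

lemma dense_iff' {H : Type u} [Group H] (U : Set (MulAut H))
    (h : ∀ (g0 : MulAut H) (e : Finset H), ∃ g ∈ U, ∀ x ∈ e, g x = g0 x) : Dense U := by
  rw [dense_iff_inter_open]
  rintro V hV ⟨g0, hg0⟩
  obtain ⟨e, he⟩ := (isOpen_iff' V).1 hV g0 hg0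
  obtain ⟨g, hg, hge⟩ := h g0 e
  exact ⟨g, he g hge, hg⟩

lemma continuous_mul_left' {H : Type u} [Group H] (v : MulAut H) :
    Continuous (fun g : MulAut H => v * g) := by
  rw [continuous_def]
  intro U hU
  rw [isOpen_iff'] at hU ⊢
  intro g0 hg0
  obtain ⟨e, he⟩ := hU _ hg0
  exact ⟨e, fun g hg => he _ (fun x hx => by simp [hg x hx])⟩

lemma isOpenMap_mul_left' {H : Type u} [Group H] (v : MulAut H) :
    IsOpenMap (fun g : MulAut H => v * g) := by
  intro U hU
  have : (fun g : MulAut H => v * g) '' U = (fun g : MulAut H => v⁻¹ * g) ⁻¹' U := by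
    ext g
    constructor
    · rintro ⟨x, hx, rfl⟩
      simpa using hx
    · intro h
      exact ⟨v⁻¹ * g, h, by simp⟩
  rw [this]
  exact hU.preimage (continuous_mul_left' _)

lemma baire {H : Type u} [Group H] (hc : Countable H) : BaireSpace (MulAut H) := by
  let : TopologicalSpace H := ⊥
  have : DiscreteTopology H := ⟨rfl⟩
  let F : MulAut H → (H → H) × (H → H) := fun f => (f, f.symm)
  have hi : Topology.IsInducing (fun f : MulAut H => (f : H → H)) := ⟨rfl⟩
  have hs : Continuous (fun f : MulAut H => (f.symm : H → H)) := by
    refine continuous_pi fun x => ?_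
    rw [continuous_def]
    intro U _
    rw [isOpen_iff']
    intro g0 hg0
    refine ⟨{g0.symm x}, fun g hg => ?_⟩
    have : g.symm x = g0.symm x := by
      rw [MulEquiv.symm_apply_eq, hg _ (Finset.mem_singleton_self _)]
      simp
    simpa [this] using hg0
  have hF : Continuous F := hi.continuous.prodMk hs
  have hFi : Topology.IsInducing F := Topology.IsInducing.of_comp hF continuous_fst hi
  have hemb : Topology.IsClosedEmbedding F := by
    refine ⟨⟨hFi, ?_⟩, ?_⟩
    · intro f g h
      ext x
      exact congrFun (congrArg Prod.fst h) x
    · have : Set.range F = (⋂ x : H, {p | p.1 (p.2 x) = x}) ∩ (⋂ x : H, {p | p.2 (p.1 x) = x}) ∩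
          ⋂ x : H, ⋂ y : H, {p | p.1 (x * y) = p.1 x * p.1 y} := by
        ext ⟨a, b⟩
        simp only [Set.mem_range, Set.mem_inter_iff, Set.mem_iInter, Set.mem_ofPred_eq]
        constructor
        · rintro ⟨f, hf⟩
          simp only [F, Prod.mk.injEq] at hf
          obtain ⟨rfl, rfl⟩ := hf
          simp
        · rintro ⟨⟨h1, h2⟩, h3⟩
          exact ⟨⟨⟨a, b, h2, h1⟩, h3⟩, rfl⟩
      rw [this]
      have c1 : ∀ x : H, Continuous (fun p : (H → H) × (H → H) => p.1 x) :=
        fun x => (continuous_apply x).comp continuous_fst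
      have c2 : ∀ x : H, Continuous (fun p : (H → H) × (H → H) => p.2 x) :=
        fun x => (continuous_apply x).comp continuous_snd
      have ev : Continuous (fun q : (H → H) × H => q.1 q.2) := by
        rw [continuous_discrete_rng]
        intro b
        have : (fun q : (H → H) × H => q.1 q.2) ⁻¹' {b} =
            ⋃ x : H, {q | q.1 x = b ∧ q.2 = x} := by
          ext q; simp
        rw [this]
        refine isOpen_iUnion fun x => ?_
        have o1 : IsOpen ((fun q : (H → H) × H => q.1 x) ⁻¹' {b}) :=
          (isOpen_discrete {b}).preimage ((continuous_apply x).comp continuous_fst)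
        have o2 : IsOpen ((fun q : (H → H) × H => q.2) ⁻¹' {x}) :=
          (isOpen_discrete {x}).preimage continuous_snd
        exact o1.inter o2
      refine (IsClosed.inter (isClosed_iInter fun x => ?_) (isClosed_iInter fun x => ?_)).inter
        (isClosed_iInter fun x => isClosed_iInter fun y => ?_)
      · exact isClosed_eq (ev.comp (continuous_fst.prodMk (c2 x))) continuous_const
      · exact isClosed_eq (ev.comp (continuous_snd.prodMk (c1 x))) continuous_const
      · exact isClosed_eq (c1 _) ((continuous_of_discreteTopology
          (f := fun p : H × H => p.1 * p.2)).comp ((c1 x).prodMk (c1 y)))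
  have : TopologicalSpace.IsCompletelyMetrizableSpace H := by
    let : MetricSpace H := TopologicalSpace.metrizableSpaceMetric H
    infer_instance
  have := hemb.IsCompletelyMetrizableSpace
  infer_instance

/-- Generic extensions of a generic tuple are comeagre. -/
lemma residual_gen {H : Type u} [Group H] (hH : IsHallUniversal H) {n : ℕ} {g : ℕ → MulAut H}
    (hg : Gen n g) : ∀ᶠ x in residual (MulAut H), Gen (n + 1) (Function.update g n x) := by
  have := hH.countable
  have hn : ∀ x, Function.update g n x n = x := fun x => by simp
  have hi : ∀ x, ∀ i < n, Function.update g n x i = g i := fun x i hi => by simp [hi.ne]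
  have H1 : ∀ᶠ x in residual (MulAut H), ∀ s : Finset H, ∃ A : Finset H, s ⊆ A ∧
      (∀ i < n, ∀ a ∈ A, g i a ∈ A) ∧ ∀ a ∈ A, x a ∈ A := by
    rw [eventually_countable_forall]
    intro s
    refine residual_of_dense_open ((isOpen_iff' _).2 ?_) (dense_iff' _ ?_)
    · rintro g0 ⟨A, h1, h2, h3⟩
      exact ⟨A, fun x hx => ⟨A, h1, h2, fun a ha => by rw [hx a ha]; exact h3 a ha⟩⟩
    · intro g0 e
      obtain ⟨g1, h1, h2⟩ := dense_lf hH hg g0 e s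
      exact ⟨g1, h2, h1⟩
  let ex : (Fin (n + 1) → H) → ℕ → H := fun t i => if h : i < n + 1 then t ⟨i, h⟩ else 1
  have H2 : ∀ᶠ x in residual (MulAut H), ∀ (A s : Finset H) (t : Fin (n + 1) → H),
      (∀ i < n, ∀ a ∈ A, g i a ∈ A ∧ g i a = ex t i * a * (ex t i)⁻¹) →
      (∀ a ∈ A, x a ∈ A ∧ x a = ex t n * a * (ex t n)⁻¹) →
      ∃ h : H, (∀ a ∈ A, h * a = a * h) ∧
      (∀ i < n, ∀ b ∈ s, g i (h * b * h⁻¹) = h * (ex t i * b * (ex t i)⁻¹) * h⁻¹) ∧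
      ∀ b ∈ s, x (h * b * h⁻¹) = h * (ex t n * b * (ex t n)⁻¹) * h⁻¹ := by
    simp only [eventually_countable_forall]
    intro A s t hA
    classical
    refine residual_of_dense_open ((isOpen_iff' _).2 ?_) (dense_iff' _ ?_)
    · intro g0 hg0
      by_cases hA0 : ∀ a ∈ A, g0 a ∈ A ∧ g0 a = ex t n * a * (ex t n)⁻¹
      · obtain ⟨h, h1, h2, h3⟩ := hg0 hA0
        exact ⟨s.image (MulAut.conj h), fun x hx _ => ⟨h, h1, h2, fun b hb => by
          rw [← h3 b hb]
          exact hx _ (Finset.mem_image.2 ⟨b, hb, by simp⟩)⟩⟩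
      · refine ⟨A, fun x hx hx' => absurd (fun a ha => ?_) hA0⟩
        rw [← hx a ha]
        exact hx' a ha
    · intro g0 e
      by_cases hA0 : ∀ a ∈ A, g0 a ∈ A ∧ g0 a = ex t n * a * (ex t n)⁻¹
      · obtain ⟨g1, h1, h2⟩ := dense_ext hH hg g0 e A s (ex t) hA hA0
        exact ⟨g1, fun _ => h2, h1⟩
      · exact ⟨g0, fun h => absurd h hA0, fun _ _ => rfl⟩
  filter_upwards [H1, H2] with x h1 h2
  refine ⟨fun s => ?_, fun A s t hA => ?_⟩
  · obtain ⟨A, hs, k1, k2⟩ := h1 s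
    refine ⟨A, hs, fun i hi' => ?_⟩
    rcases Nat.lt_succ_iff_lt_or_eq.1 hi' with h | rfl
    · rw [hi x i h]; exact k1 i h
    · rw [hn]; exact k2
  · have het : ∀ i < n + 1, ex (fun i => t i) i = t i := fun i hi => dif_pos hi
    obtain ⟨h, k1, k2, k3⟩ := h2 A s (fun i => t i) (by
      intro i h
      rw [het i (by omega), ← hi x i h]
      exact hA i (by omega)) (by
      have := hA n (by omega)
      rw [hn] at this
      rw [het n (by omega)]
      exact this)
    refine ⟨h, k1, fun i hi' => ?_⟩
    rw [← het i hi']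
    rcases Nat.lt_succ_iff_lt_or_eq.1 hi' with h | rfl
    · rw [hi x i h]; exact k2 i h
    · rw [hn]; exact k3

/-- Limits of sequences of automorphisms. -/
lemma limit_aut {H : Type u} [Group H] (E : ℕ → Finset H) (hmono : Monotone E)
    (hex : ∀ x, ∃ n, x ∈ E n) (v : ℕ → MulAut H)
    (h1 : ∀ n, ∀ x ∈ E n, v (n + 1) x = v n x)
    (h2 : ∀ n, ∀ x ∈ E n, (v (n + 1)).symm x = (v n).symm x) :
    ∃ u : MulAut H, ∀ n, ∀ x ∈ E n, u x = v n x := by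
  have k1 : ∀ n m, n ≤ m → ∀ x ∈ E n, v m x = v n x := by
    intro n m hnm x hx
    induction m, hnm using Nat.le_induction with
    | base => rfl
    | succ m hm ih => rw [h1 m x (hmono hm hx), ih]
  have k2 : ∀ n m, n ≤ m → ∀ x ∈ E n, (v m).symm x = (v n).symm x := by
    intro n m hnm x hx
    induction m, hnm using Nat.le_induction with
    | base => rfl
    | succ m hm ih => rw [h2 m x (hmono hm hx), ih]
  choose N hN using hex
  have e1 : ∀ x m, N x ≤ m → v (N x) x = v m x := fun x m h => (k1 _ _ h x (hN x)).symm
  have e2 : ∀ x m, N x ≤ m → (v (N x)).symm x = (v m).symm x :=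
    fun x m h => (k2 _ _ h x (hN x)).symm
  refine ⟨⟨⟨fun x => v (N x) x, fun x => (v (N x)).symm x, ?_, ?_⟩, ?_⟩, ?_⟩
  · intro x
    dsimp only
    obtain ⟨m, hm1, hm2⟩ : ∃ m, N x ≤ m ∧ N (v (N x) x) ≤ m :=
      ⟨max _ _, le_max_left _ _, le_max_right _ _⟩
    rw [e2 _ m hm2, MulEquiv.symm_apply_eq]
    exact e1 x m hm1
  · intro x
    dsimp only
    obtain ⟨m, hm1, hm2⟩ : ∃ m, N x ≤ m ∧ N ((v (N x)).symm x) ≤ m :=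
      ⟨max _ _, le_max_left _ _, le_max_right _ _⟩
    rw [e1 _ m hm2, ← MulEquiv.eq_symm_apply]
    exact e2 x m hm1
  · intro x y
    dsimp only
    set m := max (max (N x) (N y)) (N (x * y))
    rw [e1 x m (by omega), e1 y m (by omega), e1 (x * y) m (by omega), map_mul]
  · intro n x hx
    change v (N x) x = v n x
    rw [e1 x (max (N x) n) (le_max_left _ _), k1 n _ (le_max_right _ _) x hx]

/-- A finite partial isomorphism between tuples of automorphisms. -/
def Eqv {H : Type u} [Group H] (n : ℕ) (g b : ℕ → MulAut H) (C : Finset H) (w : H) : Prop :=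
  ∀ i < n, ∀ c ∈ C, g i c ∈ C ∧ b i (w * c * w⁻¹) = w * g i c * w⁻¹

lemma Eqv.fwd {H : Type u} [Group H] (hH : IsHallUniversal H) {n : ℕ} {g b : ℕ → MulAut H}
    (hg : Gen n g) (hb : Gen n b) {C : Finset H} {w : H} (h : Eqv n g b C w) (S : Finset H) :
    ∃ C' w', Eqv n g b C' w' ∧ C ⊆ C' ∧ S ⊆ C' ∧ ∀ c ∈ C, w' * c * w'⁻¹ = w * c * w⁻¹ := by
  classical
  obtain ⟨C', hC', hC'g⟩ := hg.lf (C ∪ S)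
  choose t ht using fun i => inner_on hH (g i) C'
  have hCC : C ⊆ C' := Finset.union_subset_left hC'
  obtain ⟨k, k1, k2⟩ := hb.ext (C.image (MulAut.conj w)) (C'.image (MulAut.conj w))
    (fun i => w * t i * w⁻¹) (by
      intro i hi a ha
      obtain ⟨c, hc, rfl⟩ := Finset.mem_image.1 ha
      obtain ⟨h1, h2⟩ := h i hi c hc
      rw [MulAut.conj_apply, h2]
      refine ⟨Finset.mem_image.2 ⟨_, h1, by simp⟩, ?_⟩
      rw [ht i c (hCC hc)]
      group)
  refine ⟨C', k * w, fun i hi c hc => ⟨hC'g i hi c hc, ?_⟩, hCC, Finset.union_subset_right hC',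
    fun c hc => ?_⟩
  · have := k2 i hi (w * c * w⁻¹) (Finset.mem_image.2 ⟨c, hc, by simp⟩)
    have e : k * w * c * (k * w)⁻¹ = k * (w * c * w⁻¹) * k⁻¹ := by group
    rw [e, this, ht i c hc]
    group
  · have := k1 (w * c * w⁻¹) (Finset.mem_image.2 ⟨c, hc, by simp⟩)
    calc _ = k * (w * c * w⁻¹) * k⁻¹ := by group
      _ = _ := by rw [this]; group

open Classical in
lemma Eqv.symm {H : Type u} [Group H] {n : ℕ} {g b : ℕ → MulAut H}
    {C : Finset H} {w : H} (h : Eqv n g b C w) :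
    Eqv n b g (C.image (MulAut.conj w)) w⁻¹ := by
  intro i hi c hc
  obtain ⟨c, hc', rfl⟩ := Finset.mem_image.1 hc
  obtain ⟨h1, h2⟩ := h i hi c hc'
  rw [MulAut.conj_apply, h2]
  refine ⟨Finset.mem_image.2 ⟨_, h1, by simp⟩, ?_⟩
  have e1 : w⁻¹ * (w * c * w⁻¹) * w⁻¹⁻¹ = c := by group
  rw [e1]
  group

lemma Eqv.step {H : Type u} [Group H] (hH : IsHallUniversal H) {n : ℕ} {g b : ℕ → MulAut H}
    (hg : Gen n g) (hb : Gen n b) {C : Finset H} {w : H} (h : Eqv n g b C w) (S : Finset H) :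
    ∃ C' w', Eqv n g b C' w' ∧ C ⊆ C' ∧ S ⊆ C' ∧ (∀ x ∈ S, w'⁻¹ * x * w' ∈ C') ∧
      ∀ c ∈ C, w' * c * w'⁻¹ = w * c * w⁻¹ := by
  classical
  obtain ⟨C1, w1, h1, hC1, hS1, e1⟩ := h.fwd hH hg hb S
  obtain ⟨D, w2, h2, hD, hSD, e2⟩ := h1.symm.fwd hH hb hg S
  have h3 := h2.symm
  have key : ∀ c ∈ C1, w2⁻¹ * c * w2 = w1 * c * w1⁻¹ := by
    intro c hc
    have := e2 (w1 * c * w1⁻¹) (Finset.mem_image.2 ⟨c, hc, by simp⟩)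
    have e : w1⁻¹ * (w1 * c * w1⁻¹) * w1⁻¹⁻¹ = c := by group
    rw [e] at this
    conv_lhs => rw [← this]
    group
  have hsub : C1 ⊆ D.image (MulAut.conj w2) := by
    intro c hc
    refine Finset.mem_image.2 ⟨w1 * c * w1⁻¹, hD (Finset.mem_image.2 ⟨c, hc, by simp⟩), ?_⟩
    rw [← key c hc, MulAut.conj_apply]
    group
  refine ⟨_, _, h3, hC1.trans hsub, hS1.trans hsub, fun x hx => ?_, fun c hc => ?_⟩
  · exact Finset.mem_image.2 ⟨x, hSD hx, by simp⟩
  · rw [inv_inv, key c (hC1 hc), e1 c hc]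

/-- Back and forth: generic tuples which agree on a finite invariant set are conjugate
over that set. -/
lemma back_forth {H : Type u} [Group H] (hH : IsHallUniversal H) (E : ℕ → Finset H)
    (hmono : Monotone E) (hE0 : E 0 = ∅)
    (hex : ∀ x, ∃ n, x ∈ E n) {n : ℕ} {g b : ℕ → MulAut H}
    (hg : Gen n g) (hb : Gen n b) (A : Finset H)
    (hA : ∀ i < n, ∀ a ∈ A, g i a ∈ A ∧ b i a = g i a) :
    ∃ u : MulAut H, (∀ a ∈ A, u a = a) ∧ ∀ i < n, u * g i = b i * u := by
  classical
  let P : ℕ → Finset H × H → Prop := fun k p => Eqv n g b p.1 p.2 ∧ E k ⊆ p.1 ∧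
    (∀ x ∈ E k, p.2⁻¹ * x * p.2 ∈ p.1) ∧ A ⊆ p.1 ∧ ∀ a ∈ A, p.2 * a * p.2⁻¹ = a
  have hstep : ∀ k (p : {p // P k p}), ∃ p' : {p // P (k + 1) p}, p.1.1 ⊆ p'.1.1 ∧
      ∀ c ∈ p.1.1, p'.1.2 * c * p'.1.2⁻¹ = p.1.2 * c * p.1.2⁻¹ := by
    rintro k ⟨⟨C, w⟩, h1, h2, h3, h4, h5⟩
    obtain ⟨C', w', k1, k2, k3, k4, k5⟩ := h1.step hH hg hb (E (k + 1))
    exact ⟨⟨(C', w'), k1, k3, k4, h4.trans k2, fun a ha => by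
      dsimp only; rw [k5 a (h4 ha)]; exact h5 a ha⟩, k2, k5⟩
  choose F hF using hstep
  let p0 : {p // P 0 p} := ⟨(A, 1), by
    intro i hi c hc
    simpa using hA i hi c hc, by simp [hE0], by simp [hE0], subset_rfl, by simp⟩
  let p : ∀ k, {p // P k p} := fun k => Nat.rec p0 F k
  have hp : ∀ k, p (k + 1) = F k (p k) := fun k => rfl
  have q1 : ∀ k, (p k).1.1 ⊆ (p (k + 1)).1.1 := fun k => by rw [hp]; exact (hF k (p k)).1
  have q2 : ∀ k, ∀ c ∈ (p k).1.1, (p (k + 1)).1.2 * c * (p (k + 1)).1.2⁻¹ =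
      (p k).1.2 * c * (p k).1.2⁻¹ := fun k => by rw [hp]; exact (hF k (p k)).2
  obtain ⟨u, hu⟩ := limit_aut E hmono hex (fun k => MulAut.conj (p k).1.2)
    (fun k x hx => by simpa using q2 k x ((p k).2.2.1 hx))
    (fun k x hx => by
      rw [MulEquiv.symm_apply_eq]
      have := q2 k _ ((p k).2.2.2.1 x hx)
      simp only [MulAut.conj_apply, MulAut.conj_symm_apply]
      rw [this]
      group)
  refine ⟨u, fun a ha => ?_, fun i hi => ?_⟩
  · obtain ⟨k, hk⟩ := hex a
    rw [hu k a hk, MulAut.conj_apply]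
    exact (p k).2.2.2.2.2 a ha
  · ext x
    obtain ⟨k1, hk1⟩ := hex x
    obtain ⟨k2, hk2⟩ := hex (g i x)
    have m1 := hmono (le_max_left k1 k2) hk1
    have m2 := hmono (le_max_right k1 k2) hk2
    rw [MulAut.mul_apply, MulAut.mul_apply, hu _ _ m1, hu _ _ m2, MulAut.conj_apply,
      MulAut.conj_apply]
    exact (((p (max k1 k2)).2.1 i hi x ((p (max k1 k2)).2.2.1 m1)).2).symm


lemma main_step {H : Type u} [Group H] (hH : IsHallUniversal H) (E : ℕ → Finset H)
    (hmono : Monotone E) (hE0 : E 0 = ∅) (hex : ∀ x, ∃ n, x ∈ E n)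
    (K : Subgroup (MulAut H)) (hK : ¬ IsOpen (K : Set (MulAut H)))
    (hKm : ¬ IsMeagre (K : Set (MulAut H))) (S : Finset H)
    (n : ℕ) (g b : ℕ → MulAut H) (h : MulAut H) (hg : Gen n g) (hb : Gen n b)
    (hgb : ∀ i < n, h * g i = b i * h) :
    ∃ x z h' : MulAut H, Gen (n + 1) (Function.update g n x) ∧ Gen (n + 1) (Function.update b n z) ∧
      (∀ i < n, h' * g i = b i * h') ∧ h' * x = z * h' ∧ x ∈ K ∧ z ∉ K ∧
      ∀ s ∈ S, h' s = h s ∧ h'.symm s = h.symm s := by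
  classical
  have := baire hH.countable
  obtain ⟨x, hxK, hx⟩ : ∃ x ∈ K, Gen (n + 1) (Function.update g n x) := by
    by_contra hcon
    push Not at hcon
    apply hKm
    filter_upwards [residual_gen hH hg] with x hx hxK
    exact hcon x hxK hx
  have hy : Gen (n + 1) (Function.update b n (h * x * h⁻¹)) := by
    refine (hx.conj h).congr fun i hi => ?_
    rcases Nat.lt_succ_iff_lt_or_eq.1 hi with hi | rfl
    · simp [hi.ne, hgb i hi]
    · simp
  set y := h * x * h⁻¹ with hydef
  obtain ⟨A, hSA, hA⟩ := hy.lf (S ∪ S.image h)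
  obtain ⟨z, hzK, hz, hzA⟩ : ∃ z, z ∉ K ∧ Gen (n + 1) (Function.update b n z) ∧
      ∀ a ∈ A, z a = y a := by
    by_contra hcon
    push Not at hcon
    apply hK
    rw [isOpen_iff']
    intro k0 hk0
    have hfix : ∀ v : MulAut H, (∀ a ∈ A, v (y a) = y a) → v ∈ K := by
      intro v hv
      have hr := residual_gen hH hb
      have hr2 := (tendsto_residual_of_isOpenMap (continuous_mul_left' v⁻¹)
        (isOpenMap_mul_left' v⁻¹)).eventually hr
      obtain ⟨z, hzU, hz1, hz2⟩ := (dense_of_mem_residual (hr.and hr2)).inter_open_nonempty _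
        (isOpen_basic y A) ⟨y, fun _ _ => rfl⟩
      have m1 : z ∈ K := by
        by_contra hzK
        obtain ⟨a, ha, hne⟩ := hcon z hzK hz1
        exact hne (hzU a ha)
      have m2 : v⁻¹ * z ∈ K := by
        by_contra hzK
        obtain ⟨a, ha, hne⟩ := hcon _ hzK hz2
        apply hne
        rw [MulAut.mul_apply, hzU a ha, MulAut.inv_def, MulEquiv.symm_apply_eq, hv a ha]
      have := K.mul_mem m1 (K.inv_mem m2)
      simpa using this
    refine ⟨A.image (fun a => k0⁻¹ (y a)), fun k hk => ?_⟩
    have : k * k0⁻¹ ∈ K := hfix _ (fun a ha => by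
      rw [MulAut.mul_apply, hk _ (Finset.mem_image_of_mem _ ha)]
      simp)
    simpa using K.mul_mem this hk0
  obtain ⟨u, hu, hub⟩ := back_forth hH E hmono hE0 hex hy hz A (by
    intro i hi a ha
    refine ⟨hA i hi a ha, ?_⟩
    rcases Nat.lt_succ_iff_lt_or_eq.1 hi with hi | rfl
    · simp [hi.ne]
    · simpa using hzA a ha)
  refine ⟨x, z, u * h, hx, hz, fun i hi => ?_, ?_, hxK, hzK, fun s hs => ⟨?_, ?_⟩⟩
  · have := hub i (by omega)
    simp only [Function.update_of_ne hi.ne] at this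
    rw [mul_assoc, hgb i hi, ← mul_assoc, this, mul_assoc]
  · have := hub n (by omega)
    simp only [Function.update_self] at this
    rw [← mul_assoc, ← this, hydef]
    group
  · exact hu _ (hSA (Finset.mem_union_right _ (Finset.mem_image_of_mem _ hs)))
  · rw [MulEquiv.symm_apply_eq, MulAut.mul_apply, MulEquiv.apply_symm_apply]
    exact (hu _ (hSA (Finset.mem_union_left _ hs))).symm

lemma main {H : Type u} [Group H] (hH : IsHallUniversal H)
    (G : ℕ → Subgroup (MulAut H))
    (hmono : ∀ k : ℕ, G k ≤ G (k + 1))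
    (hunion : ∀ f : MulAut H, ∃ k : ℕ, f ∈ G k) :
    ∃ k : ℕ, IsOpen (G k : Set (MulAut H)) := by
  classical
  by_contra hno
  push Not at hno
  have hc := hH.countable
  have := baire hc
  have hG : Monotone G := monotone_nat_of_le_succ hmono
  obtain ⟨n0, hn0⟩ : ∃ n0, ¬ IsMeagre (G n0 : Set (MulAut H)) := by
    by_contra hcon
    push Not at hcon
    have h1 : IsMeagre (⋃ k, (G k : Set (MulAut H))) := isMeagre_iUnion hcon
    have h2 : (⋃ k, (G k : Set (MulAut H))) = Set.univ := by
      ext f; simpa using hunion f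
    rw [h2] at h1
    exact not_isMeagre_of_mem_residual Filter.univ_mem h1
  have hnm : ∀ k, ¬ IsMeagre (G (n0 + k) : Set (MulAut H)) := fun k hk =>
    hn0 (hk.mono (hG (Nat.le_add_right _ _)))
  obtain ⟨e, he⟩ := exists_surjective_nat H
  let E : ℕ → Finset H := fun k => (Finset.range k).image e
  have hE : Monotone E := fun a b hab => Finset.image_subset_image (Finset.range_mono hab)
  have hE0 : E 0 = ∅ := by simp [E]
  have hex : ∀ x, ∃ n, x ∈ E n := fun x => by
    obtain ⟨k, rfl⟩ := he x
    exact ⟨k + 1, Finset.mem_image_of_mem _ (by simp)⟩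
  let P : ℕ → (ℕ → MulAut H) × (ℕ → MulAut H) × MulAut H → Prop := fun n s =>
    Gen n s.1 ∧ Gen n s.2.1 ∧ ∀ i < n, s.2.2 * s.1 i = s.2.1 i * s.2.2
  have hstep : ∀ n (s : {s // P n s}), ∃ s' : {s // P (n + 1) s},
      (∀ i < n, s'.1.1 i = s.1.1 i ∧ s'.1.2.1 i = s.1.2.1 i) ∧
      s'.1.1 n ∈ G (n0 + n) ∧ s'.1.2.1 n ∉ G (n0 + n) ∧
      ∀ x ∈ E n, s'.1.2.2 x = s.1.2.2 x ∧ s'.1.2.2.symm x = s.1.2.2.symm x := by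
    rintro n ⟨⟨g, b, h⟩, h1, h2, h3⟩
    obtain ⟨x, z, h', k1, k2, k3, k4, k5, k6, k7⟩ := main_step hH E hE hE0 hex (G (n0 + n))
      (hno _) (hnm n) (E n) n g b h h1 h2 h3
    refine ⟨⟨(Function.update g n x, Function.update b n z, h'), k1, k2, fun i hi => ?_⟩,
      fun i hi => ?_, ?_, ?_, k7⟩
    · rcases Nat.lt_succ_iff_lt_or_eq.1 hi with hi | rfl
      · simpa [hi.ne] using k3 i hi
      · simpa using k4
    · simp [hi.ne]
    · simpa using k5
    · simpa using k6
  choose F hF using hstep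
  let p0 : {s // P 0 s} := ⟨(fun _ => 1, fun _ => 1, 1), Gen.zero _, Gen.zero _, by simp⟩
  let p : ∀ k, {s // P k s} := fun k => Nat.rec p0 F k
  have hp : ∀ k, p (k + 1) = F k (p k) := fun k => rfl
  have q : ∀ n, (∀ i < n, (p (n + 1)).1.1 i = (p n).1.1 i ∧
      (p (n + 1)).1.2.1 i = (p n).1.2.1 i) ∧
      (p (n + 1)).1.1 n ∈ G (n0 + n) ∧ (p (n + 1)).1.2.1 n ∉ G (n0 + n) ∧
      ∀ x ∈ E n, (p (n + 1)).1.2.2 x = (p n).1.2.2 x ∧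
        (p (n + 1)).1.2.2.symm x = (p n).1.2.2.symm x := fun n => by
    rw [hp]; exact hF n (p n)
  obtain ⟨u, hu⟩ := limit_aut E hE hex (fun k => (p k).1.2.2)
    (fun n x hx => ((q n).2.2.2 x hx).1) (fun n x hx => ((q n).2.2.2 x hx).2)
  obtain ⟨m, hm⟩ := hunion u
  have hm' : u ∈ G (n0 + m) := hG (Nat.le_add_left _ _) hm
  have stab : ∀ n, m + 1 ≤ n → (p n).1.1 m = (p (m + 1)).1.1 m ∧
      (p n).1.2.1 m = (p (m + 1)).1.2.1 m := by
    intro n hn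
    induction n, hn using Nat.le_induction with
    | base => exact ⟨rfl, rfl⟩
    | succ n hn ih =>
      have := (q n).1 m (by omega)
      exact ⟨this.1.trans ih.1, this.2.trans ih.2⟩
  set x := (p (m + 1)).1.1 m with hx
  set z := (p (m + 1)).1.2.1 m with hz
  have hconj : u * x = z * u := by
    ext a
    obtain ⟨k1, hk1⟩ := hex a
    obtain ⟨k2, hk2⟩ := hex (x a)
    obtain ⟨k, l1, l2, l3⟩ : ∃ k, k1 ≤ k ∧ k2 ≤ k ∧ m + 1 ≤ k :=
      ⟨max (max k1 k2) (m + 1), by omega, by omega, by omega⟩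
    have := (p k).2.2.2 m (by omega)
    rw [(stab k l3).1, (stab k l3).2] at this
    rw [MulAut.mul_apply, MulAut.mul_apply, hu k _ (hE l1 hk1), hu k _ (hE l2 hk2)]
    exact DFunLike.congr_fun this a
  have hzz : z = u * x * u⁻¹ := by rw [hconj]; group
  apply (q m).2.2.1
  rw [← hz, hzz]
  exact (G _).mul_mem ((G _).mul_mem hm' (q m).2.1) ((G _).inv_mem hm')

end

end HallChain

/-- **`Aut H` is not the union of a countable chain of non-open subgroups.**
If `(Gₖ)ₖ` is an increasing sequence of subgroups of `Aut H` whose union is all of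
`Aut H`, then some `Gₖ` is open. -/
theorem hallUniversal_not_countable_chain_of_nonopen
    (H : Type*) [Group H] (hH : IsHallUniversal H)
    (G : ℕ → Subgroup (MulAut H))
    (hmono : ∀ k : ℕ, G k ≤ G (k + 1))
    (hunion : ∀ f : MulAut H, ∃ k : ℕ, f ∈ G k) :
    ∃ k : ℕ, IsOpen (G k : Set (MulAut H)) := by
  exact HallChain.main hH G hmono hunion
end

section
/- Let H be a Hall universal group. Then Aut(H) is a complete group: the center of Aut(H) is trivial, and every automorphism of the group Aut(H) is an inner automorphism of Aut(H). -/
/-- Burnside-type lemma: the automorphism group of a centerless group with only trivial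
normal subgroups is complete. -/
theorem aut_complete_of_simple (H : Type*) [Group H]
    (hs : ∀ N : Subgroup H, N.Normal → N ≠ ⊥ → N = ⊤)
    (hinj : Function.Injective (MulAut.conj : H →* MulAut H)) :
    Subgroup.center (MulAut H) = ⊥ ∧
      ∀ Φ : MulAut (MulAut H), ∃ g : MulAut H, ∀ x : MulAut H, Φ x = g * x * g⁻¹ := by
  have hconj : ∀ (z : MulAut H) (h : H), z * MulAut.conj h * z⁻¹ = MulAut.conj (z h) := by
    intro z h
    ext k
    simp [MulAut.mul_apply, MulAut.conj_apply]
  have key : ∀ N : Subgroup (MulAut H), N.Normal → N ≠ ⊥ → ∀ h, MulAut.conj h ∈ N := by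
    intro N hN hne
    obtain ⟨⟨z, hz⟩, hz0⟩ := Subgroup.ne_bot_iff_exists_ne_one.1 hne
    have hz1 : z ≠ 1 := fun h => hz0 (Subtype.ext h)
    have hM : (N.comap (MulAut.conj : H →* MulAut H)) = ⊤ := by
      apply hs _ (hN.comap _)
      intro hbot
      apply hz1
      ext h
      have h1 : z h * h⁻¹ ∈ N.comap (MulAut.conj : H →* MulAut H) := by
        rw [Subgroup.mem_comap, map_mul, ← hconj, map_inv]
        have := N.mul_mem hz (hN.conj_mem _ (N.inv_mem hz) (MulAut.conj h))
        simpa [mul_assoc] using this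
      rw [hbot, Subgroup.mem_bot] at h1
      simpa using mul_inv_eq_one.1 h1
    intro h
    have : h ∈ N.comap (MulAut.conj : H →* MulAut H) := by rw [hM]; trivial
    exact this
  have hchar : ∀ Φ : MulAut (MulAut H), ∀ h, ∃ k, Φ (MulAut.conj h) = MulAut.conj k := by
    intro Φ h
    by_cases hh : h = 1
    · exact ⟨1, by simp [hh]⟩
    have hnorm : ((MulAut.conj : H →* MulAut H).range).Normal := by
      constructor
      rintro _ ⟨n, rfl⟩ g
      exact ⟨g n, (hconj g n).symm⟩
    have := key ((MulAut.conj : H →* MulAut H).range.comap Φ.toMonoidHom)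
      (hnorm.comap _) (by
        intro hbot
        have h2 : Φ.symm (MulAut.conj h) ∈
            ((MulAut.conj : H →* MulAut H).range.comap Φ.toMonoidHom) :=
          ⟨h, by simp⟩
        rw [hbot, Subgroup.mem_bot] at h2
        have h3 : MulAut.conj h = 1 := by simpa using h2
        exact hh (hinj (by rw [h3, map_one]))) h
    obtain ⟨k, hk⟩ := this
    exact ⟨k, hk.symm⟩
  constructor
  · rw [eq_bot_iff]
    intro z hz
    rw [Subgroup.mem_bot]
    ext h
    have h1 := Subgroup.mem_center_iff.1 hz (MulAut.conj h)
    have h2 := hconj z h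
    rw [← h1, mul_inv_cancel_right] at h2
    exact (hinj h2).symm
  · intro Φ
    choose a ha using hchar Φ
    choose b hb using hchar Φ.symm
    let α : MulAut H :=
      { toFun := a
        invFun := b
        left_inv := fun h => hinj (by rw [← hb, ← ha]; exact Φ.symm_apply_apply _)
        right_inv := fun h => hinj (by rw [← ha, ← hb]; exact Φ.apply_symm_apply _)
        map_mul' := fun h k => hinj (by rw [← ha, map_mul, map_mul, ha, ha, map_mul]) }
    have hα : ∀ h, Φ (MulAut.conj h) = MulAut.conj (α h) := ha
    refine ⟨α, fun x => ?_⟩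
    rw [eq_mul_inv_iff_mul_eq]
    ext h
    apply hinj
    rw [MulAut.mul_apply, MulAut.mul_apply, ← hconj, ← hα, ← hα, ← hconj]
    simp

/-- In a Hall universal group every element has finite order. -/
theorem IsHallUniversal.orderOf_pos {H : Type*} [Group H] (hH : IsHallUniversal H) (x : H) :
    0 < orderOf x := by
  have : Finite (Subgroup.zpowers x) :=
    hH.locallyFinite _ ⟨{x}, by simp [Subgroup.zpowers_eq_closure]⟩
  rw [← Nat.card_zpowers]
  exact Nat.card_pos

/-- In a Hall universal group elements of the same order are conjugate. -/
theorem IsHallUniversal.isConj {H : Type*} [Group H] (hH : IsHallUniversal H) {x y : H}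
    (hxy : orderOf x = orderOf y) : IsConj x y := by
  obtain ⟨n, hn⟩ : ∃ n, n = orderOf x := ⟨_, rfl⟩
  have hn0 : NeZero n := ⟨by rw [hn]; exact (hH.orderOf_pos x).ne'⟩
  let C := Multiplicative (ZMod n)
  obtain ⟨φ, hφ⟩ := hH.embedsFinite (Equiv.Perm C)
  let ψ : C →* H := φ.comp (MulAction.toPermHom C C)
  have hψ : Function.Injective ψ := hφ.comp MulAction.toPerm_injective
  have hcard : Nat.card C = n := by simp [C]
  have main : ∀ z : H, orderOf z = n → ∃ c : C, orderOf c = n ∧ IsConj z (ψ c) := by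
    intro z hz
    have hfin : Finite (Subgroup.zpowers z) := by
      apply Nat.finite_of_card_ne_zero
      rw [Nat.card_zpowers, hz]; exact hn0.ne
    have hiso : Nonempty (Subgroup.zpowers z ≃* ψ.range) :=
      ⟨(mulEquivOfCyclicCardEq (by rw [Nat.card_zpowers, hz, hcard])).trans
        (MonoidHom.ofInjective hψ)⟩
    obtain ⟨h, hh⟩ := hH.conjIso (Subgroup.zpowers z) ψ.range hfin
      (Finite.of_equiv C (MonoidHom.ofInjective hψ).toEquiv) hiso
    have h1 : h * z * h⁻¹ ∈ ψ.range := by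
      rw [← hh]
      exact ⟨z, Subgroup.mem_zpowers z, rfl⟩
    obtain ⟨c, hc⟩ := h1
    have h2 : IsConj z (ψ c) := isConj_iff.2 ⟨h, hc.symm⟩
    refine ⟨c, ?_, h2⟩
    rw [← orderOf_injective ψ hψ, hc, ← hz]
    exact orderOf_injective (MulAut.conj h).toMonoidHom (MulAut.conj h).injective z
  obtain ⟨c, hc, hxc⟩ := main x hn.symm
  obtain ⟨d, hd, hyd⟩ := main y (by rw [← hxy, hn])
  refine hxc.trans (IsConj.trans ?_ hyd.symm)
  have gen : ∀ e : C, orderOf e = n → ∀ w, w ∈ Subgroup.zpowers e := by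
    intro e he w
    have : Subgroup.zpowers e = ⊤ := by
      apply Subgroup.eq_top_of_card_eq
      rw [Nat.card_zpowers, he, hcard]
    rw [this]; trivial
  let α : C ≃* C := mulEquivOfOrderOfEq (gen c hc) (gen d hd) (hc.trans hd.symm)
  have hα : α c = d := mulEquivOfOrderOfEq_apply_gen _ _ _
  have : IsConj (MulAction.toPermHom C C c) (MulAction.toPermHom C C d) := by
    refine isConj_iff.2 ⟨α.toEquiv, ?_⟩
    rw [mul_inv_eq_iff_eq_mul]
    ext w
    change α (c * w) = d * α w
    rw [map_mul, hα]
  exact φ.map_isConj this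

/-- In the wreath product of `D` by `Q`, the commutator of a base element with `q ≠ 1`
has the same order as the base element. -/
theorem wreath_commutator {D Q : Type} [Group D] [Group Q] (d : D) (q : Q) (hq : q ≠ 1) :
    ∃ f : RegularWreathProduct D Q,
      orderOf (f * RegularWreathProduct.inl q * f⁻¹ * (RegularWreathProduct.inl q)⁻¹)
        = orderOf d := by
  classical
  let base : (Q → D) →* RegularWreathProduct D Q :=
    { toFun := fun F => ⟨F, 1⟩
      map_one' := rfl
      map_mul' := fun F G => by
        ext <;> simp }
  have hbase : Function.Injective base := fun F G h => congrArg RegularWreathProduct.left h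
  refine ⟨base (Pi.mulSingle 1 d), ?_⟩
  have : base (Pi.mulSingle 1 d) * RegularWreathProduct.inl q * (base (Pi.mulSingle 1 d))⁻¹ *
      (RegularWreathProduct.inl q)⁻¹ = base (Pi.mulSingle 1 d * Pi.mulSingle q d⁻¹) := by
    ext w
    · by_cases h1 : w = q
      · subst h1
        simp [base]
      · have h2 : q⁻¹ * w ≠ 1 := fun h => h1 (inv_mul_eq_one.1 h).symm
        simp [base, Pi.mulSingle_apply, h1, h2]
    · simp [base]
  rw [this, orderOf_injective base hbase, orderOf_eq_orderOf_iff]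
  intro k
  constructor
  · intro h
    have := congrFun h 1
    simpa [Pi.mulSingle_apply, hq.symm] using this
  · intro h
    funext w
    by_cases h1 : w = 1
    · subst h1
      simp [Pi.mulSingle_apply, hq.symm, h]
    · by_cases h2 : w = q
      · subst h2
        simp [Pi.mulSingle_apply, hq, h]
      · simp [Pi.mulSingle_apply, h1, h2]

/-- A Hall universal group has no nontrivial proper normal subgroup. -/
theorem IsHallUniversal.simple {H : Type*} [Group H] (hH : IsHallUniversal H)
    (N : Subgroup H) (hN : N.Normal) (hne : N ≠ ⊥) : N = ⊤ := by
  obtain ⟨⟨x, hx⟩, hx1⟩ := Subgroup.ne_bot_iff_exists_ne_one.1 hne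
  have hx1 : x ≠ 1 := fun h => hx1 (Subtype.ext h)
  have hmem : ∀ a b : H, a ∈ N → orderOf a = orderOf b → b ∈ N := by
    intro a b ha hab
    obtain ⟨g, rfl⟩ := isConj_iff.1 (hH.isConj hab)
    exact hN.conj_mem _ ha g
  rw [eq_top_iff]
  intro y _
  have hn0 : NeZero (orderOf x) := ⟨(hH.orderOf_pos x).ne'⟩
  have hm0 : NeZero (orderOf y) := ⟨(hH.orderOf_pos y).ne'⟩
  let Q := Multiplicative (ZMod (orderOf x))
  let D := Multiplicative (ZMod (orderOf y))
  obtain ⟨q, hq⟩ := IsCyclic.exists_ofOrder_eq_natCard (α := Q)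
  obtain ⟨d, hd⟩ := IsCyclic.exists_ofOrder_eq_natCard (α := D)
  have hq' : orderOf q = orderOf x := by rw [hq]; simp [Q]
  have hd' : orderOf d = orderOf y := by rw [hd]; simp [D]
  have hq1 : q ≠ 1 := by
    intro h
    rw [h, orderOf_one] at hq'
    exact hx1 (orderOf_eq_one_iff.1 hq'.symm)
  obtain ⟨f, hf⟩ := wreath_commutator d q hq1
  obtain ⟨φ, hφ⟩ := hH.embedsFinite (RegularWreathProduct D Q)
  have hinl : Function.Injective (RegularWreathProduct.inl : Q →* RegularWreathProduct D Q) :=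
    fun a b h => congrArg RegularWreathProduct.right h
  have hs : φ (RegularWreathProduct.inl q) ∈ N := by
    apply hmem x _ hx
    rw [orderOf_injective φ hφ, orderOf_injective _ hinl, hq']
  apply hmem _ y _ ((orderOf_injective φ hφ _).trans (hf.trans hd'))
  rw [map_mul, map_mul, map_mul, map_inv, map_inv]
  exact N.mul_mem (hN.conj_mem _ hs _) (N.inv_mem hs)

/-- A Hall universal group has trivial center. -/
theorem IsHallUniversal.conj_injective {H : Type*} [Group H] (hH : IsHallUniversal H) :
    Function.Injective (MulAut.conj : H →* MulAut H) := by
  rw [← MonoidHom.ker_eq_bot_iff]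
  by_contra hne
  have htop := hH.simple _ inferInstance hne
  obtain ⟨φ, hφ⟩ := hH.embedsFinite (Equiv.Perm (Fin 3))
  have hcomm : ∀ a b : Equiv.Perm (Fin 3), a * b = b * a := by
    intro a b
    apply hφ
    have h1 : φ a ∈ (MulAut.conj : H →* MulAut H).ker := by rw [htop]; trivial
    have h2 := DFunLike.congr_fun ((MonoidHom.mem_ker).1 h1) (φ b)
    rw [MulAut.conj_apply, MulAut.one_apply, mul_inv_eq_iff_eq_mul] at h2
    rw [map_mul, map_mul, h2]
  exact absurd hcomm (by decide)

/-- **`Aut H` is a complete group.**  The center of `Aut H` is trivial and every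
automorphism of the group `Aut H` is inner. -/
theorem hallUniversal_aut_complete
    (H : Type*) [Group H] (hH : IsHallUniversal H) :
    Subgroup.center (MulAut H) = ⊥ ∧
      ∀ Φ : MulAut (MulAut H), ∃ g : MulAut H, ∀ x : MulAut H, Φ x = g * x * g⁻¹ := by
  exact aut_complete_of_simple H hH.simple hH.conj_injective
end

section
/- Let H be a Hall universal group and let g ∈ Aut(H) be a generic automorphism, i.e., the conjugacy class { f g f⁻¹ : f ∈ Aut(H) } is comeager in Aut(H). Then for every integer n ≥ 1, g is conjugate in Aut(H) to its n-th power gⁿ. -/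
set_option linter.style.haveILetI false

namespace HallAux

open Topology Filter

section Topo
variable {H : Type*} [Group H]

lemma ev_discrete {X : Type*} [TopologicalSpace X] [DiscreteTopology X] (a : X) :
    ∀ᶠ y in 𝓝 a, y = a := by
  simp [nhds_discrete]

lemma eventually_apply (f0 : MulAut H) (y : H) : ∀ᶠ f in 𝓝 f0, f y = f0 y := by
  letI : TopologicalSpace H := ⊥
  haveI : DiscreteTopology H := ⟨rfl⟩
  have hc : Continuous (fun f : MulAut H => (f : H → H)) := continuous_induced_dom
  have hcy : Continuous (fun f : MulAut H => f y) := (continuous_apply y).comp hc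
  exact hcy.continuousAt.eventually (ev_discrete _)

lemma exists_finset {U : Set (MulAut H)} (hU : IsOpen U) {f0 : MulAut H} (hf : f0 ∈ U) :
    ∃ S : Finset H, ∀ f : MulAut H, (∀ x ∈ S, f x = f0 x) → f ∈ U := by
  letI : TopologicalSpace H := ⊥
  obtain ⟨V, hV, rfl⟩ := isOpen_induced_iff.1 hU
  obtain ⟨I, u, h1, h2⟩ := isOpen_pi_iff.1 hV _ hf
  refine ⟨I, fun f h => h2 fun x hx => ?_⟩
  have := (h1 x hx).2
  change f x ∈ u x
  rw [h x hx]
  exact this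

lemma isOpen_agree (S : Finset H) (f0 : MulAut H) :
    IsOpen {f : MulAut H | ∀ x ∈ S, f x = f0 x} := by
  rw [isOpen_iff_mem_nhds]
  intro f1 h1
  have : ∀ᶠ f in 𝓝 f1, ∀ x ∈ S, f x = f1 x :=
    (Filter.eventually_all_finset S).2 fun x _ => eventually_apply f1 x
  filter_upwards [this] with f hf x hx
  rw [hf x hx, h1 x hx]

lemma eventually_pow (n : ℕ) (f0 : MulAut H) (y : H) :
    ∀ᶠ f in 𝓝 f0, (f ^ n) y = (f0 ^ n) y := by
  induction n with
  | zero => simp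
  | succ k ih =>
    filter_upwards [ih, eventually_apply f0 ((f0 ^ k) y)] with f h1 h2
    rw [pow_succ', pow_succ', MulAut.mul_apply, MulAut.mul_apply, h1, h2]

lemma isOpen_pow {U : Set (MulAut H)} (hU : IsOpen U) (n : ℕ) :
    IsOpen {f : MulAut H | f ^ n ∈ U} := by
  rw [isOpen_iff_mem_nhds]
  intro f0 h0
  obtain ⟨S, hS⟩ := exists_finset hU h0
  have : ∀ᶠ f in 𝓝 f0, ∀ x ∈ S, (f ^ n) x = (f0 ^ n) x :=
    (Filter.eventually_all_finset S).2 fun x _ => eventually_pow n f0 x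
  filter_upwards [this] with f hf
  exact hS _ hf

lemma eventually_inv (f0 : MulAut H) (y : H) : ∀ᶠ f in 𝓝 f0, f.symm y = f0.symm y := by
  filter_upwards [eventually_apply f0 (f0.symm y)] with f hf
  rw [MulEquiv.symm_apply_eq, hf, MulEquiv.apply_symm_apply]

lemma baire [Countable H] : BaireSpace (MulAut H) := by
  letI : TopologicalSpace H := ⊥
  haveI : DiscreteTopology H := ⟨rfl⟩
  let F : MulAut H → (H → H) × (H → H) := fun f => (f, f.symm)
  have hc : Continuous (fun f : MulAut H => (f : H → H)) := continuous_induced_dom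
  have hind : IsInducing (fun f : MulAut H => (f : H → H)) := ⟨rfl⟩
  have hF : Continuous F := by
    refine hc.prodMk (continuous_pi fun y => continuous_iff_continuousAt.2 fun f0 => ?_)
    exact tendsto_nhds_of_eventually_eq (eventually_inv f0 y)
  have hFi : IsInducing F := IsInducing.of_comp hF continuous_fst hind
  have hcl : IsClosedEmbedding F := by
    refine ⟨⟨hFi, fun a b h => ?_⟩, ?_⟩
    · exact DFunLike.coe_injective (congrArg Prod.fst h)
    · have : Set.range F = {p | (∀ x, p.1 (p.2 x) = x) ∧ (∀ x, p.2 (p.1 x) = x) ∧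
          ∀ x y, p.1 (x * y) = p.1 x * p.1 y} := by
        ext p
        constructor
        · rintro ⟨f, rfl⟩
          simp [F]
        · rintro ⟨h1, h2, h3⟩
          exact ⟨MulEquiv.mk ⟨p.1, p.2, h2, h1⟩ h3, rfl⟩
      have key : ∀ (x : H), Continuous fun q : (H → H) × H => q.1 q.2 := fun _ => by
        refine continuous_iff_continuousAt.2 fun q0 => ?_
        refine tendsto_nhds_of_eventually_eq ?_
        have e1 : ∀ᶠ q : (H → H) × H in 𝓝 q0, q.2 = q0.2 :=
          continuous_snd.continuousAt.eventually (ev_discrete _)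
        have e2 : ∀ᶠ q : (H → H) × H in 𝓝 q0, q.1 q0.2 = q0.1 q0.2 :=
          ((continuous_apply q0.2).comp continuous_fst).continuousAt.eventually
            (ev_discrete _)
        filter_upwards [e1, e2] with q h1 h2
        rw [h1, h2]
      have k := key 1
      have c1 : ∀ x, Continuous fun p : (H → H) × (H → H) => p.1 x := fun x =>
        (continuous_apply x).comp continuous_fst
      have c2 : ∀ x, Continuous fun p : (H → H) × (H → H) => p.2 x := fun x =>
        (continuous_apply x).comp continuous_snd
      rw [this]
      simp only [Set.ofPred_and, Set.ofPred_forall]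
      refine IsClosed.inter (isClosed_iInter fun x => ?_) (IsClosed.inter
        (isClosed_iInter fun x => ?_) (isClosed_iInter fun x => isClosed_iInter fun y => ?_))
      · exact isClosed_eq (k.comp (continuous_fst.prodMk (c2 x))) continuous_const
      · exact isClosed_eq (k.comp (continuous_snd.prodMk (c1 x))) continuous_const
      · have cm : Continuous fun q : H × H => q.1 * q.2 := continuous_of_discreteTopology
        exact isClosed_eq (c1 _) (cm.comp ((c1 x).prodMk (c1 y)))
  haveI : PolishSpace H := inferInstance
  haveI := hcl.polishSpace
  infer_instance

end Topo

section Alg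
variable {H : Type*} [Group H]

lemma embeds (hH : IsHallUniversal H) (G : Type*) [Group G] [Finite G] :
    ∃ f : G →* H, Function.Injective f := by
  haveI : Finite (Shrink.{0} G) := Finite.of_equiv G (equivShrink.{0} G)
  obtain ⟨f, hf⟩ := hH.embedsFinite (Shrink.{0} G)
  exact ⟨f.comp (Shrink.mulEquiv.{0} (α := G)).symm.toMonoidHom,
    hf.comp (Shrink.mulEquiv.{0} (α := G)).symm.injective⟩

/-- every embedding is conjugate to the regular one -/
lemma conj_regular (hH : IsHallUniversal H) {M : Type*} [Group M] [Finite M]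
    (e : Equiv.Perm M →* H) (he : Function.Injective e) (a : M →* H)
    (ha : Function.Injective a) :
    ∃ x : H, ∀ m, x * a m * x⁻¹ = e (MulAction.toPermHom M M m) := by
  set r : M →* Equiv.Perm M := MulAction.toPermHom M M with hr
  have hri : Function.Injective r := MulAction.toPerm_injective
  have hb : Function.Injective (e.comp r) := he.comp hri
  let ea := MonoidHom.ofInjective ha
  let eb := MonoidHom.ofInjective hb
  obtain ⟨x, hx⟩ := hH.conjIso a.range (e.comp r).range (Finite.of_equiv M ea.toEquiv)
    (Finite.of_equiv M eb.toEquiv) ⟨ea.symm.trans eb⟩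
  have h1 : ∀ m, ∃ mm, e (r mm) = x * a m * x⁻¹ := by
    intro m
    have : x * a m * x⁻¹ ∈ (e.comp r).range := by
      rw [← hx]
      exact ⟨a m, ⟨m, rfl⟩, rfl⟩
    exact this
  choose s hs using h1
  have smul : ∀ m k, s (m * k) = s m * s k := by
    intro m k
    apply hb
    simp only [MonoidHom.comp_apply, map_mul, hs]
    group
  have sinj : Function.Injective s := by
    intro m k h
    have := hs m
    rw [h, hs k] at this
    exact (ha (by simpa using this)).symm
  let σ : Equiv.Perm M := Equiv.ofBijective s (Finite.injective_iff_bijective.1 sinj)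
  have hσ : ∀ m, r (s m) = σ * r m * σ⁻¹ := by
    intro m
    rw [eq_mul_inv_iff_mul_eq]
    ext k
    simp [hr, σ, smul]
  refine ⟨(e σ)⁻¹ * x, fun m => ?_⟩
  have := hs m
  rw [hσ, map_mul, map_mul, map_inv] at this
  calc _ = (e σ)⁻¹ * (x * a m * x⁻¹) * e σ := by group
    _ = _ := by rw [← this]; group

lemma conj_of_inj (hH : IsHallUniversal H) {M : Type*} [Group M] [Finite M]
    (a b : M →* H) (ha : Function.Injective a) (hb : Function.Injective b) :
    ∃ x : H, ∀ m, x * a m * x⁻¹ = b m := by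
  obtain ⟨e, he⟩ := embeds hH (Equiv.Perm M)
  obtain ⟨x, hx⟩ := conj_regular hH e he a ha
  obtain ⟨y, hy⟩ := conj_regular hH e he b hb
  refine ⟨y⁻¹ * x, fun m => ?_⟩
  have := (hx m).trans (hy m).symm
  calc _ = y⁻¹ * (x * a m * x⁻¹) * y := by group
    _ = _ := by rw [this]; group

lemma extend (hH : IsHallUniversal H) {M L : Type*} [Group M] [Group L] [Finite M] [Finite L]
    (j : M →* L) (hj : Function.Injective j) (i : M →* H) (hi : Function.Injective i) :
    ∃ k : L →* H, Function.Injective k ∧ ∀ m, k (j m) = i m := by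
  obtain ⟨e, he⟩ := embeds hH L
  obtain ⟨x, hx⟩ := conj_of_inj hH (e.comp j) i (he.comp hj) hi
  exact ⟨(MulAut.conj x).toMonoidHom.comp e, (MulAut.conj x).injective.comp he, hx⟩

/-- On a finite set, every automorphism agrees with an inner one. -/
lemma exists_inner (hH : IsHallUniversal H) (p : MulAut H) (K : Subgroup H) [Finite K] :
    ∃ h : H, ∀ x ∈ K, p x = h * x * h⁻¹ := by
  obtain ⟨h, hh⟩ := conj_of_inj hH K.subtype (p.toMonoidHom.comp K.subtype)
    K.subtype_injective (p.injective.comp K.subtype_injective)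
  exact ⟨h, fun x hx => (hh ⟨x, hx⟩).symm⟩

lemma finite_closure (hH : IsHallUniversal H) (S : Finset H) :
    Finite (Subgroup.closure (S : Set H)) :=
  hH.locallyFinite _ ⟨S, rfl⟩

/-- Roots modulo centralizers. -/
lemma exists_root (hH : IsHallUniversal H) (K L : Subgroup H) [Finite L] (hKL : K ≤ L)
    (u : H) (hu : u ∈ L) (huK : ∀ k ∈ K, Commute k u) (n : ℕ) (hn : 1 ≤ n) :
    ∃ w z : H, (∀ k ∈ K, Commute k w) ∧ (∀ l ∈ L, Commute l z) ∧ w ^ n = u * z := by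
  haveI : Finite K := Finite.of_injective _ (Subgroup.inclusion_injective hKL)
  let uL : L := ⟨u, hu⟩
  set m := orderOf uL with hm
  have hmpos : 0 < m := orderOf_pos uL
  haveI : NeZero m := ⟨hmpos.ne'⟩
  haveI : NeZero (n * m) := ⟨(Nat.mul_pos hn hmpos).ne'⟩
  let Z := Multiplicative (ZMod m)
  let W := Multiplicative (ZMod (n * m))
  haveI : Finite Z := inferInstanceAs (Finite (ZMod m))
  haveI : Finite W := inferInstanceAs (Finite (ZMod (n * m)))
  -- the homomorphism `Z → L` onto powers of `u`
  let pu : Z →* L := AddMonoidHom.toMultiplicativeLeft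
    (ZMod.lift m ⟨zmultiplesHom (Additive L) (Additive.ofMul uL), by
      simp [← ofMul_pow, hm, pow_orderOf_eq_one]⟩)
  have hpu1 : pu (Multiplicative.ofAdd 1) = uL := by
    have := ZMod.lift_coe m ⟨zmultiplesHom (Additive L) (Additive.ofMul uL), by
      simp [← ofMul_pow, hm, pow_orderOf_eq_one]⟩ 1
    simp only [Int.cast_one] at this
    change Additive.toMul (ZMod.lift m _ (1 : ZMod m)) = uL
    rw [this]
    simp
  -- the homomorphism `Z → W`, multiplication by `n`
  let qn : Z →* W := AddMonoidHom.toMultiplicative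
    (ZMod.lift m ⟨zmultiplesHom (ZMod (n * m)) (n : ZMod (n * m)), by
      have := ZMod.natCast_self (n * m)
      push_cast at this
      simp [mul_comm, this]⟩)
  have hqcoe : ∀ k : ℤ, qn (Multiplicative.ofAdd (k : ZMod m)) =
      Multiplicative.ofAdd (((k * n : ℤ)) : ZMod (n * m)) := by
    intro k
    change Multiplicative.ofAdd (ZMod.lift m _ (k : ZMod m)) = _
    rw [ZMod.lift_coe]
    simp
  have hqinj : Function.Injective qn := by
    rw [injective_iff_map_eq_one]
    intro a ha
    obtain ⟨k, hk⟩ := ZMod.intCast_surjective (Multiplicative.toAdd a)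
    have hkk : a = Multiplicative.ofAdd (k : ZMod m) := by rw [hk]; rfl
    rw [hkk, hqcoe, ofAdd_eq_one, ZMod.intCast_zmod_eq_zero_iff_dvd] at ha
    rw [hkk, ofAdd_eq_one, ZMod.intCast_zmod_eq_zero_iff_dvd]
    push_cast at ha
    rw [mul_comm k] at ha
    exact Int.dvd_of_mul_dvd_mul_left (by omega) ha
  have hucomm : ∀ (k : K) (i : Z), Commute (Subgroup.inclusion hKL k) (pu i) := by
    intro k i
    obtain ⟨j, hj⟩ := ZMod.intCast_surjective (Multiplicative.toAdd i)
    have hi : i = (Multiplicative.ofAdd (1 : ZMod m)) ^ j := by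
      rw [← ofAdd_zsmul, zsmul_one, hj]; rfl
    rw [hi, map_zpow, hpu1]
    refine Commute.zpow_right ?_ j
    exact Subtype.ext (huK k k.2)
  obtain ⟨ψ, hψi, hψ⟩ := extend hH (MonoidHom.inl L Z) (fun a b h => (Prod.ext_iff.1 h).1)
    L.subtype L.subtype_injective
  let z := ψ (1, Multiplicative.ofAdd 1)
  let φ₀ : K × Z →* L × Z :=
    (MonoidHom.noncommCoprod (Subgroup.inclusion hKL) pu hucomm).prod (MonoidHom.snd K Z)
  have hφ₀ : Function.Injective φ₀ := by
    rintro ⟨a, i⟩ ⟨b, j⟩ h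
    have h2 : i = j := (Prod.ext_iff.1 h).2
    have h1 : Subgroup.inclusion hKL a * pu i = Subgroup.inclusion hKL b * pu j :=
      (Prod.ext_iff.1 h).1
    subst h2
    rw [Subgroup.inclusion_injective hKL (mul_right_cancel h1)]
  obtain ⟨θ, hθi, hθ⟩ := extend hH (MonoidHom.prodMap (MonoidHom.id K) qn)
    (Function.injective_id.prodMap hqinj) (ψ.comp φ₀) (hψi.comp hφ₀)
  refine ⟨θ (1, Multiplicative.ofAdd 1), z, ?_, ?_, ?_⟩
  · intro k hk
    have h1 : θ (⟨k, hk⟩, 1) = k := by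
      have := hθ (⟨k, hk⟩, 1)
      have h2 := hψ ⟨k, hKL hk⟩
      simp [φ₀] at this h2
      rw [this]
      exact h2
    rw [← h1]
    exact (show Commute ((⟨k, hk⟩, 1) : K × W) (1, Multiplicative.ofAdd 1) by
      simp [Commute, SemiconjBy]).map θ
  · intro l hl
    have h2 := hψ ⟨l, hl⟩
    have h3 : ψ (⟨l, hl⟩, 1) = l := h2
    rw [← h3]
    exact (show Commute ((⟨l, hl⟩, 1) : L × Z) (1, Multiplicative.ofAdd 1) by
      simp [Commute, SemiconjBy]).map ψ
  · rw [← map_pow]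
    have h1 := hθ (1, Multiplicative.ofAdd 1)
    have h2 := hqcoe 1
    have h3 := hψ uL
    have h4 : ((1, Multiplicative.ofAdd 1) : K × W) ^ n =
      MonoidHom.prodMap (MonoidHom.id K) qn (1, Multiplicative.ofAdd 1) := by
      simp only [Int.cast_one] at h2
      ext1
      · simp
      · change (Multiplicative.ofAdd (1 : ZMod (n * m))) ^ n = qn (Multiplicative.ofAdd 1)
        rw [h2, ← ofAdd_nsmul]
        simp
    rw [h4, h1]
    have h5 : φ₀ (1, Multiplicative.ofAdd 1) = (uL, 1) * (1, Multiplicative.ofAdd 1) := by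
      simp [φ₀, hpu1]
    rw [MonoidHom.comp_apply, h5, map_mul]
    congr 1

lemma dense_pow (hH : IsHallUniversal H) {U : Set (MulAut H)} (hU : IsOpen U) (hd : Dense U)
    (n : ℕ) (hn : 1 ≤ n) : Dense {f : MulAut H | f ^ n ∈ U} := by
  classical
  rw [dense_iff_inter_open]
  rintro V hV ⟨p, hp⟩
  obtain ⟨A, hA⟩ := exists_finset hV hp
  haveI := finite_closure hH A
  obtain ⟨h, hh⟩ := exists_inner hH p (Subgroup.closure (A : Set H))
  -- perturb the inner automorphism by `h ^ n` into `U`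
  obtain ⟨q, hq1, hqU⟩ := hd.inter_open_nonempty _
    (isOpen_agree (insert h A) (MulAut.conj (h ^ n))) ⟨_, fun x _ => rfl⟩
  obtain ⟨B, hB⟩ := exists_finset hU hqU
  let K := Subgroup.closure ((insert h A : Finset H) : Set H)
  haveI := finite_closure hH (insert h A ∪ B)
  obtain ⟨s, hs⟩ := exists_inner hH q (Subgroup.closure ((insert h A ∪ B : Finset H) : Set H))
  let L := Subgroup.closure ((insert s (insert h A ∪ B) : Finset H) : Set H)
  haveI : Finite L := finite_closure hH _
  have hKL : K ≤ L := Subgroup.closure_mono (by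
    intro x hx
    simp only [Finset.coe_insert, Finset.coe_union, Set.mem_insert_iff, Set.mem_union] at hx ⊢
    tauto)
  have hhK : h ∈ K := Subgroup.subset_closure (by simp)
  have hsL : s ∈ L := Subgroup.subset_closure (by simp)
  have hqK : ∀ x ∈ (insert h A : Finset H), h ^ n * x * (h ^ n)⁻¹ = s * x * s⁻¹ := by
    intro x hx
    rw [← hs x (Subgroup.subset_closure (by
      simp only [Finset.coe_union]; exact Or.inl hx)), hq1 x hx]
    rfl
  obtain ⟨w, z, hw, hz, hwz⟩ := exists_root hH K L hKL ((h ^ n)⁻¹ * s)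
    (L.mul_mem (L.inv_mem (L.pow_mem (hKL hhK) n)) hsL) (by
      have : K ≤ Subgroup.centralizer {(h ^ n)⁻¹ * s} := by
        rw [Subgroup.closure_le]
        intro x hx
        have := hqK x hx
        rw [SetLike.mem_coe, Subgroup.mem_centralizer_singleton_iff]
        have h2 : x = (h ^ n)⁻¹ * (s * x * s⁻¹) * h ^ n := by rw [← this]; group
        calc _ = (h ^ n)⁻¹ * (s * x * s⁻¹) * h ^ n * ((h ^ n)⁻¹ * s) := by rw [← h2]
          _ = _ := by group
      intro k hk
      exact (Subgroup.mem_centralizer_singleton_iff.1 (this hk))) n hn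
  refine ⟨MulAut.conj (h * w), hA _ fun x hx => ?_, hB _ fun x hx => ?_⟩
  · have hxK : x ∈ K := Subgroup.subset_closure (by simp [hx])
    rw [hh x (Subgroup.subset_closure hx), MulAut.conj_apply]
    have := (hw x hxK).eq
    calc _ = h * (w * x) * w⁻¹ * h⁻¹ := by group
      _ = _ := by rw [← this]; group
  · have hxL : x ∈ L := Subgroup.subset_closure (by simp [hx])
    rw [hs x (Subgroup.subset_closure (by simp [hx])), ← map_pow, MulAut.conj_apply,
      (hw h hhK).mul_pow, hwz]
    have := (hz x hxL).eq
    calc _ = s * (z * x) * z⁻¹ * s⁻¹ := by group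
      _ = _ := by rw [← this]; group

end Alg

end HallAux

/-- **Every generic automorphism of a Hall universal group is conjugate to its `n`-th
power** for every `n ≥ 1`.  Here `g ∈ Aut H` is generic if its conjugacy class is
comeager in `Aut H` (topology of pointwise convergence). -/
theorem hallUniversal_generic_conjugate_to_powers
    (H : Type*) [Group H] (hH : IsHallUniversal H) (g : MulAut H)
    (hg : {h : MulAut H | ∃ f : MulAut H, h = f * g * f⁻¹} ∈ residual (MulAut H))
    (n : ℕ) (hn : 1 ≤ n) :
    ∃ f : MulAut H, f * g * f⁻¹ = g ^ n := by
  haveI := hH.countable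
  haveI : BaireSpace (MulAut H) := HallAux.baire
  have hg2 : {f : MulAut H | f ^ n ∈ {h : MulAut H | ∃ f : MulAut H, h = f * g * f⁻¹}} ∈
      residual (MulAut H) := by
    obtain ⟨S, hSo, hSd, hSc, hS⟩ := mem_residual_iff.1 hg
    have : ⋂ U ∈ S, {f : MulAut H | f ^ n ∈ U} ∈ residual (MulAut H) :=
      (countable_bInter_mem hSc).2 fun U hU =>
        residual_of_dense_open (HallAux.isOpen_pow (hSo U hU) n)
          (HallAux.dense_pow hH (hSo U hU) (hSd U hU) n hn)
    refine Filter.mem_of_superset this fun f hf => hS ?_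
    simpa using hf
  obtain ⟨f, ⟨a, ha⟩, ⟨b, hb⟩⟩ := (dense_of_mem_residual (Filter.inter_mem hg hg2)).nonempty
  refine ⟨a⁻¹ * b, ?_⟩
  rw [ha, conj_pow] at hb
  calc _ = a⁻¹ * (b * g * b⁻¹) * a := by group
    _ = _ := by rw [← hb]; group
end
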